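/- For every real critical exponent α > 1 and every integer k ≥ 2 the renormalization operator with period-k combinatorics has a fixed point: there exist a unimodal map f with critical exponent α, a number s ∈ (0,1), and a sign ε ∈ {-1,+1} such that the k intervals f^i([-s,s]), 0 ≤ i ≤ k-1, have pairwise disjoint interiors, f^k([-s,s]) ⊆ [-s,s], and ε·f^k(ε·s·x)/s = f(x) for all x ∈ [-1,1] (i.e. the first return map f^k to [-s,s], rescaled affinely, equals f itself). -/

import Mathlib

/-- The canonical folding map with critical exponent `α` and peak-value `t`:
`q_t(x) = -2t|x|^α + 2t - 1` (here `^` is the real power). -/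
noncomputable def foldMap (α t x : ℝ) : ℝ := -2 * t * |x| ^ α + 2 * t - 1

/-- `IsDiffeo φ d1 d2` : `φ` is an orientation-preserving C² diffeomorphism of `[-1,1]`
onto itself fixing the endpoints, with first derivative `d1 > 0` and continuous second
derivative `d2`. -/
def IsDiffeo (φ d1 d2 : ℝ → ℝ) : Prop :=
  Set.BijOn φ (Set.Icc (-1 : ℝ) 1) (Set.Icc (-1 : ℝ) 1) ∧
  φ (-1) = -1 ∧ φ 1 = 1 ∧
  (∀ x ∈ Set.Icc (-1 : ℝ) 1, HasDerivWithinAt φ (d1 x) (Set.Icc (-1 : ℝ) 1) x) ∧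
  (∀ x ∈ Set.Icc (-1 : ℝ) 1, HasDerivWithinAt d1 (d2 x) (Set.Icc (-1 : ℝ) 1) x) ∧
  ContinuousOn d2 (Set.Icc (-1 : ℝ) 1) ∧
  (∀ x ∈ Set.Icc (-1 : ℝ) 1, 0 < d1 x)

/-- `f` is a unimodal map with critical exponent `α`: `f = φ ∘ q_t` with `φ` an
orientation-preserving C² diffeomorphism of `[-1,1]` fixing the endpoints and
`t ∈ [0,1]` a peak-value. -/
def IsUnimodal (α : ℝ) (f : ℝ → ℝ) : Prop :=
  ∃ φ d1 d2 : ℝ → ℝ, ∃ t ∈ Set.Icc (0 : ℝ) 1,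
    IsDiffeo φ d1 d2 ∧ ∀ x, f x = φ (foldMap α t x)

namespace Renorm

section Scarf
variable {T I : Type*}

/-- A pair `(σ, C)` is dominant for the utilities `u` if no `y` strictly improves on the worst
element of `σ` with respect to all `i ∈ C` at once. -/
def Dominant (u : I → T → ℕ) (σ : Finset T) (C : Finset I) : Prop :=
  ∀ y, ∃ i ∈ C, ∀ x ∈ σ, u i y ≤ u i x

lemma Dominant.mono {u : I → T → ℕ} {σ σ' : Finset T} {C C' : Finset I} (h : Dominant u σ C)
    (hσ : σ' ⊆ σ) (hC : C ⊆ C') : Dominant u σ' C' := fun y =>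
  let ⟨i, hi, hx⟩ := h y
  ⟨i, hC hi, fun x hx' => hx x (hσ hx')⟩

variable [Fintype T] [DecidableEq T] [Fintype I] [DecidableEq I]

open Classical in
lemma card_rooms_of_door {u : I → T → ℕ} (hu : ∀ i, Function.Injective (u i))
    {τ : Finset T} {D : Finset I} (hτ : τ.Nonempty) (hd : Dominant u τ D)
    (hcard : D.card = τ.card + 1) :
    (Finset.univ.filter (fun p : Finset T × Finset I =>
      (Dominant u p.1 p.2 ∧ p.1.card = p.2.card) ∧ τ ⊆ p.1 ∧ p.2 ⊆ D)).card = 2 := by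
  have hm : ∀ i, ∃ x ∈ τ, ∀ x' ∈ τ, u i x ≤ u i x' := fun i =>
    Finset.exists_min_image τ (u i) hτ
  choose m hmτ hm using hm
  have muniq : ∀ i x, x ∈ τ → (∀ x' ∈ τ, u i x ≤ u i x') → m i = x := fun i x hx h =>
    hu i (le_antisymm (hm i x hx) (h _ (hmτ i)))
  have hdm : ∀ y, ∃ i ∈ D, u i y ≤ u i (m i) := fun y =>
    let ⟨i, hi, h⟩ := hd y
    ⟨i, hi, h _ (hmτ i)⟩
  have hsurj : ∀ x ∈ τ, ∃ i ∈ D, m i = x := fun x hx =>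
    let ⟨i, hi, h⟩ := hd x
    ⟨i, hi, muniq i x hx h⟩
  obtain ⟨a, ha, b, hb, hab, hmab⟩ := Finset.exists_ne_map_eq_of_card_lt_of_maps_to
    (s := D) (t := τ) (by omega) (f := m) (fun i _ => hmτ i)
  set S := Finset.univ.filter (fun p : Finset T × Finset I =>
      (Dominant u p.1 p.2 ∧ p.1.card = p.2.card) ∧ τ ⊆ p.1 ∧ p.2 ⊆ D) with hS
  have memS : ∀ p, p ∈ S ↔ ((Dominant u p.1 p.2 ∧ p.1.card = p.2.card) ∧ τ ⊆ p.1 ∧ p.2 ⊆ D) := by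
    intro p; simp [hS]
  let Ty : I → Finset T × Finset I → Prop := fun j p =>
    p = (τ, D.erase j) ∨ ∃ x, x ∉ τ ∧ p = (insert x τ, D) ∧
      ∀ i ∈ D, i ≠ j → u i (m i) < u i x
  have ex : ∀ j j', j ∈ D → j' ∈ D → j ≠ j' → m j = m j' → ∃ p ∈ S, Ty j p := by
    intro j j' hj hj' hjj hmj
    by_cases hM : ∃ x, ∀ i ∈ D, i ≠ j → u i (m i) < u i x
    · obtain ⟨x, hx, hmax⟩ := Finset.exists_max_image
        (Finset.univ.filter (fun x => ∀ i ∈ D, i ≠ j → u i (m i) < u i x)) (u j)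
        (by obtain ⟨x, hx⟩ := hM; exact ⟨x, by simpa using hx⟩)
      have hx' : ∀ i ∈ D, i ≠ j → u i (m i) < u i x := by simpa using hx
      have hxτ : x ∉ τ := by
        intro hxτ
        obtain ⟨i, hi, hix⟩ := hsurj x hxτ
        by_cases hij : i = j
        · have := hx' j' hj' (Ne.symm hjj)
          rw [← hmj, ← hij, hix] at this
          exact lt_irrefl _ this
        · have := hx' i hi hij
          rw [hix] at this
          exact lt_irrefl _ this
      refine ⟨(insert x τ, D), (memS _).2 ⟨⟨?_, ?_⟩, ?_, ?_⟩, Or.inr ⟨x, hxτ, rfl, hx'⟩⟩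
      · intro y
        by_contra hcon
        push Not at hcon
        have hy : ∀ i ∈ D, i ≠ j → u i (m i) < u i y := by
          intro i hi hij
          obtain ⟨z, hz, hzy⟩ := hcon i hi
          rcases Finset.mem_insert.1 hz with rfl | hz
          · exact (hx' i hi hij).trans hzy
          · exact (hm i z hz).trans_lt hzy
        have hyx : u j y ≤ u j x := hmax y (by simpa using hy)
        obtain ⟨z, hz, hzy⟩ := hcon j hj
        rcases Finset.mem_insert.1 hz with rfl | hz
        · omega
        · have h1 := hm j z hz
          obtain ⟨i, hi, hix⟩ := hdm x
          by_cases hij : i = j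
          · subst hij; omega
          · have := hx' i hi hij; omega
      · simp [hxτ, hcard]
      · exact Finset.subset_insert _ _
      · exact subset_rfl
    · push Not at hM
      refine ⟨(τ, D.erase j), (memS _).2 ⟨⟨?_, ?_⟩, subset_rfl, Finset.erase_subset _ _⟩, Or.inl rfl⟩
      · intro y
        obtain ⟨i, hi, hij, h⟩ := hM y
        exact ⟨i, Finset.mem_erase.2 ⟨hij, hi⟩, fun x hx => h.trans (hm i x hx)⟩
      · simp [Finset.card_erase_of_mem hj, hcard]
  have uniq : ∀ j p p', p ∈ S → p' ∈ S → Ty j p → Ty j p' → p = p' := by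
    have mixed : ∀ j x, (τ, D.erase j) ∈ S → ¬ ∀ i ∈ D, i ≠ j → u i (m i) < u i x := by
      intro j x h1 h2
      obtain ⟨i, hi, h⟩ := ((memS _).1 h1).1.1 x
      have hi := Finset.mem_erase.1 hi
      have := h2 i hi.2 hi.1
      have := h _ (hmτ i)
      omega
    have half : ∀ j x x', (insert x τ, D) ∈ S → (∀ i ∈ D, i ≠ j → u i (m i) < u i x') →
        u j x' ≤ u j x := by
      intro j x x' h1 h2
      obtain ⟨i, hi, h⟩ := ((memS _).1 h1).1.1 x'
      by_cases hij : i = j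
      · subst hij; exact h x (Finset.mem_insert_self _ _)
      · have := h2 i hi hij
        have := h _ (Finset.mem_insert_of_mem (hmτ i))
        omega
    rintro j p p' hp hp' (rfl | ⟨x, hx, rfl, hxx⟩) (rfl | ⟨x', hx', rfl, hxx'⟩)
    · rfl
    · exact absurd hxx' (mixed j x' hp)
    · exact absurd hxx (mixed j x hp')
    · have : x = x' := hu j (le_antisymm (half j x' x hp' hxx) (half j x x' hp hxx'))
      rw [this]
  have cover : ∀ p ∈ S, Ty a p ∨ Ty b p := by
    rintro ⟨σ, C⟩ hp
    obtain ⟨⟨hdom, hc⟩, hτσ, hCD⟩ := (memS _).1 hp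
    simp only at hdom hc hτσ hCD
    have h1 := Finset.card_le_card hτσ
    have h2 := Finset.card_le_card hCD
    by_cases hcase : C.card = D.card
    · obtain rfl : C = D := Finset.eq_of_subset_of_card_le hCD hcase.ge
      have : (σ \ τ).card = 1 := by rw [Finset.card_sdiff_of_subset hτσ]; omega
      obtain ⟨x, hx⟩ := Finset.card_eq_one.1 this
      have hxτ : x ∉ τ := by
        have : x ∈ σ \ τ := by rw [hx]; simp
        exact (Finset.mem_sdiff.1 this).2
      obtain rfl : σ = insert x τ := by
        rw [← Finset.sdiff_union_of_subset hτσ, hx]; rfl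
      have hm' : ∀ i, ∃ z ∈ insert x τ, ∀ x' ∈ insert x τ, u i z ≤ u i x' := fun i =>
        Finset.exists_min_image _ (u i) (Finset.insert_nonempty _ _)
      choose m' hmτ' hm' using hm'
      have inj : Set.InjOn m' C := by
        rw [← Finset.card_image_iff]
        refine le_antisymm Finset.card_image_le ?_
        rw [← hc]
        refine Finset.card_le_card fun z hz => ?_
        obtain ⟨i, hi, h⟩ := hdom z
        exact Finset.mem_image.2 ⟨i, hi, hu i (le_antisymm (hm' i z hz) (h _ (hmτ' i)))⟩
      obtain ⟨j, hj, hjx⟩ := hdom x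
      have hjx' : m' j = x := hu j (le_antisymm (hm' j x (Finset.mem_insert_self _ _)) (hjx _ (hmτ' j)))
      have key : ∀ i ∈ C, i ≠ j → m' i = m i ∧ u i (m i) < u i x := by
        intro i hi hij
        have hne : m' i ≠ x := fun h => hij (inj hi hj (h.trans hjx'.symm))
        have hmem : m' i ∈ τ := by
          rcases Finset.mem_insert.1 (hmτ' i) with h | h
          · exact absurd h hne
          · exact h
        have heq : m i = m' i := muniq i _ hmem fun x' hx' => hm' i x' (Finset.mem_insert_of_mem hx')
        refine ⟨heq.symm, ?_⟩
        rw [heq]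
        exact lt_of_le_of_ne (hm' i x (Finset.mem_insert_self _ _)) fun h => hne (hu i h)
      by_cases hja : j = a
      · subst hja; exact Or.inl (Or.inr ⟨x, hxτ, rfl, fun i hi hij => (key i hi hij).2⟩)
      by_cases hjb : j = b
      · subst hjb; exact Or.inr (Or.inr ⟨x, hxτ, rfl, fun i hi hij => (key i hi hij).2⟩)
      exact absurd (inj ha hb (((key a ha (Ne.symm hja)).1.trans hmab).trans
        (key b hb (Ne.symm hjb)).1.symm)) hab
    · obtain rfl : τ = σ := Finset.eq_of_subset_of_card_le hτσ (by omega)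
      have : (D \ C).card = 1 := by rw [Finset.card_sdiff_of_subset hCD]; omega
      obtain ⟨j, hj⟩ := Finset.card_eq_one.1 this
      obtain rfl : C = D.erase j := by
        rw [← Finset.sdiff_singleton_eq_erase, ← hj, Finset.sdiff_sdiff_eq_self hCD]
      have inj : Set.InjOn m (D.erase j : Finset I) := by
        rw [← Finset.card_image_iff]
        refine le_antisymm Finset.card_image_le ?_
        rw [← hc]
        refine Finset.card_le_card fun z hz => ?_
        obtain ⟨i, hi, h⟩ := hdom z
        exact Finset.mem_image.2 ⟨i, hi, muniq i z hz h⟩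
      by_cases hja : j = a
      · subst hja; exact Or.inl (Or.inl rfl)
      by_cases hjb : j = b
      · subst hjb; exact Or.inr (Or.inl rfl)
      exact absurd (inj (Finset.mem_coe.2 (Finset.mem_erase.2 ⟨Ne.symm hja, ha⟩))
        (Finset.mem_coe.2 (Finset.mem_erase.2 ⟨Ne.symm hjb, hb⟩)) hmab) hab
  have disj : ∀ p, Ty a p → ¬ Ty b p := by
    rintro p (rfl | ⟨x, hx, rfl, hxx⟩) (h | ⟨x', hx', h, hxx'⟩)
    · have h := congrArg Prod.snd h
      simp only at h
      have : b ∈ D.erase a := Finset.mem_erase.2 ⟨Ne.symm hab, hb⟩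
      rw [h] at this
      simp at this
    · have h := congrArg Prod.fst h
      simp only at h
      exact hx' (h ▸ Finset.mem_insert_self _ _)
    · have h := congrArg Prod.fst h
      simp only at h
      exact hx (h ▸ Finset.mem_insert_self _ _)
    · have h := congrArg Prod.fst h
      simp only at h
      have : x = x' := by
        have : x ∈ insert x' τ := h ▸ Finset.mem_insert_self _ _
        exact (Finset.mem_insert.1 this).resolve_right hx
      subst this
      obtain ⟨i, hi, hix⟩ := hdm x
      by_cases hia : i = a
      · have := hxx' i hi (by rw [hia]; exact hab); omega
      · have := hxx i hi hia; omega
  obtain ⟨pa, hpa, hTa⟩ := ex a b ha hb hab hmab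
  obtain ⟨pb, hpb, hTb⟩ := ex b a hb ha (Ne.symm hab) hmab.symm
  refine Finset.card_eq_two.2 ⟨pa, pb, fun h => disj pa hTa (h ▸ hTb), ?_⟩
  ext p
  rw [Finset.mem_insert, Finset.mem_singleton]
  constructor
  · intro hp
    rcases cover p hp with h | h
    · exact Or.inl (uniq a _ _ hp hpa h hTa)
    · exact Or.inr (uniq b _ _ hp hpb h hTb)
  · rintro (rfl | rfl)
    · exact hpa
    · exact hpb
end Scarf
end Renorm

namespace Renorm

section Scarf
variable {T I : Type*} [Fintype T] [DecidableEq T] [Fintype I] [DecidableEq I]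

open Classical in
lemma even_card_doors_of_room {u : I → T → ℕ} {c : T → I} {i₀ : I}
    {σ : Finset T} {C : Finset I} (hd : Dominant u σ C)
    (hcard : σ.card = C.card) (hne : σ.image c ≠ C) :
    Even (Finset.univ.filter (fun d : Finset T × Finset I =>
      (Dominant u d.1 d.2 ∧ d.2.card = d.1.card + 1 ∧ i₀ ∈ d.2 ∧ d.1.image c = d.2.erase i₀) ∧
        d.1 ⊆ σ ∧ C ⊆ d.2)).card := by
  set S := Finset.univ.filter (fun d : Finset T × Finset I =>
      (Dominant u d.1 d.2 ∧ d.2.card = d.1.card + 1 ∧ i₀ ∈ d.2 ∧ d.1.image c = d.2.erase i₀) ∧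
        d.1 ⊆ σ ∧ C ⊆ d.2) with hS
  have memS : ∀ d, d ∈ S ↔ ((Dominant u d.1 d.2 ∧ d.2.card = d.1.card + 1 ∧ i₀ ∈ d.2 ∧
      d.1.image c = d.2.erase i₀) ∧ d.1 ⊆ σ ∧ C ⊆ d.2) := by
    intro d; simp [hS]
  have form : ∀ d ∈ S, (∃ y ∈ σ, d = (σ.erase y, C)) ∨ (∃ j, j ∉ C ∧ d = (σ, insert j C)) := by
    rintro ⟨τ, D⟩ hdS
    obtain ⟨⟨-, h1, -, -⟩, h2, h3⟩ := (memS _).1 hdS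
    simp only at h1 h2 h3
    have h4 := Finset.card_le_card h2
    have h5 := Finset.card_le_card h3
    by_cases hcase : C.card = D.card
    · left
      obtain rfl : C = D := Finset.eq_of_subset_of_card_le h3 hcase.ge
      have : (σ \ τ).card = 1 := by rw [Finset.card_sdiff_of_subset h2]; omega
      obtain ⟨y, hy⟩ := Finset.card_eq_one.1 this
      refine ⟨y, ?_, ?_⟩
      · have : y ∈ σ \ τ := by rw [hy]; simp
        exact (Finset.mem_sdiff.1 this).1
      · rw [← Finset.sdiff_singleton_eq_erase, ← hy, Finset.sdiff_sdiff_eq_self h2]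
    · right
      obtain rfl : τ = σ := Finset.eq_of_subset_of_card_le h2 (by omega)
      have : (D \ C).card = 1 := by rw [Finset.card_sdiff_of_subset h3]; omega
      obtain ⟨j, hj⟩ := Finset.card_eq_one.1 this
      refine ⟨j, ?_, ?_⟩
      · have : j ∈ D \ C := by rw [hj]; simp
        exact (Finset.mem_sdiff.1 this).2
      · rw [← Finset.sdiff_union_of_subset h3, hj]; rfl
  rcases S.eq_empty_or_nonempty with hE | ⟨d, hdS⟩
  · rw [hE]; simp
  have key : i₀ ∈ C ∧ C.erase i₀ ⊆ σ.image c := by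
    rcases form d hdS with ⟨y, hy, rfl⟩ | ⟨j, hj, rfl⟩
    · obtain ⟨⟨-, -, h1, h2⟩, -, -⟩ := (memS _).1 hdS
      simp only at h1 h2
      exact ⟨h1, h2 ▸ Finset.image_subset_image (Finset.erase_subset _ _)⟩
    · obtain ⟨⟨-, -, h1, h2⟩, -, -⟩ := (memS _).1 hdS
      simp only at h1 h2
      refine ⟨?_, ?_⟩
      · rcases Finset.mem_insert.1 h1 with rfl | h
        · rw [Finset.erase_insert hj] at h2
          exact absurd h2 hne
        · exact h
      · rw [h2]
        exact Finset.erase_subset_erase _ (Finset.subset_insert _ _)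
  obtain ⟨hi₀, hsub⟩ := key
  have hKle : (σ.image c).card ≤ C.card := hcard ▸ Finset.card_image_le
  have hi₀K : i₀ ∉ σ.image c := by
    intro h
    refine hne (Finset.eq_of_subset_of_card_le (fun i hi => ?_) hKle).symm
    by_cases hii : i = i₀
    · exact hii ▸ h
    · exact hsub (Finset.mem_erase.2 ⟨hii, hi⟩)
  have hCe : (C.erase i₀).card + 1 = C.card := Finset.card_erase_add_one hi₀
  suffices S.card = 2 by rw [this]; exact even_two
  by_cases hcase : σ.image c = C.erase i₀
  · obtain ⟨x, hx, x', hx', hxx, hcx⟩ := Finset.exists_ne_map_eq_of_card_lt_of_maps_to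
      (s := σ) (t := C.erase i₀) (by omega) (f := c)
      (fun i hi => hcase ▸ Finset.mem_image_of_mem _ hi)
    have mk : ∀ x x', x ∈ σ → x' ∈ σ → x ≠ x' → c x = c x' → (σ.erase x, C) ∈ S := by
      intro x x' hx hx' hxx hcx
      refine (memS _).2 ⟨⟨hd.mono (Finset.erase_subset _ _) subset_rfl, ?_, hi₀, ?_⟩,
        Finset.erase_subset _ _, subset_rfl⟩
      · simp only
        rw [Finset.card_erase_add_one hx, hcard]
      · simp only
        rw [← hcase]
        refine le_antisymm (Finset.image_subset_image (Finset.erase_subset _ _)) fun z hz => ?_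
        obtain ⟨y, hy, rfl⟩ := Finset.mem_image.1 hz
        by_cases hyx : y = x
        · subst hyx
          rw [hcx]
          exact Finset.mem_image_of_mem _ (Finset.mem_erase.2 ⟨Ne.symm hxx, hx'⟩)
        · exact Finset.mem_image_of_mem _ (Finset.mem_erase.2 ⟨hyx, hy⟩)
    refine Finset.card_eq_two.2 ⟨(σ.erase x, C), (σ.erase x', C), ?_, ?_⟩
    · intro h
      have h := congrArg Prod.fst h
      simp only at h
      have : x' ∈ σ.erase x := Finset.mem_erase.2 ⟨Ne.symm hxx, hx'⟩
      rw [h] at this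
      simp at this
    · ext e
      rw [Finset.mem_insert, Finset.mem_singleton]
      constructor
      · intro he
        rcases form e he with ⟨y, hy, rfl⟩ | ⟨j, hj, rfl⟩
        · obtain ⟨⟨-, h1, -, h2⟩, -, -⟩ := (memS _).1 he
          simp only at h1 h2
          have inj : Set.InjOn c (σ.erase y : Finset T) := by
            rw [← Finset.card_image_iff, h2]; omega
          by_cases hyx : y = x
          · exact Or.inl (by rw [hyx])
          by_cases hyx' : y = x'
          · exact Or.inr (by rw [hyx'])
          exact absurd (inj (Finset.mem_coe.2 (Finset.mem_erase.2 ⟨Ne.symm hyx, hx⟩))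
            (Finset.mem_coe.2 (Finset.mem_erase.2 ⟨Ne.symm hyx', hx'⟩)) hcx) hxx
        · obtain ⟨⟨-, h1, h3, h2⟩, -, -⟩ := (memS _).1 he
          simp only at h1 h2 h3
          have := Finset.card_erase_add_one h3
          rw [← h2, hcase] at this
          omega
      · rintro (rfl | rfl)
        · exact mk x x' hx hx' hxx hcx
        · exact mk x' x hx' hx (Ne.symm hxx) hcx.symm
  · have hKcard : (σ.image c).card = C.card := by
      have h1 := Finset.card_le_card hsub
      have h2 : (σ.image c).card ≠ (C.erase i₀).card := fun h =>
        hcase (Finset.eq_of_subset_of_card_le hsub h.le).symm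
      omega
    have inj : Set.InjOn c σ := by rw [← Finset.card_image_iff]; omega
    have : (σ.image c \ C.erase i₀).card = 1 := by rw [Finset.card_sdiff_of_subset hsub]; omega
    obtain ⟨j, hj⟩ := Finset.card_eq_one.1 this
    have hjm : j ∈ σ.image c \ C.erase i₀ := by rw [hj]; simp
    obtain ⟨hjK, hjC⟩ := Finset.mem_sdiff.1 hjm
    have hji : j ≠ i₀ := fun h => hi₀K (h ▸ hjK)
    have hjC : j ∉ C := fun h => hjC (Finset.mem_erase.2 ⟨hji, h⟩)
    have hK : σ.image c = insert j (C.erase i₀) := by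
      rw [← Finset.sdiff_union_of_subset hsub, hj]; rfl
    obtain ⟨x, hx, hxj⟩ := Finset.mem_image.1 hjK
    refine Finset.card_eq_two.2 ⟨(σ.erase x, C), (σ, insert j C), ?_, ?_⟩
    · intro h
      have h := congrArg Prod.snd h
      simp only at h
      exact hjC (h ▸ Finset.mem_insert_self _ _)
    · ext e
      rw [Finset.mem_insert, Finset.mem_singleton]
      constructor
      · intro he
        rcases form e he with ⟨y, hy, rfl⟩ | ⟨j', hj', rfl⟩
        · left
          obtain ⟨⟨-, h1, -, h2⟩, -, -⟩ := (memS _).1 he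
          simp only at h1 h2
          by_contra hyx
          have hyx : x ≠ y := fun h => hyx (by rw [h])
          have : j ∈ C.erase i₀ := by
            rw [← h2, ← hxj]
            exact Finset.mem_image_of_mem _ (Finset.mem_erase.2 ⟨hyx, hx⟩)
          exact hjC (Finset.mem_erase.1 this).2
        · right
          obtain ⟨⟨-, h1, h3, h2⟩, -, -⟩ := (memS _).1 he
          simp only at h1 h2 h3
          rw [h2] at hjK
          rcases Finset.mem_insert.1 (Finset.mem_erase.1 hjK).2 with h | h
          · rw [h]
          · exact absurd h hjC
      · rintro (rfl | rfl)
        · refine (memS _).2 ⟨⟨hd.mono (Finset.erase_subset _ _) subset_rfl, ?_, hi₀, ?_⟩,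
            Finset.erase_subset _ _, subset_rfl⟩
          · simp only
            rw [Finset.card_erase_add_one hx, hcard]
          · simp only
            have h1 : (σ.erase x).image c = (σ.image c).erase (c x) := by
              ext z
              simp only [Finset.mem_image, Finset.mem_erase]
              constructor
              · rintro ⟨y, ⟨hyx, hy⟩, rfl⟩
                exact ⟨fun h => hyx (inj hy hx h), y, hy, rfl⟩
              · rintro ⟨hz, y, hy, rfl⟩
                exact ⟨y, ⟨fun h => hz (by rw [h]), hy⟩, rfl⟩
            rw [h1, hxj, hK, Finset.erase_insert]
            exact fun h => hjC (Finset.mem_erase.1 h).2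
        · refine (memS _).2 ⟨⟨hd.mono subset_rfl (Finset.subset_insert _ _), ?_,
            Finset.mem_insert_of_mem hi₀, ?_⟩, subset_rfl, Finset.subset_insert _ _⟩
          · simp only
            rw [Finset.card_insert_of_notMem hjC, hcard]
          · simp only
            rw [hK, Finset.erase_insert_of_ne hji]

open Classical in
/-- **Scarf's lemma**: a colouring of a finite set ordered by finitely many injective utilities
admits a dominant pair `(σ, C)` in which `C` is exactly the set of colours of `σ`. -/
theorem exists_dominant_colorful [Nonempty T] [Nonempty I] {u : I → T → ℕ}
    (hu : ∀ i, Function.Injective (u i)) (c : T → I) :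
    ∃ σ C, σ.Nonempty ∧ Dominant u σ C ∧ σ.image c = C := by
  by_contra hcon
  push Not at hcon
  obtain ⟨i₀⟩ := ‹Nonempty I›
  set R := Finset.univ.filter (fun p : Finset T × Finset I =>
      Dominant u p.1 p.2 ∧ p.1.card = p.2.card) with hR
  set Dr := Finset.univ.filter (fun d : Finset T × Finset I =>
      Dominant u d.1 d.2 ∧ d.2.card = d.1.card + 1 ∧ i₀ ∈ d.2 ∧ d.1.image c = d.2.erase i₀)
    with hDr
  have hcount := Finset.sum_card_bipartiteAbove_eq_sum_card_bipartiteBelow (s := R) (t := Dr)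
    (fun p d => d.1 ⊆ p.1 ∧ p.2 ⊆ d.2)
  have hL : Even (∑ p ∈ R, (Finset.bipartiteAbove
      (fun (p d : Finset T × Finset I) => d.1 ⊆ p.1 ∧ p.2 ⊆ d.2) Dr p).card) := by
    refine Finset.even_sum _ fun p hp => ?_
    obtain ⟨h1, h2⟩ : Dominant u p.1 p.2 ∧ p.1.card = p.2.card := by simpa [hR] using hp
    have hne : p.1.image c ≠ p.2 := by
      refine hcon _ _ ?_ h1
      obtain ⟨y⟩ := ‹Nonempty T›
      obtain ⟨i, hi, -⟩ := h1 y
      rw [← Finset.card_pos, h2, Finset.card_pos]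
      exact ⟨i, hi⟩
    have := even_card_doors_of_room (i₀ := i₀) h1 h2 hne
    rwa [Finset.bipartiteAbove, hDr, Finset.filter_filter]
  have hout : ((∅ : Finset T), ({i₀} : Finset I)) ∈ Dr := by
    exact Finset.mem_filter.2 ⟨Finset.mem_univ _, fun y => ⟨i₀, by simp, by simp⟩, by simp,
      by simp, by simp⟩
  have heven : ∀ d ∈ Dr.erase (∅, {i₀}), Even (Finset.bipartiteBelow
      (fun (p d : Finset T × Finset I) => d.1 ⊆ p.1 ∧ p.2 ⊆ d.2) R d).card := by
    intro d hd
    obtain ⟨hne, hd⟩ := Finset.mem_erase.1 hd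
    obtain ⟨h1, h2, h3, h4⟩ : Dominant u d.1 d.2 ∧ d.2.card = d.1.card + 1 ∧ i₀ ∈ d.2 ∧
      d.1.image c = d.2.erase i₀ := by simpa [hDr] using hd
    have hτ : d.1.Nonempty := by
      rw [Finset.nonempty_iff_ne_empty]
      intro h
      apply hne
      rw [h, Finset.card_empty, zero_add, Finset.card_eq_one] at h2
      obtain ⟨j, hj⟩ := h2
      rw [hj, Finset.mem_singleton] at h3
      exact Prod.ext h (by rw [hj, h3])
    have := card_rooms_of_door hu hτ h1 h2
    rw [Finset.bipartiteBelow, hR, Finset.filter_filter, this]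
    exact even_two
  have hone : (Finset.bipartiteBelow
      (fun (p d : Finset T × Finset I) => d.1 ⊆ p.1 ∧ p.2 ⊆ d.2) R (∅, {i₀})).card = 1 := by
    obtain ⟨x, -, hx⟩ := Finset.exists_max_image (Finset.univ : Finset T) (u i₀)
      Finset.univ_nonempty
    refine Finset.card_eq_one.2 ⟨({x}, {i₀}), ?_⟩
    ext ⟨σ, C⟩
    simp only [Finset.mem_bipartiteBelow, hR, Finset.mem_filter, Finset.mem_univ, true_and,
      Finset.empty_subset, Finset.mem_singleton, Prod.mk.injEq]
    constructor
    · rintro ⟨⟨h1, h2⟩, h3⟩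
      obtain ⟨i, hi, h⟩ := h1 x
      have hC : C = {i₀} := by
        refine Finset.Subset.antisymm h3 ?_
        rw [Finset.singleton_subset_iff]
        have := Finset.mem_singleton.1 (h3 hi)
        rwa [← this]
      rw [hC, Finset.card_singleton, Finset.card_eq_one] at h2
      obtain ⟨y, rfl⟩ := h2
      refine ⟨?_, hC⟩
      have h := h y (Finset.mem_singleton_self y)
      have hi : i = i₀ := Finset.mem_singleton.1 (h3 hi)
      rw [hi] at h
      rw [hu i₀ (le_antisymm h (hx y (Finset.mem_univ _)))]
    · rintro ⟨rfl, rfl⟩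
      refine ⟨⟨fun y => ⟨i₀, Finset.mem_singleton_self _, ?_⟩, by simp⟩, subset_rfl⟩
      simpa using hx y (Finset.mem_univ _)
  rw [← Finset.add_sum_erase _ _ hout, hone] at hcount
  rw [hcount] at hL
  have := Finset.even_sum _ heven
  rw [Nat.even_add] at hL
  simp [this] at hL

end Scarf
end Renorm

namespace Renorm

open Filter Topology

section Brouwer

/-- Integer points of the simplex of size `N`. -/
abbrev LatticeSimplex (ι : Type*) [Fintype ι] (N : ℕ) : Type _ :=
  {a : ι → Fin (N + 1) // ∑ i, (a i : ℕ) = N}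

variable {ι : Type*} [Fintype ι] [DecidableEq ι] [Nonempty ι]

lemma exists_latticeSimplex_ge {N : ℕ} (b : ι → ℕ) (hb : ∑ i, b i ≤ N) :
    ∃ y : LatticeSimplex ι N, ∀ i, b i ≤ y.1 i := by
  obtain ⟨i₀⟩ := ‹Nonempty ι›
  let y : ι → ℕ := fun i => b i + if i = i₀ then N - ∑ j, b j else 0
  have hy : ∑ i, y i = N := by
    simp only [y, Finset.sum_add_distrib, Finset.sum_ite_eq', Finset.mem_univ, if_true]
    omega
  have hle : ∀ i, y i < N + 1 := fun i => by
    have := Finset.single_le_sum (f := y) (fun j _ => Nat.zero_le _) (Finset.mem_univ i)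
    omega
  exact ⟨⟨fun i => ⟨y i, hle i⟩, hy⟩, fun i => Nat.le_add_right _ _⟩

/-- Combinatorial core of Brouwer's theorem. -/
lemma exists_lattice_near (N : ℕ) (c : LatticeSimplex ι N → ι) :
    ∃ x₀ : LatticeSimplex ι N, ∀ i, (x₀.1 i : ℕ) ≤ Fintype.card ι ∨
      ∃ x : LatticeSimplex ι N, c x = i ∧
        ∀ j, (x₀.1 j : ℕ) ≤ x.1 j + Fintype.card ι ∧ (x.1 j : ℕ) ≤ x₀.1 j + Fintype.card ι := by
  classical
  obtain ⟨y₀, -⟩ := exists_latticeSimplex_ge (ι := ι) (N := N) (fun _ => 0) (by simp)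
  have : Nonempty (LatticeSimplex ι N) := ⟨y₀⟩
  set M := Fintype.card (LatticeSimplex ι N) with hM
  let e : LatticeSimplex ι N ≃ Fin M := Fintype.equivFin _
  let u : ι → LatticeSimplex ι N → ℕ := fun i a => a.1 i * M + e a
  have hu : ∀ i, Function.Injective (u i) := by
    intro i a b hab
    have h : (u i a) % M = (u i b) % M := by rw [hab]
    simp only [u, Nat.mul_add_mod_self_right] at h
    rw [Nat.mod_eq_of_lt (e a).2, Nat.mod_eq_of_lt (e b).2] at h
    exact e.injective (Fin.ext h)
  obtain ⟨σ, C, hσ, hdom, himg⟩ := exists_dominant_colorful hu c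
  have hm : ∀ i, ∃ x ∈ σ, ∀ x' ∈ σ, (x.1 i : ℕ) ≤ x'.1 i := fun i =>
    Finset.exists_min_image σ (fun x => (x.1 i : ℕ)) hσ
  choose m hmσ hm using hm
  have key : N < ∑ i ∈ C, (((m i).1 i : ℕ) + 1) := by
    by_contra! hcon
    obtain ⟨y, hy⟩ := exists_latticeSimplex_ge (ι := ι) (N := N)
      (fun i => if i ∈ C then ((m i).1 i : ℕ) + 1 else 0) (by
        rw [Finset.sum_ite_mem, Finset.univ_inter]; exact hcon)
    obtain ⟨i, hi, h⟩ := hdom y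
    have h1 := h _ (hmσ i)
    have h2 := hy i
    rw [if_pos hi] at h2
    have h3 := (e (m i)).2
    simp only [u] at h1
    have h4 : (((m i).1 i : ℕ) + 1) * M ≤ y.1 i * M := Nat.mul_le_mul_right _ h2
    rw [add_mul, one_mul] at h4
    omega
  rw [Finset.sum_add_distrib, Finset.sum_const, smul_eq_mul, mul_one] at key
  have hCn : C.card ≤ Fintype.card ι := Finset.card_le_univ _
  have hout : ∀ x ∈ σ, ∀ j ∉ C, (x.1 j : ℕ) ≤ Fintype.card ι := by
    intro x hx j hj
    have h1 : ∑ i ∈ insert j C, (x.1 i : ℕ) ≤ ∑ i, (x.1 i : ℕ) :=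
      Finset.sum_le_univ_sum_of_nonneg (fun _ => Nat.zero_le _)
    rw [Finset.sum_insert hj, x.2] at h1
    have h2 : ∑ i ∈ C, ((m i).1 i : ℕ) ≤ ∑ i ∈ C, (x.1 i : ℕ) :=
      Finset.sum_le_sum fun i _ => hm i x hx
    omega
  have hin : ∀ x ∈ σ, ∀ j ∈ C, (x.1 j : ℕ) ≤ (m j).1 j + Fintype.card ι := by
    intro x hx j hj
    have h1 : ∑ i ∈ C, (x.1 i : ℕ) ≤ ∑ i, (x.1 i : ℕ) :=
      Finset.sum_le_univ_sum_of_nonneg (fun _ => Nat.zero_le _)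
    rw [x.2, ← Finset.add_sum_erase _ _ hj] at h1
    have h2 : ∑ i ∈ C.erase j, ((m i).1 i : ℕ) ≤ ∑ i ∈ C.erase j, (x.1 i : ℕ) :=
      Finset.sum_le_sum fun i _ => hm i x hx
    rw [← Finset.add_sum_erase _ _ hj] at key
    omega
  obtain ⟨x₀, hx₀⟩ := hσ
  refine ⟨x₀, fun i => ?_⟩
  by_cases hi : i ∈ C
  · right
    rw [← himg] at hi
    obtain ⟨x, hx, hci⟩ := Finset.mem_image.1 hi
    refine ⟨x, hci, fun j => ?_⟩
    by_cases hj : j ∈ C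
    · have h1 := hin x hx j hj
      have h2 := hin x₀ hx₀ j hj
      have h3 := hm j x hx
      have h4 := hm j x₀ hx₀
      omega
    · have h1 := hout x hx j hj
      have h2 := hout x₀ hx₀ j hj
      omega
  · exact Or.inl (hout x₀ hx₀ i hi)

end Brouwer

section
variable {ι : Type*} [Fintype ι] [Nonempty ι]

lemma exists_almost_le (f : (ι → ℝ) → (ι → ℝ)) (hf : Set.MapsTo f (stdSimplex ℝ ι) (stdSimplex ℝ ι))
    (N : ℕ) :
    ∃ p ∈ stdSimplex ℝ ι, ∀ i, ∃ x ∈ stdSimplex ℝ ι,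
      dist x p ≤ Fintype.card ι / (N + 1 : ℝ) ∧ p i ≤ f x i + Fintype.card ι / (N + 1 : ℝ) := by
  classical
  have hN : (0 : ℝ) < N + 1 := by positivity
  let g : LatticeSimplex ι (N + 1) → ι → ℝ := fun a i => (a.1 i : ℕ) / (N + 1 : ℝ)
  have hg : ∀ a, g a ∈ stdSimplex ℝ ι := by
    intro a
    refine ⟨fun i => by positivity, ?_⟩
    rw [← Finset.sum_div, div_eq_one_iff_eq hN.ne']
    exact_mod_cast a.2
  have hc : ∀ a, ∃ i, g a i ≤ f (g a) i := by
    intro a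
    obtain ⟨i, -, hi⟩ := Finset.exists_le_of_sum_le (s := Finset.univ) (f := g a) (g := f (g a))
      Finset.univ_nonempty (by rw [(hg a).2, (hf (hg a)).2])
    exact ⟨i, hi⟩
  choose c hc using hc
  obtain ⟨x₀, hx₀⟩ := exists_lattice_near (N + 1) c
  refine ⟨g x₀, hg x₀, fun i => ?_⟩
  rcases hx₀ i with h | ⟨x, hxi, hx⟩
  · refine ⟨g x₀, hg x₀, by simp; positivity, ?_⟩
    have h1 : g x₀ i ≤ Fintype.card ι / (N + 1 : ℝ) := by
      simp only [g]; gcongr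
    have h2 := (hf (hg x₀)).1 i
    linarith
  · have hd : ∀ j, |g x j - g x₀ j| ≤ Fintype.card ι / (N + 1 : ℝ) := by
      intro j
      simp only [g]
      rw [← sub_div, abs_div, abs_of_pos hN]
      gcongr
      obtain ⟨h1, h2⟩ := hx j
      rw [abs_le]
      constructor
      · have : ((x₀.1 j : ℕ) : ℝ) ≤ (x.1 j : ℕ) + Fintype.card ι := by exact_mod_cast h1
        linarith
      · have : ((x.1 j : ℕ) : ℝ) ≤ (x₀.1 j : ℕ) + Fintype.card ι := by exact_mod_cast h2
        linarith
    refine ⟨g x, hg x, ?_, ?_⟩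
    · rw [dist_pi_le_iff (by positivity)]
      intro j
      rw [Real.dist_eq]
      exact hd j
    · have h1 := hc x
      rw [hxi] at h1
      have h2 := (abs_le.1 (hd i)).1
      linarith

/-- Brouwer's fixed point theorem on the standard simplex. -/
theorem brouwer_stdSimplex (f : (ι → ℝ) → (ι → ℝ)) (hc : ContinuousOn f (stdSimplex ℝ ι))
    (hf : Set.MapsTo f (stdSimplex ℝ ι) (stdSimplex ℝ ι)) :
    ∃ p ∈ stdSimplex ℝ ι, f p = p := by
  classical
  have h := exists_almost_le f hf
  choose p hp x hx hd hle using h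
  obtain ⟨q, hq, φ, hφ, hlim⟩ := (isCompact_stdSimplex ℝ ι).tendsto_subseq hp
  have h0 : Tendsto (fun N : ℕ => Fintype.card ι / ((φ N : ℕ) + 1 : ℝ)) atTop (𝓝 0) := by
    have := (tendsto_const_div_atTop_nhds_zero_nat (Fintype.card ι : ℝ)).comp
      ((tendsto_add_atTop_nat 1).comp hφ.tendsto_atTop)
    refine this.congr fun N => ?_
    simp
  have hxlim : ∀ i, Tendsto (fun N => x (φ N) i) atTop (𝓝 q) := by
    intro i
    refine tendsto_iff_dist_tendsto_zero.2 ?_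
    have h1 := tendsto_iff_dist_tendsto_zero.1 hlim
    refine squeeze_zero (fun _ => dist_nonneg) (fun N => ?_) (by simpa using h0.add h1)
    exact (dist_triangle _ (p (φ N)) _).trans (add_le_add (hd (φ N) i) le_rfl)
  have hqle : ∀ i, q i ≤ f q i := by
    intro i
    have h1 : Tendsto (fun N => p (φ N) i) atTop (𝓝 (q i)) :=
      ((continuous_apply i).tendsto q).comp hlim
    have h2 : Tendsto (fun N => f (x (φ N) i) i) atTop (𝓝 (f q i)) := by
      have h3 : Tendsto (fun N => x (φ N) i) atTop (𝓝[stdSimplex ℝ ι] q) :=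
        tendsto_nhdsWithin_iff.2 ⟨hxlim i, Eventually.of_forall fun N => hx (φ N) i⟩
      exact ((continuous_apply i).tendsto _).comp ((hc q hq).tendsto.comp h3)
    refine le_of_tendsto_of_tendsto' h1 (by simpa using h2.add h0) fun N => ?_
    exact hle (φ N) i
  refine ⟨q, hq, ?_⟩
  have hs : ∑ i, q i = ∑ i, f q i := by rw [hq.2, (hf hq).2]
  have := (Finset.sum_eq_sum_iff_of_le (fun i _ => hqle i)).1 hs
  exact funext fun i => (this i (Finset.mem_univ i)).symm

end
end Renorm

namespace Renorm

/-- Schauder's fixed point theorem for compact convex sets. -/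
theorem schauder {E : Type*} [NormedAddCommGroup E] [NormedSpace ℝ E] {X : Set E}
    (hX : IsCompact X) (hconv : Convex ℝ X) (hne : X.Nonempty) {T : E → E}
    (hT : ContinuousOn T X) (hm : Set.MapsTo T X X) : ∃ x ∈ X, T x = x := by
  obtain ⟨x₀, hx₀, hmin⟩ := hX.exists_isMinOn hne (continuousOn_id.sub hT).norm
  by_contra! hcon
  set ε := ‖x₀ - T x₀‖ / 2 with hε
  have hpos : 0 < ε := half_pos (norm_pos_iff.2 (sub_ne_zero.2 (hcon x₀ hx₀).symm))
  obtain ⟨t, htX, htf, hcov⟩ := hX.finite_cover_balls hpos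
  have : Fintype t := htf.fintype
  let xx : (t → ℝ) → E := fun l => ∑ i, l i • (i : E)
  have hxx : ∀ l ∈ stdSimplex ℝ t, xx l ∈ X := fun l hl =>
    hconv.sum_mem (fun i _ => hl.1 i) hl.2 fun i _ => htX i.2
  have hxc : Continuous xx := by fun_prop
  have hTx : ContinuousOn (fun l => T (xx l)) (stdSimplex ℝ t) :=
    hT.comp hxc.continuousOn hxx
  let w : (t → ℝ) → t → ℝ := fun l i => max 0 (ε - ‖(i : E) - T (xx l)‖)
  have hw0 : ∀ l i, 0 ≤ w l i := fun l i => le_max_left _ _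
  have hwc : ∀ i, ContinuousOn (fun l => w l i) (stdSimplex ℝ t) := fun i =>
    continuousOn_const.sup (continuousOn_const.sub (continuousOn_const.sub hTx).norm)
  have hS : ∀ l ∈ stdSimplex ℝ t, 0 < ∑ i, w l i := by
    intro l hl
    obtain ⟨i, hi, hd⟩ := Set.mem_iUnion₂.1 (hcov (hm (hxx l hl)))
    refine Finset.sum_pos' (fun i _ => hw0 l i) ⟨⟨i, hi⟩, Finset.mem_univ _, ?_⟩
    rw [Metric.mem_ball, dist_comm, dist_eq_norm] at hd
    exact lt_max_of_lt_right (sub_pos.2 hd)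
  have : Nonempty t := by
    obtain ⟨i, hi, hd⟩ := Set.mem_iUnion₂.1 (hcov hx₀)
    exact ⟨⟨i, hi⟩⟩
  obtain ⟨l, hl, hfix⟩ := brouwer_stdSimplex (ι := t) (fun l i => w l i / ∑ j, w l j)
    (continuousOn_pi.2 fun i => (hwc i).div
      (continuousOn_finsetSum _ fun j _ => hwc j) fun l hl => (hS l hl).ne')
    (fun l hl => ⟨fun i => div_nonneg (hw0 l i) (hS l hl).le, by
      rw [← Finset.sum_div, div_self (hS l hl).ne']⟩)
  have h1 : xx l - T (xx l) = ∑ i, l i • ((i : E) - T (xx l)) := by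
    simp only [smul_sub, Finset.sum_sub_distrib, ← Finset.sum_smul, hl.2, one_smul, xx]
  have h2 : ‖xx l - T (xx l)‖ ≤ ∑ i, l i * ε := by
    rw [h1]
    refine (norm_sum_le _ _).trans (Finset.sum_le_sum fun i _ => ?_)
    rw [norm_smul, Real.norm_of_nonneg (hl.1 i)]
    rcases le_or_gt ‖(i : E) - T (xx l)‖ ε with h | h
    · exact mul_le_mul_of_nonneg_left h (hl.1 i)
    · have h3 : l i = 0 := by
        rw [← congrFun hfix i]
        have : w l i = 0 := max_eq_left (by linarith)
        simp [this]
      simp [h3]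
  rw [← Finset.sum_mul, hl.2, one_mul] at h2
  have h3 : ‖x₀ - T x₀‖ ≤ ‖xx l - T (xx l)‖ := isMinOn_iff.1 hmin _ (hxx l hl)
  linarith

end Renorm

namespace Renorm

open Set

lemma sub_le_sub_of_hasDerivAt_le {φ E p e : ℝ → ℝ} {x y : ℝ} (hxy : x ≤ y)
    (hφ : ∀ t ∈ Icc x y, HasDerivAt φ (p t) t) (hE : ∀ t ∈ Icc x y, HasDerivAt E (e t) t)
    (hle : ∀ t ∈ Ioo x y, p t ≤ e t) : φ y - φ x ≤ E y - E x := by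
  have h : MonotoneOn (fun t => E t - φ t) (Icc x y) := by
    refine monotoneOn_of_deriv_nonneg (convex_Icc x y)
      (fun t ht => ((hE t ht).sub (hφ t ht)).continuousAt.continuousWithinAt)
      (fun t ht => ?_) fun t ht => ?_
    · exact ((hE t (interior_subset ht)).sub
        (hφ t (interior_subset ht))).differentiableAt.differentiableWithinAt
    · have hd : deriv (fun t => E t - φ t) t = e t - p t :=
        ((hE t (interior_subset ht)).sub (hφ t (interior_subset ht))).deriv
      rw [hd, sub_nonneg]
      rw [interior_Icc] at ht
      exact hle t ht
  have := h (left_mem_Icc.2 hxy) (right_mem_Icc.2 hxy) hxy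
  simp only at this
  linarith

lemma sub_lt_sub_of_hasDerivAt_lt {φ E p e : ℝ → ℝ} {x y : ℝ} (hxy : x < y)
    (hφ : ∀ t ∈ Icc x y, HasDerivAt φ (p t) t) (hE : ∀ t ∈ Icc x y, HasDerivAt E (e t) t)
    (hle : ∀ t ∈ Ioo x y, p t < e t) : φ y - φ x < E y - E x := by
  have h : StrictMonoOn (fun t => E t - φ t) (Icc x y) := by
    refine strictMonoOn_of_deriv_pos (convex_Icc x y)
      (fun t ht => ((hE t ht).sub (hφ t ht)).continuousAt.continuousWithinAt)
      fun t ht => ?_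
    have hd : deriv (fun t => E t - φ t) t = e t - p t :=
      ((hE t (interior_subset ht)).sub (hφ t (interior_subset ht))).deriv
    rw [hd, sub_pos]
    rw [interior_Icc] at ht
    exact hle t ht
  have := h (left_mem_Icc.2 hxy.le) (right_mem_Icc.2 hxy.le) hxy
  simp only at this
  linarith

lemma hasDerivAt_moebius {c m x t : ℝ} (hc : c ≠ 0) (he : c + m * (t - x) ≠ 0) :
    HasDerivAt (fun t => (t - x) / (c * (c + m * (t - x)))) ((c + m * (t - x)) ^ 2)⁻¹ t := by
  have h1 : HasDerivAt (fun t : ℝ => t - x) 1 t := (hasDerivAt_id t).sub_const x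
  have h2 : HasDerivAt (fun t : ℝ => c * (c + m * (t - x))) (c * (m * 1)) t :=
    ((h1.const_mul m).const_add c).const_mul c
  refine (h1.div h2 (mul_ne_zero hc he)).congr_deriv ?_
  field_simp
  ring

/-- `φ` is a diffeomorphism with derivative `w⁻²` which does not expand the ratio of `φ y - φ x` to
`(y - x) √(φ' x φ' y)`; this expresses nonnegative Schwarzian derivative. -/
structure SC (I : Set ℝ) (φ w : ℝ → ℝ) : Prop where
  deriv : ∀ x ∈ I, HasDerivAt φ ((w x) ^ 2)⁻¹ x
  pos : ∀ x ∈ I, 0 < w x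
  le : ∀ x ∈ I, ∀ y ∈ I, x ≤ y → (φ y - φ x) * (w x * w y) ≤ y - x

lemma SC.strictMonoOn {a b : ℝ} {φ w : ℝ → ℝ} (h : SC (Ioo a b) φ w) :
    StrictMonoOn φ (Ioo a b) := by
  refine strictMonoOn_of_deriv_pos (convex_Ioo a b)
    (fun t ht => (h.deriv t ht).continuousAt.continuousWithinAt) fun t ht => ?_
  rw [interior_Ioo] at ht
  rw [(h.deriv t ht).deriv]
  have := h.pos t ht
  positivity

lemma SC.comp {I J : Set ℝ} {φ w φ₂ w₂ : ℝ → ℝ} (h₂ : SC J φ₂ w₂) (h : SC I φ w)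
    (hm : MapsTo φ I J) (hmono : MonotoneOn φ I) :
    SC I (fun x => φ₂ (φ x)) (fun x => w₂ (φ x) * w x) where
  deriv x hx := by
    refine ((h₂.deriv _ (hm hx)).comp x (h.deriv x hx)).congr_deriv ?_
    rw [mul_pow, mul_inv]
  pos x hx := mul_pos (h₂.pos _ (hm hx)) (h.pos x hx)
  le x hx y hy hxy := by
    have h1 := h₂.le _ (hm hx) _ (hm hy) (hmono hx hy hxy)
    have h2 := h.le x hx y hy hxy
    have h3 := mul_pos (h.pos x hx) (h.pos y hy)
    calc _ = ((φ₂ (φ y) - φ₂ (φ x)) * (w₂ (φ x) * w₂ (φ y))) * (w x * w y) := by ring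
      _ ≤ (φ y - φ x) * (w x * w y) := by gcongr
      _ ≤ _ := h2

lemma SC.congr {I : Set ℝ} {φ w φ₂ w₂ : ℝ → ℝ} (h : SC I φ w) (hI : IsOpen I) (h1 : EqOn φ₂ φ I)
    (h2 : EqOn w₂ w I) : SC I φ₂ w₂ where
  deriv x hx := by
    rw [h2 hx]
    exact (h.deriv x hx).congr_of_eventuallyEq (h1.eventuallyEq_of_mem (hI.mem_nhds hx))
  pos x hx := by rw [h2 hx]; exact h.pos x hx
  le x hx y hy hxy := by rw [h1 hx, h1 hy, h2 hx, h2 hy]; exact h.le x hx y hy hxy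

lemma SC.mono {I J : Set ℝ} {φ w : ℝ → ℝ} (h : SC J φ w) (hIJ : I ⊆ J) : SC I φ w where
  deriv x hx := h.deriv x (hIJ hx)
  pos x hx := h.pos x (hIJ hx)
  le x hx y hy := h.le x (hIJ hx) y (hIJ hy)

lemma SC.of_concaveOn {I : Set ℝ} {φ w : ℝ → ℝ} (hd : ∀ x ∈ I, HasDerivAt φ ((w x) ^ 2)⁻¹ x)
    (hpos : ∀ x ∈ I, 0 < w x) (hc : ConcaveOn ℝ I w) : SC I φ w where
  deriv := hd
  pos := hpos
  le x hx y hy hxy := by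
    rcases hxy.eq_or_lt with rfl | hxy
    · simp
    have hI : Icc x y ⊆ I := hc.1.ordConnected.out hx hy
    have hwx := hpos x hx
    have hwy := hpos y hy
    have hyx : 0 < y - x := sub_pos.2 hxy
    set m := (w y - w x) / (y - x) with hm
    have key : ∀ t ∈ Icc x y, 0 < w x + m * (t - x) ∧ w x + m * (t - x) ≤ w t := by
      intro t ht
      have e1 : w x + m * (t - x) = (y - t) / (y - x) * w x + (t - x) / (y - x) * w y := by
        rw [hm]; field_simp; ring
      have h0 : 0 ≤ (y - t) / (y - x) := div_nonneg (sub_nonneg.2 ht.2) hyx.le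
      have h1 : 0 ≤ (t - x) / (y - x) := div_nonneg (sub_nonneg.2 ht.1) hyx.le
      have h2 : (y - t) / (y - x) + (t - x) / (y - x) = 1 := by field_simp; ring
      have h3 := hc.2 hx hy h0 h1 h2
      have h4 : (y - t) / (y - x) * x + (t - x) / (y - x) * y = t := by field_simp; ring
      simp only [smul_eq_mul] at h3
      rw [h4] at h3
      rw [e1]
      refine ⟨?_, h3⟩
      rcases h0.eq_or_lt with h | h
      · rw [← h, zero_add] at h2
        rw [h2, ← h]; linarith
      · have := mul_pos h hwx
        have := mul_nonneg h1 hwy.le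
        linarith
    have := sub_le_sub_of_hasDerivAt_le hxy.le (fun t ht => hd t (hI ht))
      (fun t ht => hasDerivAt_moebius hwx.ne' (key t ht).1.ne') (fun t ht => by
        obtain ⟨h1, h2⟩ := key t (Ioo_subset_Icc_self ht)
        gcongr)
    have e1 : w x + m * (y - x) = w y := by rw [hm]; field_simp; ring
    rw [e1] at this
    simp only [sub_self, zero_div, sub_zero] at this
    rwa [le_div_iff₀ (mul_pos hwx hwy)] at this

lemma SC.concaveOn {a b : ℝ} {φ w : ℝ → ℝ} (h : SC (Ioo a b) φ w)
    (hcont : ContinuousOn w (Ioo a b)) : ConcaveOn ℝ (Ioo a b) w := by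
  refine LinearOrder.concaveOn_of_lt (convex_Ioo a b) fun x hx y hy hxy p q hp hq hpq => ?_
  by_contra! hcon
  simp only [smul_eq_mul] at hcon
  set z := p * x + q * y with hz
  have hI : Icc x y ⊆ Ioo a b := (ordConnected_Ioo).out hx hy
  have hyx : 0 < y - x := sub_pos.2 hxy
  have hxz : x < z := by
    have : z - x = q * (y - x) := by rw [hz]; linear_combination x * hpq
    nlinarith [mul_pos hq hyx]
  have hzy : z < y := by
    have : y - z = p * (y - x) := by rw [hz]; linear_combination (-y) * hpq
    nlinarith [mul_pos hp hyx]
  set m := (w y - w x) / (y - x) with hm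
  have hme : w x + m * (y - x) = w y := by rw [hm]; field_simp; ring
  have hze : w z < w x + m * (z - x) := by
    have e1 : w x + m * (z - x) = p * w x + q * w y := by
      have : z - x = q * (y - x) := by rw [hz]; linear_combination x * hpq
      rw [this, ← hme]; linear_combination (-w x) * hpq
    rw [e1]; exact hcon
  have hepos : ∀ t ∈ Icc x y, 0 < w x + m * (t - x) := by
    intro t ht
    have hwx := h.pos x hx
    have hwy := h.pos y hy
    have e1 : (y - x) * (w x + m * (t - x)) = (y - t) * w x + (t - x) * w y := by
      rw [← hme]; ring
    have h1 : 0 ≤ (t - x) * w y := mul_nonneg (sub_nonneg.2 ht.1) hwy.le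
    rcases ht.2.eq_or_lt with rfl | h2
    · rw [hme]; exact hwy
    · have := mul_pos (sub_pos.2 h2) hwx
      by_contra! hneg
      nlinarith
  have hcD : ContinuousOn (fun t => w t - (w x + m * (t - x))) (Icc x y) :=
    (hcont.mono hI).sub (by fun_prop)
  obtain ⟨x₁, ⟨hx₁, hx₁'⟩, hx₁max⟩ : ∃ u, IsGreatest
      (Icc x z ∩ (fun t => w t - (w x + m * (t - x))) ⁻¹' Ici 0) u :=
    (isCompact_Icc.of_isClosed_subset ((hcD.mono
      (Icc_subset_Icc_right hzy.le)).preimage_isClosed_of_isClosed isClosed_Icc isClosed_Ici)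
      inter_subset_left).exists_isGreatest
      ⟨x, left_mem_Icc.2 hxz.le, by simp⟩
  obtain ⟨y₁, ⟨hy₁, hy₁'⟩, hy₁min⟩ : ∃ u, IsLeast
      (Icc z y ∩ (fun t => w t - (w x + m * (t - x))) ⁻¹' Ici 0) u :=
    (isCompact_Icc.of_isClosed_subset ((hcD.mono
      (Icc_subset_Icc_left hxz.le)).preimage_isClosed_of_isClosed isClosed_Icc isClosed_Ici)
      inter_subset_left).exists_isLeast
      ⟨y, right_mem_Icc.2 hzy.le, by simp [hme]⟩
  simp only [mem_preimage, mem_Ici, sub_nonneg] at hx₁' hy₁'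
  have hx₁z : x₁ < z := lt_of_le_of_ne hx₁.2 fun h => by rw [h] at hx₁'; linarith
  have hzy₁ : z < y₁ := lt_of_le_of_ne hy₁.1 fun h => by rw [← h] at hy₁'; linarith
  have hsub : Icc x₁ y₁ ⊆ Icc x y := Icc_subset_Icc hx₁.1 hy₁.2
  have hlt : ∀ t ∈ Ioo x₁ y₁, w t < w x + m * (t - x) := by
    intro t ht
    by_contra! hge
    rcases le_total t z with h1 | h1
    · exact absurd (hx₁max ⟨⟨hx₁.1.trans ht.1.le, h1⟩, by simpa using hge⟩) (not_le.2 ht.1)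
    · exact absurd (hy₁min ⟨⟨h1, ht.2.le.trans hy₁.2⟩, by simpa using hge⟩) (not_le.2 ht.2)
  have hxy₁ : x₁ < y₁ := hx₁z.trans hzy₁
  have hx₁I : x₁ ∈ Icc x y := hsub (left_mem_Icc.2 hxy₁.le)
  have hy₁I : y₁ ∈ Icc x y := hsub (right_mem_Icc.2 hxy₁.le)
  have hK := h.le x₁ (hI hx₁I) y₁ (hI hy₁I) hxy₁.le
  have e0 : ∀ t, w x + m * (t - x) = (w x + m * (x₁ - x)) + m * (t - x₁) := fun t => by ring
  have hstr := sub_lt_sub_of_hasDerivAt_lt hxy₁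
    (fun t ht => hasDerivAt_moebius (c := w x + m * (x₁ - x)) (m := m) (x := x₁) (t := t)
      (hepos _ hx₁I).ne' (by rw [← e0]; exact (hepos t (hsub ht)).ne'))
    (fun t ht => h.deriv t (hI (hsub ht)))
    (fun t ht => by
      have h1 := hlt t ht
      have h2 := h.pos t (hI (hsub (Ioo_subset_Icc_self ht)))
      rw [← e0]
      gcongr)
  rw [← e0] at hstr
  simp only [sub_self, zero_div, sub_zero] at hstr
  have p1 := hepos _ hx₁I
  have p2 := hepos _ hy₁I
  rw [div_lt_iff₀ (mul_pos p1 p2)] at hstr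
  have hφ : 0 < φ y₁ - φ x₁ := by
    by_contra! hneg
    nlinarith [mul_pos p1 p2]
  have : (φ y₁ - φ x₁) * ((w x + m * (x₁ - x)) * (w x + m * (y₁ - x))) ≤
      (φ y₁ - φ x₁) * (w x₁ * w y₁) := by
    have := p1.le.trans hx₁'
    gcongr
  linarith

end Renorm

namespace Renorm

open Set

lemma exists_supporting_line {a b y : ℝ} {w : ℝ → ℝ} (hc : ConcaveOn ℝ (Ioo a b) w)
    (hy : y ∈ Ioo a b) : ∃ m : ℝ, ∀ t ∈ Ioo a b, w t ≤ w y + m * (t - y) := by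
  have hg := hc.neg
  have hyi : y ∈ interior (Ioo a b) := by rwa [interior_Ioo]
  set g : ℝ → ℝ := -w with hgdef
  refine ⟨-derivWithin g (Ioi y) y, fun t ht => ?_⟩
  rcases lt_trichotomy t y with h | rfl | h
  · have h1 := (hg.slope_le_leftDeriv_of_mem_interior ht hyi h).trans
      (hg.leftDeriv_le_rightDeriv_of_mem_interior hyi)
    rw [slope_def_field, div_le_iff₀ (sub_pos.2 h)] at h1
    simp only [hgdef, Pi.neg_apply] at h1 ⊢
    linarith
  · simp
  · have h1 := hg.rightDeriv_le_slope_of_mem_interior hyi ht h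
    rw [slope_def_field, le_div_iff₀ (sub_pos.2 h)] at h1
    simp only [hgdef, Pi.neg_apply] at h1 ⊢
    linarith

/-- Maps of nonnegative Schwarzian derivative from `[-A, A]` into `(-1, 1)` contract the hyperbolic
metric. -/
lemma SC.hyperbolic {a b A y : ℝ} {z w : ℝ → ℝ} (h : SC (Ioo a b) z w)
    (hc : ConcaveOn ℝ (Ioo a b) w) (hA : Icc (-A) A ⊆ Ioo a b)
    (hm : MapsTo z (Ioo a b) (Ioo (-1) 1)) (hy : y ∈ Ioo (-A) A) :
    1 / (1 - z y) + 1 / (1 + z y) ≤ w y ^ 2 * (1 / (A - y) + 1 / (A + y)) := by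
  have hyI : y ∈ Ioo a b := hA (Ioo_subset_Icc_self hy)
  have hAA : -A ≤ A := (hy.1.trans hy.2).le
  obtain ⟨m, hmle⟩ := exists_supporting_line hc hyI
  have hwy := h.pos y hyI
  have pos : ∀ t ∈ Icc (-A) A, 0 < w y + m * (t - y) := fun t ht =>
    (h.pos t (hA ht)).trans_le (hmle t (hA ht))
  have hAy : 0 < A - y := sub_pos.2 hy.2
  have hAy' : 0 < A + y := by linarith [hy.1]
  have hle : ∀ t ∈ Icc (-A) A, ((w y + m * (t - y)) ^ 2)⁻¹ ≤ ((w t) ^ 2)⁻¹ := fun t ht => by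
    have h1 := h.pos t (hA ht)
    have h2 := hmle t (hA ht)
    gcongr
  have key1 := sub_le_sub_of_hasDerivAt_le hy.2.le
    (fun t ht => hasDerivAt_moebius (c := w y) (m := m) (x := y) (t := t) hwy.ne'
      (pos t ⟨hy.1.le.trans ht.1, ht.2⟩).ne')
    (fun t ht => h.deriv t (hA ⟨hy.1.le.trans ht.1, ht.2⟩))
    (fun t ht => hle t ⟨hy.1.le.trans ht.1.le, ht.2.le⟩)
  have key2 := sub_le_sub_of_hasDerivAt_le hy.1.le
    (fun t ht => hasDerivAt_moebius (c := w y) (m := m) (x := y) (t := t) hwy.ne'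
      (pos t ⟨ht.1, ht.2.trans hy.2.le⟩).ne')
    (fun t ht => h.deriv t (hA ⟨ht.1, ht.2.trans hy.2.le⟩))
    (fun t ht => hle t ⟨ht.1.le, ht.2.le.trans hy.2.le⟩)
  have hzA := hm (hA (right_mem_Icc.2 hAA))
  have hzA' := hm (hA (left_mem_Icc.2 hAA))
  have pA := pos A (right_mem_Icc.2 hAA)
  have pA' := pos (-A) (left_mem_Icc.2 hAA)
  simp only [sub_self, zero_div, sub_zero, zero_sub] at key1 key2
  have e2 : -((-A - y) / (w y * (w y + m * (-A - y)))) =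
      (A + y) / (w y * (w y + m * (-A - y))) := by rw [← neg_div]; ring
  rw [e2] at key2
  have q1 : 0 < (A - y) / (w y * (w y + m * (A - y))) := by positivity
  have q2 : 0 < (A + y) / (w y * (w y + m * (-A - y))) := by positivity
  have b1 : 1 / (1 - z y) ≤ 1 / ((A - y) / (w y * (w y + m * (A - y)))) := by
    apply one_div_le_one_div_of_le q1
    linarith [hzA.2]
  have b2 : 1 / (1 + z y) ≤ 1 / ((A + y) / (w y * (w y + m * (-A - y)))) := by
    apply one_div_le_one_div_of_le q2
    linarith [hzA'.1]
  refine (add_le_add b1 b2).trans (le_of_eq ?_)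
  field_simp
  ring

lemma SC.mul_left {s : ℝ} (hs : 0 < s) (I : Set ℝ) (hI : Convex ℝ I) :
    SC I (fun x => s * x) (fun _ => (√s)⁻¹) := by
  refine SC.of_concaveOn (fun x _ => ?_) (fun x _ => by positivity) (concaveOn_const _ hI)
  rw [inv_pow, Real.sq_sqrt hs.le, inv_inv]
  simpa using (hasDerivAt_id x).const_mul s

lemma SC.rpow {α : ℝ} (hα : 1 < α) :
    SC (Ioi 0) (fun u => u ^ α⁻¹) (fun u => √α * u ^ ((1 - α⁻¹) / 2)) := by
  have h0 : 0 < α := by linarith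
  have h1 : α⁻¹ < 1 := inv_lt_one_of_one_lt₀ hα
  have h2 : 0 < α⁻¹ := by positivity
  refine SC.of_concaveOn (fun x hx => ?_) (fun x hx => ?_) ?_
  · rw [mem_Ioi] at hx
    refine (Real.hasDerivAt_rpow_const (Or.inl hx.ne')).congr_deriv ?_
    rw [mul_pow, Real.sq_sqrt h0.le, ← Real.rpow_natCast, ← Real.rpow_mul hx.le, mul_inv,
      ← Real.rpow_neg hx.le]
    congr 2
    push_cast
    ring
  · rw [mem_Ioi] at hx
    positivity
  · have := (Real.concaveOn_rpow (p := (1 - α⁻¹) / 2) (by linarith) (by linarith)).subset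
      Ioi_subset_Ici_self (convex_Ioi 0)
    exact this.smul (Real.sqrt_nonneg α)

end Renorm

namespace Renorm

open Set

/-- The primitive of `w⁻²` vanishing at `0`. -/
noncomputable def Pf (w : ℝ → ℝ) (y : ℝ) : ℝ := ∫ t in (0 : ℝ)..y, ((w t) ^ 2)⁻¹

/-- The affine image of `Pf w` which is `0` at `v` and `1` at `-1`. -/
noncomputable def Uf (w : ℝ → ℝ) (v y : ℝ) : ℝ := (Pf w v - Pf w y) / (Pf w v - Pf w (-1))

/-- The negative of a left inverse branch of the unimodal map with value `v` at `0`. -/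
noncomputable def hf (α : ℝ) (w : ℝ → ℝ) (v x : ℝ) : ℝ := (max 0 (Uf w v (-x))) ^ α⁻¹

/-- Continuous positive functions which are concave on `[-1, 1]`. -/
structure Weight (w : ℝ → ℝ) : Prop where
  cont : Continuous w
  pos : ∀ y, 0 < w y
  conc : ConcaveOn ℝ (Icc (-1) 1) w

section
variable {w : ℝ → ℝ} {α v : ℝ}

lemma Weight.hasDerivAt_Pf (hw : Weight w) (y : ℝ) : HasDerivAt (Pf w) ((w y) ^ 2)⁻¹ y := by
  have hc : Continuous fun t => ((w t) ^ 2)⁻¹ :=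
    (hw.cont.pow 2).inv₀ fun t => (pow_pos (hw.pos t) 2).ne'
  exact intervalIntegral.integral_hasDerivAt_right (hc.intervalIntegrable _ _)
    hc.stronglyMeasurable.stronglyMeasurableAtFilter hc.continuousAt

lemma Weight.continuous_Pf (hw : Weight w) : Continuous (Pf w) :=
  continuous_iff_continuousAt.2 fun y => (hw.hasDerivAt_Pf y).continuousAt

lemma Weight.strictMono_Pf (hw : Weight w) : StrictMono (Pf w) := by
  refine strictMono_of_deriv_pos fun y => ?_
  rw [(hw.hasDerivAt_Pf y).deriv]
  have := hw.pos y
  positivity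

lemma Weight.den_pos (hw : Weight w) (hv : 0 < v) : 0 < Pf w v - Pf w (-1) :=
  sub_pos.2 (hw.strictMono_Pf (by linarith))

lemma Weight.continuous_Uf (hw : Weight w) : Continuous (Uf w v) :=
  (continuous_const.sub hw.continuous_Pf).div_const _

lemma Weight.hasDerivAt_Uf (hw : Weight w) (y : ℝ) :
    HasDerivAt (Uf w v) (-(((w y) ^ 2)⁻¹ / (Pf w v - Pf w (-1)))) y := by
  rw [← neg_div]
  exact ((hw.hasDerivAt_Pf y).const_sub _).div_const _

lemma Weight.strictAnti_Uf (hw : Weight w) (hv : 0 < v) : StrictAnti (Uf w v) := fun x y hxy => by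
  have := hw.den_pos hv
  have := hw.strictMono_Pf hxy
  unfold Uf
  gcongr

lemma Uf_self : Uf w v v = 0 := by simp [Uf]

lemma Weight.Uf_neg_one (hw : Weight w) (hv : 0 < v) : Uf w v (-1) = 1 :=
  div_self (hw.den_pos hv).ne'

lemma Weight.Uf_nonneg (hw : Weight w) (hv : 0 < v) {y : ℝ} (hy : y ≤ v) : 0 ≤ Uf w v y := by
  rw [← Uf_self (w := w) (v := v)]
  exact (hw.strictAnti_Uf hv).antitone hy

lemma Weight.Uf_pos (hw : Weight w) (hv : 0 < v) {y : ℝ} (hy : y < v) : 0 < Uf w v y := by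
  rw [← Uf_self (w := w) (v := v)]
  exact hw.strictAnti_Uf hv hy

lemma hf_nonneg (x : ℝ) : 0 ≤ hf α w v x := Real.rpow_nonneg (le_max_left _ _) _

lemma Weight.hf_eq (hw : Weight w) (hv : 0 < v) {x : ℝ} (hx : -v ≤ x) :
    hf α w v x = (Uf w v (-x)) ^ α⁻¹ := by
  rw [hf, max_eq_right (hw.Uf_nonneg hv (by linarith))]

lemma Weight.hf_rpow (hw : Weight w) (hα : 1 < α) (hv : 0 < v) {x : ℝ} (hx : -v ≤ x) :
    hf α w v x ^ α = Uf w v (-x) := by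
  rw [hw.hf_eq hv hx, Real.rpow_inv_rpow (hw.Uf_nonneg hv (by linarith)) (by linarith)]

lemma Weight.hf_one (hw : Weight w) (hv : 0 < v) : hf α w v 1 = 1 := by
  rw [hw.hf_eq hv (by linarith), hw.Uf_neg_one hv, Real.one_rpow]

lemma Weight.hf_neg (hw : Weight w) (hα : 1 < α) (hv : 0 < v) : hf α w v (-v) = 0 := by
  rw [hw.hf_eq hv le_rfl, neg_neg, Uf_self, Real.zero_rpow (inv_ne_zero (by linarith))]

lemma Weight.continuous_hf (hw : Weight w) (hα : 1 < α) : Continuous (hf α w v) := by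
  have : Continuous fun x => max 0 (Uf w v (-x)) :=
    continuous_const.max (hw.continuous_Uf.comp continuous_neg)
  exact this.rpow_const fun _ => Or.inr (by positivity)

lemma Weight.monotone_hf (hw : Weight w) (hα : 1 < α) (hv : 0 < v) : Monotone (hf α w v) :=
  fun x y hxy => by
    have := (hw.strictAnti_Uf hv).antitone (neg_le_neg hxy)
    unfold hf
    gcongr

lemma Weight.strictMonoOn_hf (hw : Weight w) (hα : 1 < α) (hv : 0 < v) :
    StrictMonoOn (hf α w v) (Ici (-v)) := fun x hx y hy hxy => by
  rw [mem_Ici] at hx hy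
  rw [hw.hf_eq hv hx, hw.hf_eq hv hy]
  have h1 := hw.strictAnti_Uf hv (neg_lt_neg hxy)
  have h2 := hw.Uf_nonneg hv (y := -x) (by linarith)
  have h3 : 0 < α⁻¹ := by positivity
  gcongr

lemma Weight.hf_mapsTo (hw : Weight w) (hα : 1 < α) (hv : 0 < v) :
    MapsTo (hf α w v) (Ioo (-v) 1) (Ioo 0 1) := fun x hx => by
  constructor
  · rw [← hw.hf_neg hα hv]
    exact hw.strictMonoOn_hf hα hv (mem_Ici.2 le_rfl) hx.1.le hx.1
  · rw [← hw.hf_one (α := α) hv]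
    exact hw.strictMonoOn_hf hα hv hx.1.le (by rw [mem_Ici]; linarith) hx.2

lemma Weight.hf_mapsTo_Icc (hw : Weight w) (hα : 1 < α) (hv : 0 < v) :
    MapsTo (hf α w v) (Iic 1) (Icc 0 1) := fun x hx => by
  refine ⟨hf_nonneg x, ?_⟩
  rw [← hw.hf_one (α := α) hv]
  exact hw.monotone_hf hα hv hx

lemma Weight.sc_Pf (hw : Weight w) : SC (Ioo (-1) 1) (Pf w) w :=
  SC.of_concaveOn (fun x _ => hw.hasDerivAt_Pf x) (fun x _ => hw.pos x)
    (hw.conc.subset Ioo_subset_Icc_self (convex_Ioo _ _))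

/-- The weight of `hf`. -/
noncomputable def hW (α : ℝ) (w : ℝ → ℝ) (v x : ℝ) : ℝ :=
  (√α * √(Pf w v - Pf w (-1))) * (hf α w v x ^ ((α - 1) / 2) * w (-x))

lemma concaveOn_comp_neg {f : ℝ → ℝ} (hf : ConcaveOn ℝ (Icc (-1) 1) f) :
    ConcaveOn ℝ (Icc (-1) 1) (fun x => f (-x)) := by
  refine ⟨convex_Icc _ _, fun x hx y hy a b ha hb hab => ?_⟩
  have := hf.2 (x := -x) (y := -y) ⟨by linarith [hx.2], by linarith [hx.1]⟩
    ⟨by linarith [hy.2], by linarith [hy.1]⟩ ha hb hab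
  refine this.trans (le_of_eq ?_)
  congr 1
  simp only [smul_eq_mul]
  ring

lemma Weight.sc_Uf_neg (hw : Weight w) (hv : 0 < v) : SC (Ioo (-1) 1) (fun x => Uf w v (-x))
    (fun x => √(Pf w v - Pf w (-1)) * w (-x)) := by
  have hD := hw.den_pos hv
  refine SC.of_concaveOn (fun x _ => ?_) (fun x _ => ?_) ?_
  · refine ((hw.hasDerivAt_Uf (v := v) (-x)).comp x (hasDerivAt_neg x)).congr_deriv ?_
    rw [mul_pow, Real.sq_sqrt hD.le]
    field_simp
  · have := hw.pos (-x)
    positivity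
  · exact ((concaveOn_comp_neg hw.conc).subset Ioo_subset_Icc_self (convex_Ioo _ _)).smul
      (Real.sqrt_nonneg _)

lemma Weight.sc_hf (hw : Weight w) (hα : 1 < α) (hv : 0 < v) (hv1 : v ≤ 1) :
    SC (Ioo (-v) 1) (hf α w v) (hW α w v) := by
  have hmono : StrictMonoOn (fun x => Uf w v (-x)) (Ioo (-v) 1) := fun x _ y _ hxy =>
    hw.strictAnti_Uf hv (neg_lt_neg hxy)
  have h1 := (SC.rpow hα).comp ((hw.sc_Uf_neg hv).mono
    (Ioo_subset_Ioo_left (by linarith : -1 ≤ -v)))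
    (fun x hx => hw.Uf_pos hv (by linarith [hx.1])) hmono.monotoneOn
  refine h1.congr isOpen_Ioo (fun x hx => hw.hf_eq hv hx.1.le) fun x hx => ?_
  simp only [hW]
  rw [← hw.hf_rpow hα hv hx.1.le, ← Real.rpow_mul (hf_nonneg x)]
  have : α * ((1 - α⁻¹) / 2) = (α - 1) / 2 := by field_simp
  rw [this]
  ring

end
end Renorm

namespace Renorm

open Set

/-- Up to a constant factor, the weight of the renormalized diffeomorphism. -/
noncomputable def RW (α : ℝ) (w : ℝ → ℝ) (v s : ℝ) (n : ℕ) (y : ℝ) : ℝ :=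
  w ((hf α w v)^[n] (s * y)) * ∏ j ∈ Finset.range n,
    ((hf α w v)^[j + 1] (s * y) ^ ((α - 1) / 2) * w (-((hf α w v)^[j] (s * y))))

section
variable {w : ℝ → ℝ} {α v s : ℝ}

lemma Weight.mapsTo_iterate (hw : Weight w) (hα : 1 < α) (hv : 0 < v) (j : ℕ) :
    MapsTo (hf α w v)^[j + 1] (Ioo (-v) 1) (Ioo 0 1) := by
  induction j with
  | zero => exact hw.hf_mapsTo hα hv
  | succ j ih =>
    rw [Function.iterate_succ']
    exact fun x hx => hw.hf_mapsTo hα hv ⟨by linarith [(ih hx).1], (ih hx).2⟩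

lemma Weight.mapsTo_iterate' (hw : Weight w) (hα : 1 < α) (hv : 0 < v) (j : ℕ) :
    MapsTo (hf α w v)^[j] (Ioo (-v) 1) (Ioo (-v) 1) := by
  cases j with
  | zero => exact mapsTo_id _
  | succ j => exact fun x hx => ⟨by linarith [(hw.mapsTo_iterate hα hv j hx).1],
      (hw.mapsTo_iterate hα hv j hx).2⟩

lemma Weight.continuous_iterate (hw : Weight w) (hα : 1 < α) (j : ℕ) :
    Continuous fun y => (hf α w v)^[j] (s * y) :=
  ((hw.continuous_hf hα).iterate j).comp (continuous_const.mul continuous_id)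

lemma Weight.continuous_RW (hw : Weight w) (hα : 1 < α) (n : ℕ) : Continuous (RW α w v s n) := by
  unfold RW
  refine (hw.cont.comp (hw.continuous_iterate hα n)).mul (continuous_finsetProd _ fun j _ => ?_)
  exact ((hw.continuous_iterate hα (j + 1)).rpow_const fun _ => Or.inr (by linarith)).mul
    (hw.cont.comp (hw.continuous_iterate hα j).neg)

lemma mapsTo_mul_left (hs : 0 < s) :
    MapsTo (fun y => s * y) (Ioo (-v / s) (1 / s)) (Ioo (-v) 1) := fun y hy => by
  have h1 := hy.1
  have h2 := hy.2
  rw [div_lt_iff₀ hs] at h1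
  rw [lt_div_iff₀ hs] at h2
  exact ⟨by linarith, by linarith⟩

lemma Weight.sc_iterate (hw : Weight w) (hα : 1 < α) (hv : 0 < v) (hv1 : v ≤ 1) (hs : 0 < s)
    (j : ℕ) : SC (Ioo (-v / s) (1 / s)) (fun y => (hf α w v)^[j] (s * y))
      (fun y => (√s)⁻¹ * ∏ i ∈ Finset.range j, hW α w v ((hf α w v)^[i] (s * y))) := by
  induction j with
  | zero =>
    simpa using SC.mul_left hs _ (convex_Ioo (-v / s) (1 / s))
  | succ j ih =>
    have h := (hw.sc_hf hα hv hv1).comp ih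
      (fun y hy => hw.mapsTo_iterate' hα hv j (mapsTo_mul_left hs hy)) ih.strictMonoOn.monotoneOn
    refine h.congr isOpen_Ioo (fun y _ => ?_) fun y _ => ?_
    · simp only [Function.iterate_succ_apply']
    · simp only [Finset.prod_range_succ]
      ring

lemma Weight.weight_iterate_eq (n : ℕ) (y : ℝ) :
    w ((hf α w v)^[n] (s * y)) *
      ((√s)⁻¹ * ∏ i ∈ Finset.range n, hW α w v ((hf α w v)^[i] (s * y))) =
    ((√s)⁻¹ * (√α * √(Pf w v - Pf w (-1))) ^ n) * RW α w v s n y := by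
  simp only [hW, RW, Finset.prod_mul_distrib, Finset.prod_const, Finset.card_range,
    Function.iterate_succ_apply']
  ring

lemma Weight.sc_RW (hw : Weight w) (hα : 1 < α) (hv : 0 < v) (hv1 : v ≤ 1) (hs : 0 < s)
    (n : ℕ) : SC (Ioo (-v / s) (1 / s)) (fun y => Pf w ((hf α w v)^[n] (s * y)))
      (fun y => ((√s)⁻¹ * (√α * √(Pf w v - Pf w (-1))) ^ n) * RW α w v s n y) := by
  have ih := hw.sc_iterate hα hv hv1 hs n
  have h := hw.sc_Pf.comp ih (fun y hy => Ioo_subset_Ioo_left (by linarith)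
    (hw.mapsTo_iterate' hα hv n (mapsTo_mul_left hs hy))) ih.strictMonoOn.monotoneOn
  exact h.congr isOpen_Ioo (fun y _ => rfl) fun y _ => (weight_iterate_eq n y).symm

lemma Weight.const_pos (hw : Weight w) (hα : 1 < α) (hv : 0 < v) (hs : 0 < s) (n : ℕ) :
    0 < (√s)⁻¹ * (√α * √(Pf w v - Pf w (-1))) ^ n := by
  have := hw.den_pos hv
  have : 0 < α := by linarith
  positivity

lemma Weight.RW_pos (hw : Weight w) (hα : 1 < α) (hv : 0 < v) (hv1 : v ≤ 1) (hs : 0 < s)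
    (n : ℕ) {y : ℝ} (hy : y ∈ Ioo (-v / s) (1 / s)) : 0 < RW α w v s n y :=
  pos_of_mul_pos_right ((hw.sc_RW hα hv hv1 hs n).pos y hy) (hw.const_pos hα hv hs n).le

lemma Weight.concaveOn_RW (hw : Weight w) (hα : 1 < α) (hv : 0 < v) (hv1 : v ≤ 1) (hs : 0 < s)
    (n : ℕ) : ConcaveOn ℝ (Ioo (-v / s) (1 / s)) (RW α w v s n) := by
  have h := (hw.sc_RW hα hv hv1 hs n).concaveOn
    (continuous_const.mul (hw.continuous_RW hα n)).continuousOn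
  have hc := hw.const_pos hα hv hs n
  have h2 := h.smul (inv_nonneg.2 hc.le)
  refine h2.congr fun y _ => ?_
  simp only [smul_eq_mul]
  rw [inv_mul_cancel_left₀ hc.ne']

end
end Renorm

namespace Renorm

open Set Topology

/-- Normalized concave functions on `[-1, 1]` satisfying the chord inequalities inherited from a
nonnegative concave extension to `[-1 - δ, 1 + δ]`. -/
structure Adm (δ : ℝ) (w : ℝ → ℝ) : Prop where
  conc : ConcaveOn ℝ (Icc (-1) 1) w
  zero : w 0 = 1
  right : ∀ x ∈ Icc (-1 : ℝ) 1, ∀ y ∈ Icc (-1 : ℝ) 1, x ≤ y → w x * (1 + δ - y) ≤ w y * (1 + δ - x)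
  left : ∀ x ∈ Icc (-1 : ℝ) 1, ∀ y ∈ Icc (-1 : ℝ) 1, x ≤ y → w y * (1 + δ + x) ≤ w x * (1 + δ + y)

lemma concaveOn_le {I : Set ℝ} {f : ℝ → ℝ} (h : ConcaveOn ℝ I f) {x y a b : ℝ} (hx : x ∈ I)
    (hy : y ∈ I) (ha : 0 ≤ a) (hb : 0 ≤ b) (hab : a + b = 1) :
    a * f x + b * f y ≤ f (a * x + b * y) := h.2 hx hy ha hb hab

section
variable {δ : ℝ} {w : ℝ → ℝ}

lemma Adm.lower (h : Adm δ w) (hδ : 0 < δ) {y : ℝ} (hy : y ∈ Icc (-1 : ℝ) 1) :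
    δ / (1 + δ) ≤ w y := by
  have h0 : (0 : ℝ) ∈ Icc (-1 : ℝ) 1 := by norm_num
  rw [div_le_iff₀ (by linarith)]
  rcases le_total 0 y with h1 | h1
  · have := h.right 0 h0 y hy h1
    rw [h.zero] at this
    linarith [hy.2]
  · have := h.left y hy 0 h0 h1
    rw [h.zero] at this
    linarith [hy.1]

lemma Adm.pos (h : Adm δ w) (hδ : 0 < δ) {y : ℝ} (hy : y ∈ Icc (-1 : ℝ) 1) : 0 < w y :=
  (by positivity : 0 < δ / (1 + δ)).trans_le (h.lower hδ hy)

lemma Adm.upper (h : Adm δ w) (hδ : 0 < δ) {y : ℝ} (hy : y ∈ Icc (-1 : ℝ) 1) : w y ≤ 2 := by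
  have key : ∀ e : ℝ, e ∈ Icc (-1 : ℝ) 1 → |y| + y * e = 0 → w y ≤ 2 := by
    intro e he hye
    have hp := h.pos hδ he
    have hn : (0 : ℝ) < 1 + |y| := by positivity
    have h1 := concaveOn_le h.conc hy he (a := 1 / (1 + |y|)) (b := |y| / (1 + |y|)) (by positivity)
      (by positivity) (by field_simp)
    have h2 : 1 / (1 + |y|) * y + |y| / (1 + |y|) * e = 0 := by
      rcases le_total 0 y with h3 | h3
      · rw [abs_of_nonneg h3] at hye ⊢
        field_simp
        linarith
      · rw [abs_of_nonpos h3] at hye ⊢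
        have : -y * (1 - e) = 0 := by linarith
        rcases mul_eq_zero.1 this with h4 | h4
        · have : y = 0 := by linarith
          subst this; simp
        · have : e = 1 := by linarith
          subst this; ring
    rw [h2, h.zero] at h1
    have h3 : 1 / (1 + |y|) * w y ≤ 1 := by
      have : 0 ≤ |y| / (1 + |y|) * w e := by positivity
      linarith
    rw [one_div, inv_mul_le_iff₀ hn] at h3
    have : |y| ≤ 1 := abs_le.2 hy
    linarith
  rcases le_total 0 y with h3 | h3
  · exact key (-1) (by norm_num) (by rw [abs_of_nonneg h3]; ring)
  · exact key 1 (by norm_num) (by rw [abs_of_nonpos h3]; ring)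

lemma Adm.lipschitz (h : Adm δ w) (hδ : 0 < δ) {x y : ℝ} (hx : x ∈ Icc (-1 : ℝ) 1)
    (hy : y ∈ Icc (-1 : ℝ) 1) : |w x - w y| ≤ 2 / δ * |x - y| := by
  wlog hxy : x ≤ y generalizing x y
  · rw [abs_sub_comm, abs_sub_comm x]
    exact this hy hx (le_of_not_ge hxy)
  have h1 := h.right x hx y hy hxy
  have h2 := h.left x hx y hy hxy
  rw [abs_of_nonpos (by linarith : x - y ≤ 0), div_mul_eq_mul_div, le_div_iff₀ hδ, neg_sub]
  have hyx : 0 ≤ y - x := by linarith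
  have h3 := mul_le_mul_of_nonneg_right (h.upper hδ hx) hyx
  have h4 := mul_le_mul_of_nonneg_right (h.upper hδ hy) hyx
  rcases le_total (w y) (w x) with h5 | h5
  · rw [abs_of_nonneg (by linarith)]
    nlinarith [mul_nonneg (sub_nonneg.2 h5) (sub_nonneg.2 hy.2)]
  · rw [abs_of_nonpos (by linarith)]
    nlinarith [mul_nonneg (sub_nonneg.2 h5) (sub_nonneg.2 hx.1)]

lemma Adm.of_concaveOn {f : ℝ → ℝ} (hδ : 0 < δ) (hc : ConcaveOn ℝ (Icc (-(1 + δ)) (1 + δ)) f)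
    (hpos : ∀ y ∈ Icc (-(1 + δ)) (1 + δ), 0 ≤ f y) (h0 : f 0 = 1) : Adm δ f where
  conc := hc.subset (Icc_subset_Icc (by linarith) (by linarith)) (convex_Icc _ _)
  zero := h0
  right x hx y hy hxy := by
    have hd : 0 < 1 + δ - x := by linarith [hx.2]
    have hxI : x ∈ Icc (-(1 + δ)) (1 + δ) := ⟨by linarith [hx.1], by linarith [hx.2]⟩
    have heI : 1 + δ ∈ Icc (-(1 + δ)) (1 + δ) := ⟨by linarith, le_rfl⟩
    have h1 := concaveOn_le hc hxI heI (a := (1 + δ - y) / (1 + δ - x)) (b := (y - x) / (1 + δ - x))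
      (div_nonneg (by linarith [hy.2]) hd.le) (div_nonneg (by linarith) hd.le)
      (by field_simp; ring)
    have e1 : (1 + δ - y) / (1 + δ - x) * x + (y - x) / (1 + δ - x) * (1 + δ) = y := by
      field_simp; ring
    rw [e1] at h1
    have h2 : 0 ≤ (y - x) / (1 + δ - x) * f (1 + δ) :=
      mul_nonneg (div_nonneg (by linarith) hd.le) (hpos _ heI)
    have h3 : (1 + δ - y) / (1 + δ - x) * f x ≤ f y := by linarith
    rw [div_mul_eq_mul_div, div_le_iff₀ hd] at h3
    linarith
  left x hx y hy hxy := by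
    have hd : 0 < 1 + δ + y := by linarith [hy.1]
    have hyI : y ∈ Icc (-(1 + δ)) (1 + δ) := ⟨by linarith [hy.1], by linarith [hy.2]⟩
    have heI : -(1 + δ) ∈ Icc (-(1 + δ)) (1 + δ) := ⟨le_rfl, by linarith⟩
    have h1 := concaveOn_le hc hyI heI (a := (1 + δ + x) / (1 + δ + y)) (b := (y - x) / (1 + δ + y))
      (div_nonneg (by linarith [hx.1]) hd.le) (div_nonneg (by linarith) hd.le)
      (by field_simp; ring)
    have e1 : (1 + δ + x) / (1 + δ + y) * y + (y - x) / (1 + δ + y) * -(1 + δ) = x := by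
      field_simp; ring
    rw [e1] at h1
    have h2 : 0 ≤ (y - x) / (1 + δ + y) * f (-(1 + δ)) :=
      mul_nonneg (div_nonneg (by linarith) hd.le) (hpos _ heI)
    have h3 : (1 + δ + x) / (1 + δ + y) * f y ≤ f x := by linarith
    rw [div_mul_eq_mul_div, div_le_iff₀ hd] at h3
    linarith

lemma Adm.congr {f : ℝ → ℝ} (h : Adm δ w) (hf : EqOn f w (Icc (-1) 1)) : Adm δ f where
  conc := h.conc.congr hf.symm
  zero := by rw [hf (by norm_num : (0 : ℝ) ∈ Icc (-1 : ℝ) 1), h.zero]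
  right x hx y hy hxy := by rw [hf hx, hf hy]; exact h.right x hx y hy hxy
  left x hx y hy hxy := by rw [hf hx, hf hy]; exact h.left x hx y hy hxy

end

/-- The constant extension of a function on `[-1, 1]`. -/
noncomputable def ext (f : Icc (-1 : ℝ) 1 → ℝ) (x : ℝ) : ℝ :=
  f (projIcc (-1) 1 (by norm_num) x)

lemma ext_of_mem (f : Icc (-1 : ℝ) 1 → ℝ) {x : ℝ} (hx : x ∈ Icc (-1 : ℝ) 1) :
    ext f x = f ⟨x, hx⟩ := by rw [ext, projIcc_of_mem]

lemma ext_coe (f : Icc (-1 : ℝ) 1 → ℝ) (x : Icc (-1 : ℝ) 1) : ext f x = f x := ext_of_mem f x.2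

lemma isClosed_adm (δ : ℝ) : IsClosed {f : Icc (-1 : ℝ) 1 → ℝ | Adm δ (ext f)} := by
  have hc : ∀ x, Continuous fun f : Icc (-1 : ℝ) 1 → ℝ => ext f x := fun x => continuous_apply _
  have : {f : Icc (-1 : ℝ) 1 → ℝ | Adm δ (ext f)} =
      {f | ∀ x ∈ Icc (-1 : ℝ) 1, ∀ y ∈ Icc (-1 : ℝ) 1, ∀ a b : ℝ, 0 ≤ a → 0 ≤ b → a + b = 1 →
        a * ext f x + b * ext f y ≤ ext f (a * x + b * y)} ∩ ({f | ext f 0 = 1} ∩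
      ({f | ∀ x ∈ Icc (-1 : ℝ) 1, ∀ y ∈ Icc (-1 : ℝ) 1, x ≤ y →
        ext f x * (1 + δ - y) ≤ ext f y * (1 + δ - x)} ∩
      {f | ∀ x ∈ Icc (-1 : ℝ) 1, ∀ y ∈ Icc (-1 : ℝ) 1, x ≤ y →
        ext f y * (1 + δ + x) ≤ ext f x * (1 + δ + y)})) := by
    ext f
    exact ⟨fun h => ⟨fun x hx y hy a b ha hb hab => h.conc.2 hx hy ha hb hab, h.zero, h.right,
      h.left⟩, fun h => ⟨⟨convex_Icc _ _, fun x hx y hy a b ha hb hab => h.1 x hx y hy a b ha hb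
        hab⟩, h.2.1, h.2.2.1, h.2.2.2⟩⟩
  rw [this]
  simp only [ofPred_forall]
  refine IsClosed.inter ?_ (IsClosed.inter ?_ (IsClosed.inter ?_ ?_))
  · repeat refine isClosed_iInter fun _ => ?_
    exact isClosed_le (((hc _).const_mul _).add ((hc _).const_mul _)) (hc _)
  · exact isClosed_eq (hc _) continuous_const
  · repeat refine isClosed_iInter fun _ => ?_
    exact isClosed_le ((hc _).mul_const _) ((hc _).mul_const _)
  · repeat refine isClosed_iInter fun _ => ?_
    exact isClosed_le ((hc _).mul_const _) ((hc _).mul_const _)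

/-- The set of admissible weights. -/
def admSet (δ : ℝ) : Set C(Icc (-1 : ℝ) 1, ℝ) := {f | Adm δ (ext f)}

lemma adm_dist {δ : ℝ} (hδ : 0 < δ) {f : Icc (-1 : ℝ) 1 → ℝ} (h : Adm δ (ext f))
    (x y : Icc (-1 : ℝ) 1) : dist (f x) (f y) ≤ 2 / δ * dist x y := by
  have := h.lipschitz hδ x.2 y.2
  rwa [ext_coe, ext_coe] at this

lemma isCompact_admSet {δ : ℝ} (hδ : 0 < δ) : IsCompact (admSet δ) := by
  have hlip : ∀ f : Icc (-1 : ℝ) 1 → ℝ, Adm δ (ext f) → LipschitzWith (2 / δ).toNNReal f :=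
    fun f h => LipschitzWith.of_dist_le' (adm_dist hδ h)
  refine ArzelaAscoli.isCompact_of_equicontinuous _ ?_ ?_
  · have himg : ContinuousMap.toFun '' (admSet δ) = {f : Icc (-1 : ℝ) 1 → ℝ | Adm δ (ext f)} := by
      ext f
      exact ⟨fun ⟨g, hg, hgf⟩ => hgf ▸ hg, fun h => ⟨⟨f, (hlip f h).continuous⟩, h, rfl⟩⟩
    rw [himg]
    refine IsCompact.of_isClosed_subset (isCompact_univ_pi fun _ => isCompact_Icc (a := (0 : ℝ))
      (b := 2)) (isClosed_adm δ) fun f (hf : Adm δ (ext f)) x _ => ?_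
    have h1 := hf.pos hδ x.2
    have h2 := hf.upper hδ x.2
    rw [ext_coe] at h1 h2
    exact ⟨h1.le, h2⟩
  · exact (LipschitzWith.uniformEquicontinuous _ (2 / δ).toNNReal
      fun f : admSet δ => hlip f.1 f.2).equicontinuous

lemma convex_admSet (δ : ℝ) : Convex ℝ (admSet δ) := by
  intro f hf g hg a b ha hb hab
  have he : ∀ x, ext (a • f + b • g : C(Icc (-1 : ℝ) 1, ℝ)) x = a * ext f x + b * ext g x :=
    fun x => rfl
  have e2 : (ext (a • f + b • g : C(Icc (-1 : ℝ) 1, ℝ))) = a • ext f + b • ext g :=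
    funext he
  refine ⟨?_, ?_, fun x hx y hy hxy => ?_, fun x hx y hy hxy => ?_⟩
  · rw [e2]
    exact (hf.conc.smul ha).add (hg.conc.smul hb)
  · rw [he, hf.zero, hg.zero]; linarith
  · rw [he, he]
    nlinarith [mul_le_mul_of_nonneg_left (hf.right x hx y hy hxy) ha,
      mul_le_mul_of_nonneg_left (hg.right x hx y hy hxy) hb]
  · rw [he, he]
    nlinarith [mul_le_mul_of_nonneg_left (hf.left x hx y hy hxy) ha,
      mul_le_mul_of_nonneg_left (hg.left x hx y hy hxy) hb]

lemma one_mem_admSet {δ : ℝ} (hδ : 0 < δ) : (1 : C(Icc (-1 : ℝ) 1, ℝ)) ∈ admSet δ :=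
  Adm.of_concaveOn hδ (concaveOn_const 1 (convex_Icc _ _)) (fun _ _ => zero_le_one) rfl

lemma Adm.weight_ext {δ : ℝ} (hδ : 0 < δ) {f : C(Icc (-1 : ℝ) 1, ℝ)} (h : Adm δ (ext f)) :
    Weight (ext f) where
  cont := f.continuous.comp continuous_projIcc
  pos y := by
    have := h.pos hδ (projIcc (-1) 1 (by norm_num) y).2
    rwa [ext_coe] at this
  conc := h.conc

end Renorm

namespace Renorm

open Set Topology

section
variable {Z : Type*} [TopologicalSpace Z] {w : Z → ℝ → ℝ} {v s g : Z → ℝ} {α : ℝ}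

lemma continuous_Pf_param (hw : ∀ z, Weight (w z)) (hc : Continuous (Function.uncurry w))
    (hg : Continuous g) : Continuous fun z => Pf (w z) (g z) := by
  have h1 : Continuous (Function.uncurry fun z t => ((w z t) ^ 2)⁻¹) :=
    (hc.pow 2).inv₀ fun p => (pow_pos ((hw p.1).pos p.2) 2).ne'
  exact (intervalIntegral.continuous_parametric_primitive_of_continuous (a₀ := 0) h1).comp
    (continuous_id.prodMk hg)

lemma continuous_Uf_param (hw : ∀ z, Weight (w z)) (hc : Continuous (Function.uncurry w))
    (hv : Continuous v) (hv0 : ∀ z, 0 < v z) (hg : Continuous g) :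
    Continuous fun z => Uf (w z) (v z) (g z) :=
  ((continuous_Pf_param hw hc hv).sub (continuous_Pf_param hw hc hg)).div
    ((continuous_Pf_param hw hc hv).sub (continuous_Pf_param hw hc continuous_const))
    fun z => ((hw z).den_pos (hv0 z)).ne'

lemma continuous_hf_param (hα : 1 < α) (hw : ∀ z, Weight (w z))
    (hc : Continuous (Function.uncurry w))
    (hv : Continuous v) (hv0 : ∀ z, 0 < v z) (hg : Continuous g) :
    Continuous fun z => hf α (w z) (v z) (g z) :=
  (continuous_const.max (continuous_Uf_param hw hc hv hv0 hg.neg)).rpow_const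
    fun _ => Or.inr (by positivity)

lemma continuous_iterate_param (hα : 1 < α) (hw : ∀ z, Weight (w z))
    (hc : Continuous (Function.uncurry w))
    (hv : Continuous v) (hv0 : ∀ z, 0 < v z) (hg : Continuous g) (n : ℕ) :
    Continuous fun z => (hf α (w z) (v z))^[n] (g z) := by
  induction n with
  | zero => exact hg
  | succ n ih =>
    simp only [Function.iterate_succ_apply']
    exact continuous_hf_param hα hw hc hv hv0 ih

lemma continuous_RW_param (hα : 1 < α) (hw : ∀ z, Weight (w z))
    (hc : Continuous (Function.uncurry w)) (hv : Continuous v) (hv0 : ∀ z, 0 < v z)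
    (hs : Continuous s) (hg : Continuous g) (n : ℕ) :
    Continuous fun z => RW α (w z) (v z) (s z) n (g z) := by
  have h : ∀ j, Continuous fun z => (hf α (w z) (v z))^[j] (s z * g z) := fun j =>
    continuous_iterate_param hα hw hc hv hv0 (hs.mul hg) j
  have hcw : ∀ {u : Z → ℝ}, Continuous u → Continuous fun z => w z (u z) := fun hu =>
    hc.comp (continuous_id.prodMk hu)
  exact (hcw (h n)).mul (continuous_finsetProd _ fun j _ =>
    ((h (j + 1)).rpow_const fun _ => Or.inr (by linarith)).mul (hcw (h j).neg))

end
end Renorm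

namespace Renorm

open Set Topology

lemma continuous_ext_param {X : Type*} [TopologicalSpace X] {F : X → C(Icc (-1 : ℝ) 1, ℝ)}
    (hF : Continuous F) : Continuous (Function.uncurry fun z => ext (F z)) := by
  have : (Function.uncurry fun z => ext (F z)) =
      fun p : X × ℝ => F p.1 (projIcc (-1) 1 (by norm_num) p.2) := rfl
  rw [this]
  exact (hF.comp continuous_fst).eval (continuous_projIcc.comp continuous_snd)

/-- The second coordinate of the clipped renormalization operator. -/
noncomputable def nextRatio (α : ℝ) (w : ℝ → ℝ) (v s : ℝ) (n : ℕ) : ℝ :=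
  min ((hf α w v)^[n] (-s)) ((max 0 (Uf w v ((hf α w v)^[n] (-s)))) ^ α⁻¹) / v

lemma Icc_subset_domain {δ v r : ℝ} (hδ : 0 < δ) (hv : 0 < v) (hv1 : v ≤ 1)
    (hr : 0 < r) (hr1 : r ≤ 1 - δ) : Icc (-(1 + δ)) (1 + δ) ⊆ Ioo (-v / (r * v)) (1 / (r * v)) := by
  have h1 : (1 + δ) * r < 1 := by nlinarith
  have h2 : (1 + δ) * (r * v) < 1 := by nlinarith [mul_pos hr hv]
  refine Icc_subset_Ioo ?_ ?_
  · rw [div_lt_iff₀ (mul_pos hr hv)]; nlinarith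
  · rw [lt_div_iff₀ (mul_pos hr hv)]; linarith

theorem exists_clipped_fixedPoint {α δ v₀ r₀ : ℝ} (hα : 1 < α) {n : ℕ} (hn : n ≠ 0) (hδ : 0 < δ)
    (hv₀ : 0 < v₀) (hv₁ : v₀ ≤ 1) (hr₀ : 0 < r₀) (hr₁ : r₀ ≤ 1 - δ)
    (hlow : ∀ f : C(Icc (-1 : ℝ) 1, ℝ), Adm δ (ext f) → ∀ v, v₀ ≤ v → v ≤ 1 → ∀ x, 0 ≤ x → x ≤ 1 →
      v₀ ≤ hf α (ext f) v x) :
    ∃ f : C(Icc (-1 : ℝ) 1, ℝ), Adm δ (ext f) ∧ ∃ v r : ℝ, v₀ ≤ v ∧ v < 1 ∧ r₀ ≤ r ∧ r ≤ 1 - δ ∧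
      (∀ y ∈ Icc (-1 : ℝ) 1, RW α (ext f) v (r * v) n y = RW α (ext f) v (r * v) n 0 * ext f y) ∧
      (hf α (ext f) v)^[n] (r * v * v) = v ∧
      r = max r₀ (min (1 - δ) (nextRatio α (ext f) v (r * v) n)) := by
  classical
  set X : Set (C(Icc (-1 : ℝ) 1, ℝ) × ℝ × ℝ) := admSet δ ×ˢ (Icc v₀ 1 ×ˢ Icc r₀ (1 - δ)) with hX
  have hXc : IsCompact X := (isCompact_admSet hδ).prod (isCompact_Icc.prod isCompact_Icc)
  have hXconv : Convex ℝ X := (convex_admSet δ).prod ((convex_Icc _ _).prod (convex_Icc _ _))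
  have hXne : X.Nonempty := ⟨(1, 1, r₀), one_mem_admSet hδ, ⟨hv₁, le_rfl⟩, ⟨le_rfl, hr₁⟩⟩
  let W : X → ℝ → ℝ := fun z => ext z.1.1
  let V : X → ℝ := fun z => z.1.2.1
  let S : X → ℝ := fun z => z.1.2.2 * z.1.2.1
  have hW : ∀ z, Weight (W z) := fun z => Adm.weight_ext hδ z.2.1
  have hWc : Continuous (Function.uncurry W) := continuous_ext_param (by fun_prop)
  have hVc : Continuous V := by fun_prop
  have hSc : Continuous S := by fun_prop
  have hV0 : ∀ z, 0 < V z := fun z => hv₀.trans_le z.2.2.1.1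
  have hV1 : ∀ z, V z ≤ 1 := fun z => z.2.2.1.2
  have hR0 : ∀ z : X, 0 < z.1.2.2 := fun z => hr₀.trans_le z.2.2.2.1
  have hS0 : ∀ z, 0 < S z := fun z => mul_pos (hR0 z) (hV0 z)
  have hsub : ∀ z : X, Icc (-(1 + δ)) (1 + δ) ⊆ Ioo (-V z / S z) (1 / S z) := fun z =>
    Icc_subset_domain hδ (hV0 z) (hV1 z) (hR0 z) z.2.2.2.2
  have hpos : ∀ z : X, ∀ y ∈ Icc (-(1 + δ)) (1 + δ), 0 < RW α (W z) (V z) (S z) n y :=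
    fun z y hy => (hW z).RW_pos hα (hV0 z) (hV1 z) (hS0 z) n (hsub z hy)
  have h0 : ∀ z : X, 0 < RW α (W z) (V z) (S z) n 0 := fun z =>
    hpos z 0 ⟨by linarith, by linarith⟩
  let N : C(X, C(Icc (-1 : ℝ) 1, ℝ)) := ContinuousMap.curry
    ⟨fun p : X × Icc (-1 : ℝ) 1 => RW α (W p.1) (V p.1) (S p.1) n p.2 /
      RW α (W p.1) (V p.1) (S p.1) n 0, by
      have hWc' : Continuous (Function.uncurry fun p : X × Icc (-1 : ℝ) 1 => W p.1) :=
        continuous_ext_param (F := fun p : X × Icc (-1 : ℝ) 1 => p.1.1.1) (by fun_prop)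
      exact (continuous_RW_param hα (fun p => hW p.1) hWc' (hVc.comp continuous_fst)
        (fun p => hV0 p.1) (hSc.comp continuous_fst) (continuous_subtype_val.comp continuous_snd) n).div
        (continuous_RW_param hα (fun p => hW p.1) hWc' (hVc.comp continuous_fst)
        (fun p => hV0 p.1) (hSc.comp continuous_fst) continuous_const n) fun p => (h0 p.1).ne'⟩
  have hN : ∀ (z : X) (y : Icc (-1 : ℝ) 1), N z y = RW α (W z) (V z) (S z) n y /
      RW α (W z) (V z) (S z) n 0 := fun z y => rfl
  have hNadm : ∀ z : X, N z ∈ admSet δ := fun z => by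
    have h1 : Adm δ fun y => (RW α (W z) (V z) (S z) n 0)⁻¹ * RW α (W z) (V z) (S z) n y := by
      refine Adm.of_concaveOn hδ ?_ (fun y hy => ?_) ?_
      · exact (((hW z).concaveOn_RW hα (hV0 z) (hV1 z) (hS0 z) n).subset (hsub z)
          (convex_Icc _ _)).smul (inv_nonneg.2 (h0 z).le)
      · exact mul_nonneg (inv_nonneg.2 (h0 z).le) (hpos z y hy).le
      · exact inv_mul_cancel₀ (h0 z).ne'
    refine h1.congr fun y hy => ?_
    rw [ext_of_mem _ hy, hN, div_eq_inv_mul]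
  let T : X → C(Icc (-1 : ℝ) 1, ℝ) × ℝ × ℝ := fun z =>
    (N z, (hf α (W z) (V z))^[n] (S z * V z),
      max r₀ (min (1 - δ) (nextRatio α (W z) (V z) (S z) n)))
  have hqc : Continuous fun z => (hf α (W z) (V z))^[n] (-S z) :=
    continuous_iterate_param hα hW hWc hVc hV0 hSc.neg n
  have hTc : Continuous T := by
    refine N.continuous.prodMk ((continuous_iterate_param hα hW hWc hVc hV0 (hSc.mul hVc)
      n).prodMk (continuous_const.max (continuous_const.min ?_)))
    refine Continuous.div (hqc.min ?_) hVc fun z => (hV0 z).ne'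
    exact (continuous_const.max (continuous_Uf_param hW hWc hVc hV0 hqc)).rpow_const
      fun _ => Or.inr (by positivity)
  have hx : ∀ z : X, S z * V z ∈ Ioo (0 : ℝ) 1 := fun z => by
    refine ⟨mul_pos (hS0 z) (hV0 z), ?_⟩
    have h1 : z.1.2.2 < 1 := by linarith [z.2.2.2.2]
    have h2 : S z < 1 := mul_lt_one_of_nonneg_of_lt_one_left (hR0 z).le h1 (hV1 z)
    exact mul_lt_one_of_nonneg_of_lt_one_left (hS0 z).le h2 (hV1 z)
  obtain ⟨m, rfl⟩ := Nat.exists_eq_succ_of_ne_zero hn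
  have hv' : ∀ z : X, (hf α (W z) (V z))^[m + 1] (S z * V z) ∈ Ico v₀ 1 := fun z => by
    have hz : S z * V z ∈ Ioo (-V z) 1 := ⟨by linarith [(hx z).1, hV0 z], (hx z).2⟩
    refine ⟨?_, ((hW z).mapsTo_iterate hα (hV0 z) m hz).2⟩
    rw [Function.iterate_succ_apply']
    have h1 : (hf α (W z) (V z))^[m] (S z * V z) ∈ Icc (0 : ℝ) 1 := by
      cases m with
      | zero => exact ⟨(hx z).1.le, (hx z).2.le⟩
      | succ m => exact Ioo_subset_Icc_self ((hW z).mapsTo_iterate hα (hV0 z) m hz)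
    exact hlow z.1.1 z.2.1 _ z.2.2.1.1 (hV1 z) _ h1.1 h1.2
  have hTm : ∀ z, T z ∈ X := fun z => ⟨hNadm z, ⟨(hv' z).1, (hv' z).2.le⟩, le_max_left _ _,
    max_le hr₁ (min_le_left _ _)⟩
  obtain ⟨x, hxX, hfix⟩ := schauder hXc hXconv hXne
    (T := fun x => if h : x ∈ X then T ⟨x, h⟩ else x)
    (by
      rw [continuousOn_iff_continuous_domRestrict]
      refine hTc.congr fun z => ?_
      simp only [domRestrict_apply, Subtype.coe_prop, dite_true])
    (fun x hx => by simpa only [hx, dite_true] using hTm ⟨x, hx⟩)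
  simp only [hxX, dite_true] at hfix
  set z : X := ⟨x, hxX⟩ with hz
  have e1 : N z = x.1 := congrArg Prod.fst hfix
  have e2 : (hf α (W z) (V z))^[m + 1] (S z * V z) = x.2.1 := congrArg (fun p => p.2.1) hfix
  have e3 : max r₀ (min (1 - δ) (nextRatio α (W z) (V z) (S z) (m + 1))) = x.2.2 :=
    congrArg (fun p => p.2.2) hfix
  refine ⟨x.1, hxX.1, x.2.1, x.2.2, hxX.2.1.1, ?_, hxX.2.2.1, hxX.2.2.2, fun y hy => ?_, e2,
    e3.symm⟩
  · rw [← e2]; exact (hv' z).2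
  · have h2 := hN z ⟨y, hy⟩
    rw [e1, eq_div_iff (h0 z).ne'] at h2
    rw [ext_of_mem _ hy, mul_comm (RW _ _ _ _ _ 0)]
    exact h2.symm

end Renorm

namespace Renorm

open Set Topology

/-- A lower bound for the slope of `Uf`. -/
noncomputable def slopeBound (δ : ℝ) : ℝ := (δ / (1 + δ)) ^ 2 / 8

section
variable {α δ v s : ℝ} {w : ℝ → ℝ}

lemma slopeBound_pos (hδ : 0 < δ) : 0 < slopeBound δ := by unfold slopeBound; positivity

lemma slopeBound_lt_one (hδ : 0 < δ) : slopeBound δ < 1 := by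
  have h1 : δ / (1 + δ) ≤ 1 := by rw [div_le_one (by linarith)]; linarith
  have h2 : 0 < δ / (1 + δ) := by positivity
  unfold slopeBound
  nlinarith

lemma Adm.le_Pf_sub (h : Adm δ w) (hδ : 0 < δ) (hw : Weight w) {a b : ℝ} (ha : -1 ≤ a)
    (hab : a ≤ b) (hb : b ≤ 1) : (b - a) / 4 ≤ Pf w b - Pf w a := by
  rcases hab.eq_or_lt with rfl | hab
  · simp
  obtain ⟨c, hc, he⟩ := exists_hasDerivAt_eq_slope (Pf w) _ hab hw.continuous_Pf.continuousOn
    fun x _ => hw.hasDerivAt_Pf x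
  rw [eq_div_iff (by linarith)] at he
  rw [← he, div_eq_inv_mul]
  have h1 := h.upper hδ (y := c) ⟨by linarith [hc.1], by linarith [hc.2]⟩
  have h2 := hw.pos c
  have h3 : (4 : ℝ)⁻¹ ≤ (w c ^ 2)⁻¹ := inv_anti₀ (by positivity) (by nlinarith)
  gcongr

lemma Adm.Pf_sub_le (h : Adm δ w) (hδ : 0 < δ) (hw : Weight w) {a b : ℝ} (ha : -1 ≤ a)
    (hab : a ≤ b) (hb : b ≤ 1) : Pf w b - Pf w a ≤ (b - a) / (δ / (1 + δ)) ^ 2 := by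
  rcases hab.eq_or_lt with rfl | hab
  · simp
  obtain ⟨c, hc, he⟩ := exists_hasDerivAt_eq_slope (Pf w) _ hab hw.continuous_Pf.continuousOn
    fun x _ => hw.hasDerivAt_Pf x
  rw [eq_div_iff (by linarith)] at he
  rw [← he, div_eq_inv_mul]
  have h1 := h.lower hδ (y := c) ⟨by linarith [hc.1], by linarith [hc.2]⟩
  have h2 : 0 < δ / (1 + δ) := by positivity
  gcongr

lemma Adm.le_Uf_sub (h : Adm δ w) (hδ : 0 < δ) (hw : Weight w) (hv : 0 < v) (hv1 : v ≤ 1)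
    {a b : ℝ} (ha : -1 ≤ a) (hab : a ≤ b) (hb : b ≤ 1) :
    slopeBound δ * (b - a) ≤ Uf w v a - Uf w v b := by
  have hD := hw.den_pos hv
  have h1 := h.le_Pf_sub hδ hw ha hab hb
  have h2 := h.Pf_sub_le hδ hw le_rfl (by linarith : -1 ≤ v) hv1
  have h3 : 0 < δ / (1 + δ) := by positivity
  have e : Uf w v a - Uf w v b = (Pf w b - Pf w a) / (Pf w v - Pf w (-1)) := by
    unfold Uf; rw [← sub_div]; ring
  rw [e, le_div_iff₀ hD]
  have h4 : Pf w v - Pf w (-1) ≤ 2 / (δ / (1 + δ)) ^ 2 := h2.trans (by gcongr; linarith)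
  rw [le_div_iff₀ (by positivity)] at h4
  unfold slopeBound
  have h5 : (Pf w v - Pf w (-1)) * (δ / (1 + δ)) ^ 2 * (b - a) ≤ 2 * (b - a) :=
    mul_le_mul_of_nonneg_right h4 (by linarith)
  linarith

lemma Adm.le_hf_rpow (h : Adm δ w) (hδ : 0 < δ) (hw : Weight w) (hα : 1 < α) (hv : 0 < v)
    (hv1 : v ≤ 1) {a b : ℝ} (ha : -v ≤ a) (hab : a ≤ b) (hb : b ≤ 1) :
    slopeBound δ * (b - a) ≤ hf α w v b ^ α - hf α w v a ^ α := by
  rw [hw.hf_rpow hα hv ha, hw.hf_rpow hα hv (ha.trans hab)]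
  have := h.le_Uf_sub hδ hw hv hv1 (a := -b) (b := -a) (by linarith) (by linarith) (by linarith)
  linarith

lemma rpow_sub_le (hα : 1 < α) {x y : ℝ} (hy : 0 ≤ y) (hyx : y ≤ x) (hx : x ≤ 1) :
    x ^ α - y ^ α ≤ α * (x - y) := by
  rcases hyx.eq_or_lt with rfl | hyx
  · simp
  obtain ⟨c, hc, he⟩ := exists_hasDerivAt_eq_slope (fun x : ℝ => x ^ α) _ hyx
    (continuous_id.rpow_const fun _ => Or.inr (by linarith)).continuousOn
    fun x _ => Real.hasDerivAt_rpow_const (Or.inr hα.le)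
  rw [eq_div_iff (by linarith)] at he
  rw [← he]
  have h1 : c ^ (α - 1) ≤ 1 := Real.rpow_le_one (by linarith [hc.1]) (by linarith [hc.2])
    (by linarith)
  have h2 : 0 ≤ (x - y) := by linarith
  calc α * c ^ (α - 1) * (x - y) ≤ α * 1 * (x - y) := by gcongr
    _ = _ := by ring

lemma Adm.le_hf_sub (h : Adm δ w) (hδ : 0 < δ) (hw : Weight w) (hα : 1 < α) (hv : 0 < v)
    (hv1 : v ≤ 1) {a b : ℝ} (ha : -v ≤ a) (hab : a ≤ b) (hb : b ≤ 1) :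
    slopeBound δ / α * (b - a) ≤ hf α w v b - hf α w v a := by
  have h1 := h.le_hf_rpow hδ hw hα hv hv1 ha hab hb
  have h2 := rpow_sub_le hα (hf_nonneg (α := α) (w := w) (v := v) a) (hw.monotone_hf hα hv hab)
    (hw.hf_mapsTo_Icc hα hv hb).2
  rw [div_mul_eq_mul_div, div_le_iff₀ (by linarith)]
  linarith

lemma Weight.monotone_iterate (hw : Weight w) (hα : 1 < α) (hv : 0 < v) (n : ℕ) :
    Monotone (hf α w v)^[n] := (hw.monotone_hf hα hv).iterate n

lemma Weight.iterate_mem (hw : Weight w) (hα : 1 < α) (hv : 0 < v) (n : ℕ) {x : ℝ}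
    (hx : x ∈ Icc (-v) 1) : (hf α w v)^[n] x ∈ Icc (-v) 1 := by
  induction n with
  | zero => exact hx
  | succ n ih =>
    rw [Function.iterate_succ_apply']
    have := hw.hf_mapsTo_Icc hα hv ih.2
    exact ⟨by linarith [this.1], this.2⟩

lemma Adm.le_iterate_sub (h : Adm δ w) (hδ : 0 < δ) (hw : Weight w) (hα : 1 < α) (hv : 0 < v)
    (hv1 : v ≤ 1) {a b : ℝ} (ha : -v ≤ a) (hab : a ≤ b) (hb : b ≤ 1) (n : ℕ) :
    (slopeBound δ / α) ^ n * (b - a) ≤ (hf α w v)^[n] b - (hf α w v)^[n] a := by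
  induction n with
  | zero => simp
  | succ n ih =>
    rw [Function.iterate_succ_apply', Function.iterate_succ_apply']
    refine le_trans ?_ (h.le_hf_sub hδ hw hα hv hv1 (hw.iterate_mem hα hv n ⟨ha, hab.trans hb⟩).1
      (hw.monotone_iterate hα hv n hab) (hw.iterate_mem hα hv n ⟨ha.trans hab, hb⟩).2)
    rw [pow_succ', mul_assoc]
    have := slopeBound_pos hδ
    gcongr

/-- A lower bound for the critical value of the renormalized map. -/
noncomputable def valueBound (α δ : ℝ) : ℝ := slopeBound δ ^ (α - 1)⁻¹

lemma valueBound_pos (hδ : 0 < δ) : 0 < valueBound α δ := Real.rpow_pos_of_pos (slopeBound_pos hδ) _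

lemma valueBound_le_one (hα : 1 < α) (hδ : 0 < δ) : valueBound α δ ≤ 1 :=
  Real.rpow_le_one (slopeBound_pos hδ).le (slopeBound_lt_one hδ).le
    (inv_nonneg.2 (by linarith))

lemma valueBound_rpow (hα : 1 < α) (hδ : 0 < δ) :
    valueBound α δ ^ α = slopeBound δ * valueBound α δ := by
  have h1 : valueBound α δ ^ (α - 1) = slopeBound δ :=
    Real.rpow_inv_rpow (slopeBound_pos hδ).le (by linarith)
  have h2 := Real.rpow_sub_one (valueBound_pos (α := α) hδ).ne' α
  rw [h1] at h2
  rw [h2]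
  have := valueBound_pos (α := α) hδ
  field_simp

lemma Adm.valueBound_le_hf (h : Adm δ w) (hδ : 0 < δ) (hw : Weight w) (hα : 1 < α)
    (hv : valueBound α δ ≤ v) (hv1 : v ≤ 1) {x : ℝ} (hx : 0 ≤ x) (hx1 : x ≤ 1) :
    valueBound α δ ≤ hf α w v x := by
  have hp := valueBound_pos (α := α) hδ
  have hs := slopeBound_pos hδ
  have h1 := h.le_hf_rpow hδ hw hα (hp.trans_le hv) hv1 le_rfl (by linarith : -v ≤ x) hx1
  rw [hw.hf_neg hα (hp.trans_le hv), Real.zero_rpow (by linarith), sub_zero] at h1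
  have h2 : valueBound α δ ^ α ≤ hf α w v x ^ α := by
    rw [valueBound_rpow hα hδ]
    refine le_trans ?_ h1
    gcongr
    linarith
  exact (Real.rpow_le_rpow_iff hp.le (hf_nonneg x) (by linarith)).1 h2

lemma Adm.half_valueBound_le_hf (h : Adm δ w) (hδ : 0 < δ) (hw : Weight w) (hα : 1 < α)
    (hv : valueBound α δ ≤ v) (hv1 : v ≤ 1) {x : ℝ} (hx : -v / 2 ≤ x) (hx1 : x ≤ 1) :
    valueBound α δ / 2 ≤ hf α w v x := by
  have hp := valueBound_pos (α := α) hδ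
  have hs := slopeBound_pos hδ
  have h1 := h.le_hf_rpow hδ hw hα (hp.trans_le hv) hv1 le_rfl (by linarith : -v ≤ x) hx1
  rw [hw.hf_neg hα (hp.trans_le hv), Real.zero_rpow (by linarith), sub_zero] at h1
  have h2 : (valueBound α δ / 2) ^ α ≤ hf α w v x ^ α := by
    rw [Real.div_rpow hp.le (by norm_num), valueBound_rpow hα hδ]
    refine le_trans ?_ h1
    have h3 : (2 : ℝ) ≤ 2 ^ α := by
      simpa using Real.rpow_le_rpow_of_exponent_le (by norm_num : (1 : ℝ) ≤ 2) hα.le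
    calc slopeBound δ * valueBound α δ / 2 ^ α ≤ slopeBound δ * valueBound α δ / 2 := by gcongr
      _ ≤ slopeBound δ * v / 2 := by gcongr
      _ = slopeBound δ * (v / 2) := by ring
      _ ≤ _ := by gcongr; linarith
  exact (Real.rpow_le_rpow_iff (by positivity) (hf_nonneg x) (by linarith)).1 h2

lemma Adm.half_valueBound_le_iterate (h : Adm δ w) (hδ : 0 < δ) (hw : Weight w) (hα : 1 < α)
    (hv : valueBound α δ ≤ v) (hv1 : v ≤ 1) {x : ℝ} (hx : -v / 2 ≤ x) (hx1 : x ≤ 1) (n : ℕ) :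
    valueBound α δ / 2 ≤ (hf α w v)^[n + 1] x := by
  have hp := valueBound_pos (α := α) hδ
  rw [Function.iterate_succ_apply']
  refine h.half_valueBound_le_hf hδ hw hα hv hv1 ?_
    (hw.iterate_mem hα (hp.trans_le hv) n ⟨by linarith, hx1⟩).2
  cases n with
  | zero => exact hx
  | succ n =>
    rw [Function.iterate_succ_apply']
    linarith [hf_nonneg (α := α) (w := w) (v := v) ((hf α w v)^[n] x)]

end
end Renorm

namespace Renorm

open Set Topology

section
variable {α δ v s : ℝ} {w : ℝ → ℝ}

lemma Adm.le_three_mul (h : Adm δ w) (hδ : 0 < δ) (hw : Weight w) (hv1 : v ≤ 1)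
    {x y : ℝ} (hx : v - 2 * δ * v ≤ x) (hxv : x ≤ v) (hy : v - 2 * δ * v ≤ y) (hyv : y ≤ v)
    (hx1 : -1 ≤ x) (hy1 : -1 ≤ y) : w x ≤ 3 * w y := by
  have hδv : δ * v ≤ δ := by nlinarith
  have hp := hw.pos x
  have hq := hw.pos y
  rcases le_total x y with hxy | hxy
  · have h1 := h.right x ⟨hx1, hxv.trans hv1⟩ y ⟨hy1, hyv.trans hv1⟩ hxy
    have h2 : 1 + δ - x ≤ 3 * (1 + δ - y) := by linarith
    have h3 : 0 < 1 + δ - y := by linarith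
    have h4 := mul_le_mul_of_nonneg_left h2 hq.le
    have h5 : w x * (1 + δ - y) ≤ (3 * w y) * (1 + δ - y) := by linarith
    exact le_of_mul_le_mul_right h5 h3
  · have h1 := h.left y ⟨hy1, hyv.trans hv1⟩ x ⟨hx1, hxv.trans hv1⟩ hxy
    have h2 : 1 + δ + x ≤ 3 * (1 + δ + y) := by linarith
    have h3 : 0 < 1 + δ + y := by linarith
    have h4 := mul_le_mul_of_nonneg_left h2 hq.le
    have h5 : w x * (1 + δ + y) ≤ (3 * w y) * (1 + δ + y) := by linarith
    exact le_of_mul_le_mul_right h5 h3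

lemma Adm.Uf_ninth (h : Adm δ w) (hδ : 0 < δ) (hδ1 : δ ≤ 1 / 2) (hw : Weight w) (hv : 0 < v)
    (hv1 : v ≤ 1) {q : ℝ} (hq : (1 - δ) * v ≤ q) (hqv : q < v) :
    Uf w v q ≤ 9 * (Uf w v (q - δ * v) - Uf w v q) := by
  have hδv : 0 < δ * v := mul_pos hδ hv
  have hδv' : δ * v ≤ v / 2 := by nlinarith
  obtain ⟨a, ha, hae⟩ := exists_hasDerivAt_eq_slope (Pf w) _ (by linarith : q - δ * v < q)
    hw.continuous_Pf.continuousOn fun x _ => hw.hasDerivAt_Pf x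
  obtain ⟨b, hb, hbe⟩ := exists_hasDerivAt_eq_slope (Pf w) _ hqv
    hw.continuous_Pf.continuousOn fun x _ => hw.hasDerivAt_Pf x
  rw [eq_div_iff (by linarith)] at hae hbe
  have hab : w a ≤ 3 * w b := h.le_three_mul hδ hw hv1 (by linarith [ha.1]) (by linarith [ha.2])
    (by linarith [hb.1]) hb.2.le (by linarith [ha.1]) (by linarith [hb.1])
  have hpa := hw.pos a
  have hpb := hw.pos b
  have h1 : (w b ^ 2)⁻¹ ≤ 9 * (w a ^ 2)⁻¹ := by
    rw [← div_eq_mul_inv, inv_le_comm₀ (by positivity) (by positivity), inv_div, div_le_iff₀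
      (by norm_num)]
    nlinarith
  have h2 : 0 < (w a ^ 2)⁻¹ := by positivity
  have h3 : (w b ^ 2)⁻¹ * (v - q) ≤ 9 * (w a ^ 2)⁻¹ * (δ * v) := by
    have : v - q ≤ δ * v := by linarith
    have : 0 ≤ v - q := by linarith
    gcongr
  have hD := hw.den_pos hv
  have e : Uf w v (q - δ * v) - Uf w v q =
      (Pf w q - Pf w (q - δ * v)) / (Pf w v - Pf w (-1)) := by
    unfold Uf; rw [← sub_div]; ring
  rw [e, Uf, ← mul_div_assoc, div_le_div_iff_of_pos_right hD, ← hae, ← hbe]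
  linarith

/-- The data of a fixed point of the renormalization operator. -/
structure Fixed (α δ : ℝ) (n : ℕ) (w : ℝ → ℝ) (v s : ℝ) : Prop where
  adm : Adm δ w
  weight : Weight w
  v_pos : 0 < v
  v_lt : v < 1
  s_pos : 0 < s
  s_le : s ≤ (1 - δ) * v
  iterate_v : (hf α w v)^[n] (s * v) = v
  Uf_iterate : ∀ y ∈ Icc (-1 : ℝ) 1, Uf w v ((hf α w v)^[n] (s * y)) = s ^ α * Uf w v y
  le_iterate : s ≤ (hf α w v)^[n] (-s)
  RW_eq : ∀ y ∈ Icc (-1 : ℝ) 1, RW α w v s n y = RW α w v s n 0 * w y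

/-- The renormalized diffeomorphism is affinely conjugate to the original one as soon as the
weights agree. -/
lemma Weight.Uf_iterate_eq (hw : Weight w) (hα : 1 < α) (hv : 0 < v) (hv1 : v ≤ 1) (hs : 0 < s)
    {n : ℕ} (hsub : Icc (-1) 1 ⊆ Ioo (-v / s) (1 / s))
    (hRW : ∀ y ∈ Icc (-1 : ℝ) 1, RW α w v s n y = RW α w v s n 0 * w y)
    (hfix : (hf α w v)^[n] (s * v) = v) {y : ℝ} (hy : y ∈ Icc (-1 : ℝ) 1) :
    Uf w v ((hf α w v)^[n] (s * y)) = Uf w v ((hf α w v)^[n] (-s)) * Uf w v y := by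
  set C := (√s)⁻¹ * (√α * √(Pf w v - Pf w (-1))) ^ n with hC
  have hCp : 0 < C := hw.const_pos hα hv hs n
  set κ := ((C * RW α w v s n 0) ^ 2)⁻¹ with hκ
  have hd : ∀ y ∈ Icc (-1 : ℝ) 1, HasDerivAt
      (fun y => Pf w ((hf α w v)^[n] (s * y)) - κ * Pf w y) 0 y := fun y hy => by
    have h1 := (hw.sc_RW hα hv hv1 hs n).deriv y (hsub hy)
    rw [hRW y hy, ← hC] at h1
    refine (h1.sub ((hw.hasDerivAt_Pf y).const_mul κ)).congr_deriv ?_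
    rw [hκ, ← mul_assoc, mul_pow, mul_inv, sub_self]
  have hconst : ∀ y ∈ Icc (-1 : ℝ) 1, Pf w ((hf α w v)^[n] (s * y)) - κ * Pf w y =
      Pf w ((hf α w v)^[n] (s * -1)) - κ * Pf w (-1) := by
    intro y hy
    exact constant_of_has_deriv_right_zero (fun x hx => (hd x hx).continuousAt.continuousWithinAt)
      (fun x hx => (hd x (Ico_subset_Icc_self hx)).hasDerivWithinAt) y hy
  have hcv := hconst v ⟨by linarith, hv1⟩
  rw [hfix] at hcv
  have hD := hw.den_pos hv
  have key : ∀ y ∈ Icc (-1 : ℝ) 1, Uf w v ((hf α w v)^[n] (s * y)) = κ * Uf w v y := by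
    intro y hy
    have h1 := hconst y hy
    unfold Uf
    rw [← mul_div_assoc]
    congr 1
    linarith
  have h1 := key (-1) ⟨le_rfl, by norm_num⟩
  rw [hw.Uf_neg_one hv, mul_one, mul_neg_one] at h1
  rw [h1, key y hy]

end

set_option maxHeartbeats 1000000 in
theorem exists_fixed {α δ : ℝ} (hα : 1 < α) {n : ℕ} (hn : n ≠ 0) (hδ : δ = 1 / (20 * α)) :
    ∃ w v s, Fixed α δ n w v s := by
  have hα0 : 0 < α := by linarith
  have hδ0 : 0 < δ := by rw [hδ]; positivity
  have hαδ : α * δ = 1 / 20 := by rw [hδ]; field_simp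
  have hδ1 : δ ≤ 1 / 20 := by nlinarith
  obtain ⟨n, rfl⟩ := Nat.exists_eq_succ_of_ne_zero hn
  have hc := slopeBound_pos hδ0
  have hvb := valueBound_pos (α := α) hδ0
  have hvb1 := valueBound_le_one hα hδ0
  set K := slopeBound δ * (slopeBound δ / α) ^ (n + 1) with hK
  have hK0 : 0 < K := by positivity
  set r₀ := min (valueBound α δ / 4) ((K / 2) ^ (α - 1)⁻¹) with hr₀
  have hr₀p : 0 < r₀ := lt_min (by positivity) (by positivity)
  have hr₀v : r₀ ≤ valueBound α δ / 4 := min_le_left _ _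
  have hr₀K : r₀ ^ (α - 1) < K := by
    have h1 : r₀ ^ (α - 1) ≤ ((K / 2) ^ (α - 1)⁻¹) ^ (α - 1) :=
      Real.rpow_le_rpow hr₀p.le (min_le_right _ _) (by linarith)
    rw [Real.rpow_inv_rpow (by positivity) (by linarith)] at h1
    linarith
  obtain ⟨f, hf', v, r, hv₀, hv1, hr, hr1, hRW, hfix, hclip⟩ := exists_clipped_fixedPoint hα hn hδ0
    hvb hvb1 hr₀p (by linarith) fun f hf v hv hv1 x hx hx1 =>
      hf.valueBound_le_hf hδ0 (hf.weight_ext hδ0) hα hv hv1 hx hx1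
  have hw := hf'.weight_ext hδ0
  set w := ext f with hw'
  have hv : 0 < v := hvb.trans_le hv₀
  have hrp : 0 < r := hr₀p.trans_le hr
  set s := r * v with hs
  have hsp : 0 < s := mul_pos hrp hv
  have hsv : s ≤ (1 - δ) * v := by rw [hs]; gcongr
  have hsv' : s < v := by nlinarith
  have hsvv : s * v < s := by nlinarith
  have hssv : 0 < s * v := mul_pos hsp hv
  set q := (hf α w v)^[n + 1] (-s) with hq
  set y₁ := (hf α w v)^[n] (-s) with hy₁
  set z₁ := (hf α w v)^[n] (s * v) with hz₁
  have hqy : q = hf α w v y₁ := Function.iterate_succ_apply' _ _ _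
  have hvz : v = hf α w v z₁ := 
    hfix.symm.trans (Function.iterate_succ_apply' _ _ _)
  have hy₁m : y₁ ∈ Icc (-v) 1 := hw.iterate_mem hα hv n ⟨by linarith, by linarith⟩
  have hz₁0 : 0 ≤ z₁ := by
    rw [hz₁]
    cases n with
    | zero => exact hssv.le
    | succ n => rw [Function.iterate_succ_apply']; exact hf_nonneg _
  have hq0 : 0 ≤ q := hqy ▸ hf_nonneg _
  have hqv : q < v := by
    suffices hlt : y₁ < z₁ by
      exact hqy.trans_lt ((hw.strictMonoOn_hf hα hv hy₁m.1 (mem_Ici.2 (by linarith)) hlt).trans_eq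
        hvz.symm)
    have := hf'.le_iterate_sub hδ0 hw hα hv hv1.le (a := -s) (b := s * v) (by linarith)
      (by linarith) (by linarith) n
    have h2 : 0 < (slopeBound δ / α) ^ n * (s * v - -s) := by
      have : 0 < s * v - -s := by linarith
      positivity
    linarith
  have hUq : 0 < Uf w v q := hw.Uf_pos hv hqv
  have hnext : nextRatio α w v s (n + 1) = min q (Uf w v q ^ α⁻¹) / v := by
    rw [nextRatio, ← hq, max_eq_right hUq.le]
  change r = max r₀ (min (1 - δ) (nextRatio α w v s (n + 1))) at hclip
  rw [hnext] at hclip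
  have hpow : ∀ x, 0 ≤ x → (x ≤ Uf w v q ^ α⁻¹ ↔ x ^ α ≤ Uf w v q) := fun x hx =>
    Real.le_rpow_inv_iff_of_pos hx hUq.le hα0
  have hpow' : ∀ x, 0 ≤ x → (x < Uf w v q ^ α⁻¹ ↔ x ^ α < Uf w v q) := fun x hx =>
    Real.lt_rpow_inv_iff_of_pos hx hUq.le hα0
  have hr₀r : r₀ ≠ r := by
    intro hr0
    have h1 : s < q := by
      have h2 := hf'.half_valueBound_le_iterate hδ0 hw hα hv₀ hv1.le (x := -s)
        (by rw [hs, ← hr0]; nlinarith) (by linarith) n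
      rw [← hq] at h2
      have h3 : s ≤ r₀ := by rw [hs, ← hr0]; nlinarith
      linarith
    have h2 : s ^ α < Uf w v q := by
      have h3 := hf'.le_iterate_sub hδ0 hw hα hv hv1.le (a := -s) (b := s * v) (by linarith)
        (by linarith) (by linarith) (n + 1)
      have h4 := hf'.le_Uf_sub hδ0 hw hv hv1.le (a := q) (b := v) (by linarith) hqv.le hv1.le
      rw [Uf_self, sub_zero] at h4
      change _ ≤ (hf α w v)^[n + 1] (s * v) - q at h3
      change (hf α w v)^[n + 1] (s * v) = v at hfix
      rw [hfix] at h3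
      have h5 : s ^ (α - 1) < K := by
        refine lt_of_le_of_lt (Real.rpow_le_rpow hsp.le ?_ (by linarith)) hr₀K
        rw [hs, ← hr0]; nlinarith
      have h6 : s ^ α = s ^ (α - 1) * s := by
        rw [Real.rpow_sub_one hsp.ne']; field_simp
      have h7 : (slopeBound δ / α) ^ (n + 1) * s ≤ (slopeBound δ / α) ^ (n + 1) * (s * v - -s) := by
        gcongr
        linarith
      calc s ^ α < K * s := by rw [h6]; gcongr
        _ = slopeBound δ * ((slopeBound δ / α) ^ (n + 1) * s) := by rw [hK]; ring
        _ ≤ slopeBound δ * (v - q) := by gcongr; linarith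
        _ ≤ _ := h4
    have h3 : r₀ < min (1 - δ) (min q (Uf w v q ^ α⁻¹) / v) := by
      refine lt_min (by linarith) ?_
      rw [lt_div_iff₀ hv, hr0]
      exact lt_min h1 ((hpow' s hsp.le).2 h2)
    rw [max_eq_right h3.le] at hclip
    linarith
  have hr2 : r = min (1 - δ) (min q (Uf w v q ^ α⁻¹) / v) := by
    rcases max_choice r₀ (min (1 - δ) (min q (Uf w v q ^ α⁻¹) / v)) with h | h
    · exact absurd (hclip.trans h).symm hr₀r
    · exact hclip.trans h
  have hle : s ≤ min q (Uf w v q ^ α⁻¹) := by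
    rw [← le_div_iff₀ hv]
    exact hr2.le.trans (min_le_right _ _)
  have hsq : s ≤ q := hle.trans (min_le_left _ _)
  have hsU : s ^ α ≤ Uf w v q := (hpow s hsp.le).1 (hle.trans (min_le_right _ _))
  have hrδ : r ≠ 1 - δ := by
    intro hr3
    have hsδ : s = (1 - δ) * v := by rw [hs, hr3]
    have h1 := hf'.Uf_ninth hδ0 (by linarith) hw hv hv1.le (hsδ ▸ hsq) hqv
    have h2 : Uf w v (q - δ * v) ≤ v ^ α := by
      have h4 : v ^ α = Uf w v (-z₁) := by
        conv_lhs => rw [hvz]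
        exact hw.hf_rpow hα hv (by linarith)
      rw [h4]
      exact (hw.strictAnti_Uf hv).antitone (by nlinarith)
    have h3 : s ^ α = (1 - δ) ^ α * v ^ α := by
      rw [hsδ, Real.mul_rpow (by linarith) hv.le]
    have h4 : 1 + α * (-δ) ≤ (1 + -δ) ^ α := one_add_mul_self_le_rpow_one_add (by linarith) hα.le
    rw [← sub_eq_add_neg] at h4
    have h5 : 0 < v ^ α := by positivity
    have h6 : (1 + α * (-δ)) * v ^ α ≤ (1 - δ) ^ α * v ^ α := by gcongr
    rw [mul_neg, hαδ] at h6
    linarith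
  have hr4 : s = min q (Uf w v q ^ α⁻¹) := by
    have h1 : r = min q (Uf w v q ^ α⁻¹) / v := by
      rcases min_choice (1 - δ) (min q (Uf w v q ^ α⁻¹) / v) with h | h
      · exact absurd (hr2.trans h) hrδ
      · exact hr2.trans h
    rw [hs]
    exact (eq_div_iff hv.ne').1 h1
  have hsU' : s ^ α = Uf w v q := by
    refine hsU.antisymm ?_
    by_contra! hlt
    have h1 := (hpow' s hsp.le).2 hlt
    have h2 : s = q := by
      rcases min_choice q (Uf w v q ^ α⁻¹) with h | h
      · exact hr4.trans h
      · exact absurd (hr4.trans h) h1.ne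
    have h3 : q ^ α = Uf w v (-y₁) := by
      conv_lhs => rw [hqy]
      exact hw.hf_rpow hα hv hy₁m.1
    have h4 : Uf w v q ≤ Uf w v (-y₁) := by
      refine (hw.strictAnti_Uf hv).antitone ?_
      rw [← h2, hy₁]
      cases n with
      | zero => simp
      | succ n =>
        rw [Function.iterate_succ_apply']
        linarith [hf_nonneg (α := α) (w := w) (v := v) ((hf α w v)^[n] (-s))]
    rw [← h3, ← h2] at h4
    rw [← h2] at hlt
    linarith
  refine ⟨w, v, s, hf', hw, hv, hv1, hsp, hsv, hfix, fun y hy => ?_, hsq, hRW⟩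
  rw [hsU']
  exact hw.Uf_iterate_eq hα hv hv1.le hsp ((Icc_subset_Icc (by linarith) (by linarith)).trans
    (Icc_subset_domain hδ0 hv hv1.le hrp hr1)) hRW hfix hy

end Renorm

namespace Renorm

open Set Topology

/-- `l` and `r` are the one-sided derivatives of `f` at `x`. -/
def OneSided (f : ℝ → ℝ) (x l r : ℝ) : Prop :=
  HasDerivWithinAt f l (Iic x) x ∧ HasDerivWithinAt f r (Ici x) x

lemma OneSided.unique {f : ℝ → ℝ} {x l r l' r' : ℝ} (h : OneSided f x l r)
    (h' : OneSided f x l' r') : l = l' ∧ r = r' :=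
  ⟨(uniqueDiffWithinAt_Iic x).eq_deriv _ h.1 h'.1, (uniqueDiffWithinAt_Ici x).eq_deriv _ h.2 h'.2⟩

lemma OneSided.congr {f g : ℝ → ℝ} {x l r : ℝ} (h : OneSided f x l r) (hfg : g =ᶠ[𝓝 x] f) :
    OneSided g x l r :=
  ⟨h.1.congr_of_eventuallyEq (hfg.filter_mono nhdsWithin_le_nhds) hfg.eq_of_nhds,
    h.2.congr_of_eventuallyEq (hfg.filter_mono nhdsWithin_le_nhds) hfg.eq_of_nhds⟩

lemma OneSided.of_hasDerivAt {f : ℝ → ℝ} {x d : ℝ} (h : HasDerivAt f d x) : OneSided f x d d :=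
  ⟨h.hasDerivWithinAt, h.hasDerivWithinAt⟩

lemma OneSided.hasDerivAt {f : ℝ → ℝ} {x d : ℝ} (h : OneSided f x d d) : HasDerivAt f d x := by
  have := h.1.union h.2
  rwa [Iic_union_Ici, hasDerivWithinAt_univ] at this

lemma OneSided.add {f g : ℝ → ℝ} {x l r l' r' : ℝ} (h : OneSided f x l r)
    (h' : OneSided g x l' r') : OneSided (fun x => f x + g x) x (l + l') (r + r') :=
  ⟨h.1.add h'.1, h.2.add h'.2⟩

lemma OneSided.sum {ι : Type*} {s : Finset ι} {f : ι → ℝ → ℝ} {x : ℝ} {l r : ι → ℝ}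
    (h : ∀ i, OneSided (f i) x (l i) (r i)) :
    OneSided (fun x => ∑ i ∈ s, f i x) x (∑ i ∈ s, l i) (∑ i ∈ s, r i) :=
  ⟨HasDerivWithinAt.fun_sum fun i _ => (h i).1, HasDerivWithinAt.fun_sum fun i _ => (h i).2⟩

lemma OneSided.log {f : ℝ → ℝ} {x l r : ℝ} (h : OneSided f x l r) (hx : 0 < f x) :
    OneSided (fun x => Real.log (f x)) x (l / f x) (r / f x) :=
  ⟨h.1.log hx.ne', h.2.log hx.ne'⟩

lemma OneSided.comp_monotone {f z : ℝ → ℝ} {x l r d : ℝ} (h : OneSided f (z x) l r)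
    (hz : HasDerivAt z d x) (hm : Monotone z) :
    OneSided (fun x => f (z x)) x (l * d) (r * d) :=
  ⟨h.1.comp x hz.hasDerivWithinAt fun _ hy => hm hy,
    h.2.comp x hz.hasDerivWithinAt fun _ hy => hm hy⟩

lemma OneSided.comp_antitone {f z : ℝ → ℝ} {x l r d : ℝ} (h : OneSided f (z x) l r)
    (hz : HasDerivAt z d x) (hm : Antitone z) :
    OneSided (fun x => f (z x)) x (r * d) (l * d) :=
  ⟨h.2.comp x hz.hasDerivWithinAt fun _ hy => hm hy,
    h.1.comp x hz.hasDerivWithinAt fun _ hy => hm hy⟩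

lemma OneSided.exists_comp {f z : ℝ → ℝ} {x l r d : ℝ} (h : OneSided f (z x) l r)
    (hz : HasDerivAt z d x) (hm : Monotone z ∨ Antitone z) :
    ∃ p : ℝ × ℝ, OneSided (fun x => f (z x)) x p.1 p.2 ∧ p.1 - p.2 = (l - r) * |d| := by
  rcases hm with hm | hm
  · refine ⟨(_, _), h.comp_monotone hz hm, ?_⟩
    have : 0 ≤ d := hz.deriv ▸ hm.deriv_nonneg
    rw [abs_of_nonneg this]
    ring
  · refine ⟨(_, _), h.comp_antitone hz hm, ?_⟩
    have : d ≤ 0 := hz.deriv ▸ hm.deriv_nonpos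
    rw [abs_of_nonpos this]
    ring

lemma exists_oneSided_of_concaveOn {a b : ℝ} {f : ℝ → ℝ} (hf : ConcaveOn ℝ (Ioo a b) f) :
    ∃ l r : ℝ → ℝ, (∀ x ∈ Ioo a b, OneSided f x (l x) (r x)) ∧ (∀ x ∈ Ioo a b, r x ≤ l x) ∧
      ∀ x ∈ Ioo a b, ∀ y ∈ Ioo a b, x < y → l y ≤ r x := by
  have hc := hf.neg
  have hi : ∀ x ∈ Ioo a b, x ∈ interior (Ioo a b) := fun x hx => by rwa [interior_Ioo]
  refine ⟨fun x => -derivWithin (-f) (Iio x) x, fun x => -derivWithin (-f) (Ioi x) x,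
    fun x hx => ⟨?_, ?_⟩, fun x hx => ?_, fun x hx y hy hxy => ?_⟩
  · simpa using (hc.hasDerivWithinAt_leftDeriv_of_mem_interior (hi x hx)).neg.Iic_of_Iio
  · simpa using (hc.hasDerivWithinAt_rightDeriv_of_mem_interior (hi x hx)).neg.Ici_of_Ioi
  · exact neg_le_neg (hc.leftDeriv_le_rightDeriv_of_mem_interior (hi x hx))
  · refine neg_le_neg ?_
    exact (hc.rightDeriv_le_slope_of_mem_interior (hi x hx) hy hxy).trans
      (hc.slope_le_leftDeriv_of_mem_interior hx (hi y hy) hxy)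

lemma sum_jump_le {l r : ℝ → ℝ} {M : ℝ} (F : Finset ℝ)
    (hM : ∀ x ∈ F, l x ≤ M) (hlr : ∀ x ∈ F, ∀ y ∈ F, x < y → l y ≤ r x)
    (c : ℝ) (hc : ∀ x ∈ F, c ≤ r x) (hcM : c ≤ M) : ∑ x ∈ F, (l x - r x) ≤ M - c := by
  induction F using Finset.induction_on_max generalizing c with
  | empty => simpa using hcM
  | insert a F hF ih =>
    have ha : a ∉ F := fun h => lt_irrefl _ (hF a h)
    rw [Finset.sum_insert ha]
    have h1 := ih (fun x hx => hM x (Finset.mem_insert_of_mem hx))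
      (fun x hx y hy => hlr x (Finset.mem_insert_of_mem hx) y (Finset.mem_insert_of_mem hy))
      (l a) (fun x hx => hlr x (Finset.mem_insert_of_mem hx) a (Finset.mem_insert_self _ _) (hF x hx))
      (hM a (Finset.mem_insert_self _ _))
    linarith [hc a (Finset.mem_insert_self _ _)]

/-- A nonnegative function with uniformly bounded finite sums vanishes if its values are dominated,
up to a factor `θ < 1`, by the sum of its values at points which are all different. -/
lemma eq_zero_of_le_sum_comp {X ι : Type*} [Fintype ι] {g : X → ℝ} (hg : ∀ x, 0 ≤ g x)
    {Z : X × ι → X} (hZ : Function.Injective Z) {θ c : ℝ} (hθ : 0 ≤ θ) (hθ1 : θ < 1)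
    (hgZ : ∀ x, g x ≤ θ * ∑ i, g (Z (x, i))) (hc : ∀ F : Finset X, ∑ x ∈ F, g x ≤ c) (x : X) :
    g x = 0 := by
  have key : ∀ m : ℕ, ∀ F : Finset X, ∑ x ∈ F, g x ≤ θ ^ m * c := by
    intro m
    induction m with
    | zero => simpa using hc
    | succ m ih =>
      intro F
      calc ∑ x ∈ F, g x ≤ ∑ x ∈ F, θ * ∑ i, g (Z (x, i)) := Finset.sum_le_sum fun x _ => hgZ x
        _ = θ * ∑ p ∈ F ×ˢ Finset.univ, g (Z p) := by rw [← Finset.mul_sum, Finset.sum_product]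
        _ = θ * ∑ y ∈ (F ×ˢ Finset.univ).map ⟨Z, hZ⟩, g y := by rw [Finset.sum_map]; rfl
        _ ≤ θ * (θ ^ m * c) := mul_le_mul_of_nonneg_left (ih _) hθ
        _ = _ := by ring
  refine (hg x).antisymm' ?_
  have h1 : Filter.Tendsto (fun m : ℕ => θ ^ m * c) Filter.atTop (𝓝 (0 * c)) :=
    (tendsto_pow_atTop_nhds_zero_of_lt_one hθ hθ1).mul_const c
  rw [zero_mul] at h1
  exact ge_of_tendsto' h1 fun m => by simpa using key m {x}

end Renorm

namespace Renorm

open Set Topology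

lemma hyperbolic_density_le {A z : ℝ} (hA : 1 < A) (hz : z ∈ Ioo (-1 : ℝ) 1) :
    1 / (A - z) + 1 / (A + z) ≤ A⁻¹ * (1 / (1 - z) + 1 / (1 + z)) := by
  have h1 : 0 < 1 - z := by linarith [hz.2]
  have h2 : 0 < 1 + z := by linarith [hz.1]
  have h3 : 0 < A - z := by linarith
  have h4 : 0 < A + z := by linarith
  have e1 : 1 / (A - z) + 1 / (A + z) = (2 * A) / ((A - z) * (A + z)) := by field_simp; ring
  have e2 : A⁻¹ * (1 / (1 - z) + 1 / (1 + z)) = 2 / (A * ((1 - z) * (1 + z))) := by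
    field_simp; ring
  rw [e1, e2, div_le_div_iff₀ (by positivity) (by positivity)]
  nlinarith [mul_nonneg (sq_nonneg z) (by nlinarith : 0 ≤ A ^ 2 - 1)]

/-- A concave solution of a contracting multiplicative functional equation is differentiable. -/
theorem differentiableAt_of_log_eq {a b A : ℝ} {W D : ℝ → ℝ} {ι : Type*} [Fintype ι]
    {z dz : ι → ℝ → ℝ} (hI : Icc (-1) 1 ⊆ Ioo a b) (hc : ConcaveOn ℝ (Ioo a b) W)
    (hpos : ∀ y ∈ Ioo a b, 0 < W y) (hA : 1 < A)
    (hz : ∀ i, ∀ y ∈ Ioo (-1 : ℝ) 1, HasDerivAt (z i) (dz i y) y)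
    (hm : ∀ i, MapsTo (z i) (Ioo (-1) 1) (Ioo (-1) 1))
    (hmono : ∀ i, Monotone (z i) ∨ Antitone (z i))
    (hinj : ∀ i j, ∀ x ∈ Ioo (-1 : ℝ) 1, ∀ y ∈ Ioo (-1 : ℝ) 1, z i x = z j y → i = j ∧ x = y)
    (hcon : ∀ i, ∀ y ∈ Ioo (-1 : ℝ) 1,
      (1 / (1 - z i y) + 1 / (1 + z i y)) * |dz i y| ≤ 1 / (A - y) + 1 / (A + y))
    (hD : ∀ y ∈ Ioo (-1 : ℝ) 1, DifferentiableAt ℝ D y)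
    (hlog : ∀ y ∈ Ioo (-1 : ℝ) 1, Real.log (W y) = D y + ∑ i, Real.log (W (z i y)))
    {y : ℝ} (hy : y ∈ Ioo (-1 : ℝ) 1) : DifferentiableAt ℝ W y := by
  obtain ⟨l, r, hlr, hle, hlt⟩ := exists_oneSided_of_concaveOn hc
  have hIo : Ioo (-1) 1 ⊆ Ioo a b := Ioo_subset_Icc_self.trans hI
  have hν : ∀ y ∈ Ioo (-1 : ℝ) 1,
      (l y - r y) / W y = ∑ i, (l (z i y) - r (z i y)) / W (z i y) * |dz i y| := by
    intro y hy
    have h1 := fun i => ((hlr _ (hIo (hm i hy))).log (hpos _ (hIo (hm i hy)))).exists_comp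
      (hz i y hy) (hmono i)
    choose p hp hpe using h1
    have h2 := (OneSided.of_hasDerivAt (hD y hy).hasDerivAt).add (OneSided.sum
      (s := Finset.univ) hp)
    have h3 := (hlr y (hIo hy)).log (hpos _ (hIo hy))
    obtain ⟨e1, e2⟩ := h3.unique (h2.congr (Filter.eventuallyEq_of_mem
      (isOpen_Ioo.mem_nhds hy) hlog))
    rw [sub_div, e1, e2, add_sub_add_left_eq_sub, ← Finset.sum_sub_distrib]
    exact Finset.sum_congr rfl fun i _ => by rw [hpe, sub_div]
  set ρ : ℝ → ℝ := fun y => 1 / (A - y) + 1 / (A + y) with hρ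
  have hρ1 : ∀ y ∈ Ioo (-1 : ℝ) 1, 1 / A ≤ ρ y := by
    intro y hy
    have h3 : 0 < A - y := by linarith [hy.2]
    have h4 : 0 < A + y := by linarith [hy.1]
    rcases le_total 0 y with h | h
    · have h5 : 1 / A ≤ 1 / (A - y) := one_div_le_one_div_of_le h3 (by linarith)
      have h6 : 0 < 1 / (A + y) := by positivity
      simp only [hρ]; linarith
    · have h5 : 1 / A ≤ 1 / (A + y) := one_div_le_one_div_of_le h4 (by linarith)
      have h6 : 0 < 1 / (A - y) := by positivity
      simp only [hρ]; linarith
  have hA0 : 0 < A := by linarith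
  have hρ0 : ∀ y ∈ Ioo (-1 : ℝ) 1, 0 < ρ y := fun y hy =>
    (by positivity : 0 < 1 / A).trans_le (hρ1 y hy)
  have hν0 : ∀ y ∈ Ioo (-1 : ℝ) 1, 0 ≤ (l y - r y) / W y := fun y hy =>
    div_nonneg (sub_nonneg.2 (hle y (hIo hy))) (hpos y (hIo hy)).le
  -- the minimum of `W` on `[-1, 1]`
  obtain ⟨y₀, hy₀, hmin⟩ := isCompact_Icc.exists_isMinOn (nonempty_Icc.2 (by norm_num : (-1:ℝ) ≤ 1))
    ((hc.continuousOn isOpen_Ioo).mono hI)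
  have hW0 := hpos y₀ (hI hy₀)
  have h1I : (1 : ℝ) ∈ Ioo a b := hI (by norm_num)
  have h1I' : (-1 : ℝ) ∈ Ioo a b := hI (by norm_num)
  set C := r (-1) - l 1 with hC
  have hC0 : 0 ≤ C := by
    have h1 := hlt (-1) h1I' 0 (hI (by norm_num)) (by norm_num)
    have h2 := hlt 0 (hI (by norm_num)) 1 h1I (by norm_num)
    have h3 := hle 0 (hI (by norm_num))
    linarith
  let X := Ioo (-1 : ℝ) 1
  let g : X → ℝ := fun y => (l y - r y) / W y / ρ y
  have hg : ∀ y, 0 ≤ g y := fun y => div_nonneg (hν0 y y.2) (hρ0 y y.2).le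
  let Z : X × ι → X := fun p => ⟨z p.2 p.1, hm p.2 p.1.2⟩
  have hZ : Function.Injective Z := by
    rintro ⟨x, i⟩ ⟨y, j⟩ h
    obtain ⟨rfl, h2⟩ := hinj i j x x.2 y y.2 (congrArg Subtype.val h)
    exact Prod.ext (Subtype.ext h2) rfl
  have hgZ : ∀ x, g x ≤ A⁻¹ * ∑ i, g (Z (x, i)) := by
    intro x
    rw [div_le_iff₀ (hρ0 x x.2), hν x x.2, Finset.mul_sum, Finset.sum_mul]
    refine Finset.sum_le_sum fun i _ => ?_
    have hzi := hm i x.2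
    have h1 := hyperbolic_density_le hA hzi
    have h2 := mul_le_mul_of_nonneg_right h1 (abs_nonneg (dz i x))
    rw [mul_assoc] at h2
    have h3 : ρ (z i x) * |dz i x| ≤ A⁻¹ * ρ x :=
      h2.trans (mul_le_mul_of_nonneg_left (hcon i x x.2) (by positivity))
    have h4 := mul_le_mul_of_nonneg_left h3 (hg (Z (x, i)))
    have h5 := (hρ0 _ hzi).ne'
    have e1 : g (Z (x, i)) * (ρ (z i x) * |dz i x|) =
      (l (z i x) - r (z i x)) / W (z i x) * |dz i x| := by
      simp only [g, Z]
      rw [← mul_assoc, div_mul_cancel₀ _ h5]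
    rw [e1] at h4
    linarith
  have hbd : ∀ F : Finset X, ∑ x ∈ F, g x ≤ A * ((W y₀)⁻¹ * C) := by
    intro F
    have h1 : ∀ x : X, g x ≤ A * ((W y₀)⁻¹ * (l x - r x)) := by
      intro x
      have h2 := hmin (Ioo_subset_Icc_self x.2)
      have h3 : (l x - r x) / W x ≤ (l x - r x) / W y₀ :=
        div_le_div_of_nonneg_left (sub_nonneg.2 (hle x (hIo x.2))) hW0 h2
      rw [div_le_iff₀ (hρ0 x x.2)]
      have h4 : 1 ≤ A * ρ x := by
        have := hρ1 x x.2
        rw [div_le_iff₀ hA0] at this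
        linarith
      have h5 : 0 ≤ (l x - r x) / W y₀ := (hν0 x x.2).trans h3
      calc (l x - r x) / W x ≤ (l x - r x) / W y₀ * 1 := by rw [mul_one]; exact h3
        _ ≤ (l x - r x) / W y₀ * (A * ρ x) := mul_le_mul_of_nonneg_left h4 h5
        _ = _ := by ring
    refine (Finset.sum_le_sum fun x _ => h1 x).trans ?_
    rw [← Finset.mul_sum, ← Finset.mul_sum]
    refine mul_le_mul_of_nonneg_left (mul_le_mul_of_nonneg_left ?_ (inv_nonneg.2 hW0.le)) hA0.le
    have h2 := sum_jump_le (l := l) (r := r) (M := r (-1)) (F.map (Function.Embedding.subtype _))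
      (fun x hx => ?_) (fun x hx y hy hxy => ?_) (l 1) (fun x hx => ?_) (by linarith)
    · rw [Finset.sum_map] at h2
      exact h2
    all_goals obtain ⟨u, -, rfl⟩ := Finset.mem_map.1 hx
    · exact hlt _ h1I' _ (hIo u.2) u.2.1
    · obtain ⟨u', -, rfl⟩ := Finset.mem_map.1 hy
      exact hlt _ (hIo u.2) _ (hIo u'.2) hxy
    · exact hlt _ (hIo u.2) _ h1I u.2.2
  have hzero := eq_zero_of_le_sum_comp hg hZ (inv_nonneg.2 hA0.le) (inv_lt_one_of_one_lt₀ hA)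
    hgZ hbd ⟨y, hy⟩
  have h1 : l y = r y := by
    rcases div_eq_zero_iff.1 hzero with h | h
    · rcases div_eq_zero_iff.1 h with h | h
      · exact sub_eq_zero.1 h
      · exact absurd h (hpos y (hIo hy)).ne'
    · exact absurd h (hρ0 y hy).ne'
  have h2 := hlr y (hIo hy)
  rw [h1] at h2
  exact h2.hasDerivAt.differentiableAt

end Renorm

namespace Renorm

open Set Topology

lemma continuousOn_of_antitoneOn_of_ordConnected_image {a b : ℝ} {g : ℝ → ℝ}
    (hg : AntitoneOn g (Ioo a b)) (hi : ∀ x ∈ Ioo a b, ∀ y ∈ Ioo a b, x ≤ y →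
      Icc (g y) (g x) ⊆ g '' Icc x y) : ContinuousOn g (Ioo a b) := by
  have key : ∀ x ∈ Ioo a b, ∀ ε > 0, (∃ y ∈ Ioo x b, g x - ε < g y) ∧
      ∃ y ∈ Ioo a x, g y < g x + ε := by
    intro x hx ε hε
    constructor
    · obtain ⟨y, hxy, hyb⟩ := exists_between hx.2
      by_cases h : g x - ε < g y
      · exact ⟨y, ⟨hxy, hyb⟩, h⟩
      obtain ⟨z, hz, hgz⟩ := hi x hx y ⟨hx.1.trans hxy, hyb⟩ hxy.le
        (show g x - ε / 2 ∈ _ from ⟨by linarith, by linarith⟩)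
      refine ⟨z, ⟨hz.1.lt_of_ne ?_, hz.2.trans_lt hyb⟩, by linarith⟩
      rintro rfl
      linarith
    · obtain ⟨y, hay, hyx⟩ := exists_between hx.1
      by_cases h : g y < g x + ε
      · exact ⟨y, ⟨hay, hyx⟩, h⟩
      obtain ⟨z, hz, hgz⟩ := hi y ⟨hay, hyx.trans hx.2⟩ x hx hyx.le
        (show g x + ε / 2 ∈ _ from ⟨by linarith, by linarith⟩)
      refine ⟨z, ⟨hay.trans_le hz.1, hz.2.lt_of_ne ?_⟩, by linarith⟩
      rintro rfl
      linarith
  intro x hx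
  refine ContinuousAt.continuousWithinAt (Metric.continuousAt_iff'.2 fun ε hε => ?_)
  obtain ⟨⟨p, hp, hgp⟩, q, hq, hgq⟩ := key x hx ε hε
  filter_upwards [Ioo_mem_nhds hq.2 hp.1] with y hy
  have hyI : y ∈ Ioo a b := ⟨hq.1.trans hy.1, hy.2.trans hp.2⟩
  have h1 := hg ⟨hq.1, hq.2.trans hx.2⟩ hyI hy.1.le
  have h2 := hg hyI ⟨hx.1.trans hp.1, hp.2⟩ hy.2.le
  rw [Real.dist_eq, abs_lt]
  constructor <;> linarith

lemma continuousOn_deriv_of_concaveOn {a b : ℝ} {f : ℝ → ℝ} (hf : ConcaveOn ℝ (Ioo a b) f)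
    (hd : ∀ x ∈ Ioo a b, DifferentiableAt ℝ f x) : ContinuousOn (deriv f) (Ioo a b) := by
  refine continuousOn_of_antitoneOn_of_ordConnected_image
    (hf.antitoneOn_deriv hd) fun x hx y hy hxy => ?_
  have hsub : Icc x y ⊆ Ioo a b := ordConnected_Ioo.out hx hy
  have := (ordConnected_Icc (a := x) (b := y)).image_deriv fun z hz => hd z (hsub hz)
  exact this.out (mem_image_of_mem _ (right_mem_Icc.2 hxy)) (mem_image_of_mem _ (left_mem_Icc.2 hxy))

namespace Fixed

variable {α δ v s : ℝ} {n : ℕ} {w : ℝ → ℝ}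

lemma s_lt (hF : Fixed α δ n w v s) (hδ : 0 < δ) : s < v := by
  nlinarith [hF.s_le, hF.v_pos]

lemma Icc_subset (hF : Fixed α δ n w v s) (hδ : 0 < δ) :
    Icc (-(1 + δ)) (1 + δ) ⊆ Ioo (-v / s) (1 / s) := by
  have hv := hF.v_pos
  have := Icc_subset_domain hδ hv hF.v_lt.le (div_pos hF.s_pos hv)
    ((div_le_iff₀ hv).2 hF.s_le)
  rwa [div_mul_cancel₀ _ hv.ne'] at this

lemma le_hf (hF : Fixed α δ n w v s) (hα : 1 < α) (hδ : 0 < δ) : s ≤ hf α w v (-s) := by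
  have h1 := hF.Uf_iterate (-1) ⟨le_rfl, by norm_num⟩
  rw [hF.weight.Uf_neg_one hF.v_pos, mul_one, mul_neg_one] at h1
  have h2 := hF.weight.hf_rpow hα hF.v_pos (x := -s) (by linarith [hF.s_lt hδ])
  have h3 := (hF.weight.strictAnti_Uf hF.v_pos).antitone hF.le_iterate
  rw [neg_neg] at h2
  rw [h1, ← h2] at h3
  exact (Real.rpow_le_rpow_iff hF.s_pos.le (hf_nonneg _) (by linarith)).1 h3

lemma monotone_iterate_neg (hF : Fixed α δ n w v s) (hα : 1 < α) (hδ : 0 < δ) :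
    Monotone fun j => (hf α w v)^[j] (-s) :=
  (hF.weight.monotone_hf hα hF.v_pos).monotone_iterate_of_le_map
    (by linarith [hF.le_hf hα hδ, hF.s_pos])

lemma neg_le_iterate (hF : Fixed α δ n w v s) (hα : 1 < α) (hδ : 0 < δ) (j : ℕ) :
    -s ≤ (hf α w v)^[j] (-s) := hF.monotone_iterate_neg hα hδ (Nat.zero_le j)

lemma iterate_le_iterate (hF : Fixed α δ n w v s) (hα : 1 < α) (hδ : 0 < δ) {i j : ℕ}
    (hij : i < j) : (hf α w v)^[i] s ≤ (hf α w v)^[j] (-s) := by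
  refine le_trans ?_ (hF.monotone_iterate_neg hα hδ hij)
  change _ ≤ (hf α w v)^[i + 1] (-s)
  rw [Function.iterate_succ_apply]
  exact hF.weight.monotone_iterate hα hF.v_pos i (hF.le_hf hα hδ)

lemma strictMonoOn (hF : Fixed α δ n w v s) (hα : 1 < α) (j : ℕ) :
    StrictMonoOn (fun y => (hf α w v)^[j] (s * y)) (Ioo (-v / s) (1 / s)) :=
  (hF.weight.sc_iterate hα hF.v_pos hF.v_lt.le hF.s_pos j).strictMonoOn

lemma iterate_mem (hF : Fixed α δ n w v s) (hα : 1 < α) (j : ℕ) {y : ℝ}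
    (hy : y ∈ Ioo (-v / s) (1 / s)) : (hf α w v)^[j] (s * y) ∈ Ioo (-v) 1 :=
  hF.weight.mapsTo_iterate' hα hF.v_pos j (mapsTo_mul_left hF.s_pos hy)

end Fixed
end Renorm

namespace Renorm

open Set Topology

/-- The maps, with disjoint images, at whose values the weight `w` occurs in `RW`. -/
noncomputable def branch (α : ℝ) (w : ℝ → ℝ) (v s : ℝ) {n : ℕ} : Option (Fin n) → ℝ → ℝ
  | none, y => (hf α w v)^[n] (s * y)
  | some j, y => -(hf α w v)^[(j : ℕ)] (s * y)

namespace Fixed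

variable {α δ v s : ℝ} {n : ℕ} {w : ℝ → ℝ}

lemma Ioo_subset (hF : Fixed α δ n w v s) (hδ : 0 < δ) : Ioo (-1) 1 ⊆ Ioo (-v / s) (1 / s) :=
  (Ioo_subset_Icc_self.trans (Icc_subset_Icc (by linarith) (by linarith))).trans
    (hF.Icc_subset hδ)

lemma lt_iterate (hF : Fixed α δ n w v s) (hα : 1 < α) (hδ : 0 < δ) (j : ℕ) {y : ℝ}
    (hy : y ∈ Ioo (-1 : ℝ) 1) : (hf α w v)^[j] (-s) < (hf α w v)^[j] (s * y) := by
  have := hF.strictMonoOn hα j (hF.Icc_subset hδ ⟨by linarith, by linarith⟩ : (-1 : ℝ) ∈ _)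
    (hF.Ioo_subset hδ hy) hy.1
  simpa using this

lemma iterate_lt (hF : Fixed α δ n w v s) (hα : 1 < α) (hδ : 0 < δ) (j : ℕ) {y : ℝ}
    (hy : y ∈ Ioo (-1 : ℝ) 1) : (hf α w v)^[j] (s * y) < (hf α w v)^[j] s := by
  have := hF.strictMonoOn hα j (hF.Ioo_subset hδ hy)
    (hF.Icc_subset hδ ⟨by linarith, by linarith⟩ : (1 : ℝ) ∈ _) hy.2
  simpa using this

lemma iterate_lt_iterate (hF : Fixed α δ n w v s) (hα : 1 < α) (hδ : 0 < δ) {i j : ℕ} (hij : i < j)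
    {x y : ℝ} (hx : x ∈ Ioo (-1 : ℝ) 1) (hy : y ∈ Ioo (-1 : ℝ) 1) :
    (hf α w v)^[i] (s * x) < (hf α w v)^[j] (s * y) :=
  (hF.iterate_lt hα hδ i hx).trans_le
    ((hF.iterate_le_iterate hα hδ hij).trans (hF.lt_iterate hα hδ j hy).le)

lemma branch_mem (hF : Fixed α δ n w v s) (hα : 1 < α) (i : Option (Fin n)) {y : ℝ}
    (hy : y ∈ Ioo (-v / s) (1 / s)) : branch α w v s i y ∈ Ioo (-1 : ℝ) 1 := by
  have hv := hF.v_lt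
  cases i with
  | none =>
    have h := hF.iterate_mem hα n hy
    exact ⟨(neg_lt_neg hv).trans h.1, h.2⟩
  | some j =>
    have h := hF.iterate_mem hα j hy
    exact ⟨neg_lt_neg h.2, (neg_lt.1 h.1).trans hv⟩

lemma branch_inj (hF : Fixed α δ n w v s) (hα : 1 < α) (hδ : 0 < δ) (i j : Option (Fin n))
    (x : ℝ) (hx : x ∈ Ioo (-1 : ℝ) 1) (y : ℝ) (hy : y ∈ Ioo (-1 : ℝ) 1)
    (h : branch α w v s i x = branch α w v s j y) : i = j ∧ x = y := by
  have hinj : ∀ m : ℕ, (hf α w v)^[m] (s * x) = (hf α w v)^[m] (s * y) → x = y := fun m hm =>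
    (hF.strictMonoOn hα m).injOn (hF.Ioo_subset hδ hx) (hF.Ioo_subset hδ hy) hm
  have hne : ∀ (m : ℕ) {p q : ℝ}, p ∈ Ioo (-1 : ℝ) 1 → q ∈ Ioo (-1 : ℝ) 1 →
      (hf α w v)^[n] (s * p) ≠ -(hf α w v)^[m] (s * q) := fun m p q hp hq heq => by
    linarith [hF.lt_iterate hα hδ n hp, hF.le_iterate, hF.lt_iterate hα hδ m hq,
      hF.neg_le_iterate hα hδ m]
  rcases i with _ | i <;> rcases j with _ | j
  · exact ⟨rfl, hinj n h⟩
  · exact (hne j hx hy h).elim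
  · exact (hne i hy hx h.symm).elim
  · have h' : (hf α w v)^[(i : ℕ)] (s * x) = (hf α w v)^[(j : ℕ)] (s * y) := neg_injective h
    rcases lt_trichotomy i j with hij | rfl | hij
    · exact ((hF.iterate_lt_iterate hα hδ hij hx hy).ne h').elim
    · exact ⟨rfl, hinj _ h'⟩
    · exact ((hF.iterate_lt_iterate hα hδ hij hy hx).ne' h').elim

/-- The iterates contract the hyperbolic metric of `(-1, 1)`. -/
lemma iterate_contraction (hF : Fixed α δ n w v s) (hα : 1 < α) (hδ : 0 < δ) (j : ℕ) {y : ℝ}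
    (hy : y ∈ Ioo (-1 : ℝ) 1) : ∃ d, HasDerivAt (fun y => (hf α w v)^[j] (s * y)) d y ∧
      (1 / (1 - (hf α w v)^[j] (s * y)) + 1 / (1 + (hf α w v)^[j] (s * y))) * |d| ≤
        1 / (1 + δ - y) + 1 / (1 + δ + y) := by
  have hS := hF.weight.sc_iterate hα hF.v_pos hF.v_lt.le hF.s_pos j
  have hcont : Continuous fun y =>
      (√s)⁻¹ * ∏ i ∈ Finset.range j, hW α w v ((hf α w v)^[i] (s * y)) := by
    refine continuous_const.mul (continuous_finsetProd _ fun i _ => ?_)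
    have hh : Continuous (hW α w v) := continuous_const.mul
      (((hF.weight.continuous_hf hα).rpow_const fun _ => Or.inr (by linarith)).mul
        (hF.weight.cont.comp continuous_neg))
    exact hh.comp (hF.weight.continuous_iterate hα i)
  have hyI := hF.Ioo_subset hδ hy
  have hp := hS.pos y hyI
  refine ⟨_, hS.deriv y hyI, ?_⟩
  have := hS.hyperbolic (hS.concaveOn hcont.continuousOn) (hF.Icc_subset hδ)
    (fun x hx => ⟨by linarith [(hF.iterate_mem hα j hx).1, hF.v_lt], (hF.iterate_mem hα j hx).2⟩)
    (y := y) ⟨by linarith [hy.1], by linarith [hy.2]⟩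
  rw [abs_of_pos (by positivity), ← div_eq_mul_inv, div_le_iff₀ (by positivity)]
  linarith

lemma log_RW (hF : Fixed α δ n w v s) (hα : 1 < α) {y : ℝ} (hy : y ∈ Ioo (-v / s) (1 / s)) :
    Real.log (RW α w v s n y) =
      (∑ j ∈ Finset.range n, (α - 1) / 2 * Real.log ((hf α w v)^[j + 1] (s * y))) +
      ∑ i : Option (Fin n), Real.log (w (branch α w v s i y)) := by
  have hw := hF.weight
  have hpos : ∀ j, 0 < (hf α w v)^[j + 1] (s * y) := fun j =>
    (hw.mapsTo_iterate hα hF.v_pos j (mapsTo_mul_left hF.s_pos hy)).1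
  have hpp := fun j => Real.rpow_pos_of_pos (hpos j) ((α - 1) / 2)
  rw [RW, Real.log_mul (hw.pos _).ne'
    (Finset.prod_ne_zero_iff.2 fun j _ => (mul_pos (hpp j) (hw.pos _)).ne'),
    Real.log_prod fun j _ => (mul_pos (hpp j) (hw.pos _)).ne', Fintype.sum_option]
  simp only [branch]
  rw [Finset.sum_congr rfl fun j _ => Real.log_mul (hpp j).ne' (hw.pos _).ne',
    Finset.sum_add_distrib, Fin.sum_univ_eq_sum_range
      (fun j => Real.log (w (-(hf α w v)^[j] (s * y)))) n,
    Finset.sum_congr rfl fun j _ => Real.log_rpow (hpos j) _]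
  ring

/-- The weight of a fixed point is continuously differentiable up to the boundary. -/
theorem exists_hasDerivAt (hF : Fixed α δ n w v s) (hα : 1 < α) (hδ : 0 < δ) :
    ∃ W W' : ℝ → ℝ, (∀ y ∈ Icc (-1 : ℝ) 1, W y = w y) ∧
      (∀ y ∈ Icc (-1 : ℝ) 1, HasDerivAt W (W' y) y) ∧ ContinuousOn W' (Icc (-1) 1) := by
  have hw := hF.weight
  have hv := hF.v_pos
  have hv1 := hF.v_lt.le
  have hs := hF.s_pos
  have hIcc : Icc (-1) 1 ⊆ Ioo (-v / s) (1 / s) :=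
    (Icc_subset_Icc (by linarith) (by linarith)).trans (hF.Icc_subset hδ)
  have hc := hw.concaveOn_RW hα hv hv1 hs n
  have h0 : 0 < RW α w v s n 0 := hw.RW_pos hα hv hv1 hs n (hIcc ⟨by norm_num, by norm_num⟩)
  set W : ℝ → ℝ := fun y => RW α w v s n y / RW α w v s n 0 with hW
  have hWc : ConcaveOn ℝ (Ioo (-v / s) (1 / s)) W := by
    refine (hc.smul (inv_nonneg.2 h0.le)).congr fun y _ => ?_
    simp only [hW, smul_eq_mul]
    ring
  have hWpos : ∀ y ∈ Ioo (-v / s) (1 / s), 0 < W y := fun y hy =>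
    div_pos (hw.RW_pos hα hv hv1 hs n hy) h0
  have hWw : ∀ y ∈ Icc (-1 : ℝ) 1, W y = w y := fun y hy => by
    simp only [hW]
    rw [hF.RW_eq y hy, mul_div_cancel_left₀ _ h0.ne']
  have hit : ∀ j : ℕ, ∀ y ∈ Ioo (-v / s) (1 / s),
      DifferentiableAt ℝ (fun y => (hf α w v)^[j] (s * y)) y := fun j y hy =>
    ((hw.sc_iterate hα hv hv1 hs j).deriv y hy).differentiableAt
  have hit_pos : ∀ j : ℕ, ∀ y ∈ Ioo (-v / s) (1 / s), 0 < (hf α w v)^[j + 1] (s * y) :=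
    fun j y hy => (hw.mapsTo_iterate hα hv j (mapsTo_mul_left hs hy)).1
  have hbr : ∀ (i : Option (Fin n)), ∀ y ∈ Ioo (-1 : ℝ) 1, ∃ d,
      HasDerivAt (branch α w v s i) d y ∧
      (1 / (1 - branch α w v s i y) + 1 / (1 + branch α w v s i y)) * |d| ≤
        1 / (1 + δ - y) + 1 / (1 + δ + y) := fun i y hy => by
    cases i with
    | none => exact hF.iterate_contraction hα hδ n hy
    | some j =>
      obtain ⟨d, hd, hle⟩ := hF.iterate_contraction hα hδ j hy
      refine ⟨-d, hd.neg, ?_⟩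
      simp only [branch]
      rw [abs_neg, sub_neg_eq_add, ← sub_eq_add_neg, add_comm (1 / (1 + _))]
      exact hle
  choose! dz hdz hcon using hbr
  have hdiff : ∀ y ∈ Ioo (-1 : ℝ) 1, DifferentiableAt ℝ w y := fun y hy => by
    have : DifferentiableAt ℝ W y := by
      refine differentiableAt_of_log_eq (A := 1 + δ) (z := branch α w v s (n := n)) (dz := dz)
        (D := fun y => (∑ j ∈ Finset.range n, (α - 1) / 2 *
          Real.log ((hf α w v)^[j + 1] (s * y))) - Real.log (RW α w v s n 0))
        hIcc hWc hWpos (by linarith) hdz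
        (fun i y hy => hF.branch_mem hα i (hF.Ioo_subset hδ hy)) (fun i => ?_)
        (hF.branch_inj hα hδ) hcon (fun y hy => ?_) (fun y hy => ?_) hy
      · have hm : ∀ j, Monotone fun y => (hf α w v)^[j] (s * y) := fun j a b hab =>
          hw.monotone_iterate hα hv j (mul_le_mul_of_nonneg_left hab hs.le)
        cases i with
        | none => exact Or.inl (hm n)
        | some j => exact Or.inr (hm j).neg
      · refine DifferentiableAt.sub_const (DifferentiableAt.fun_sum fun j _ => ?_) _
        have hyI := hF.Ioo_subset hδ hy
        exact ((hit (j + 1) y hyI).log (hit_pos j y hyI).ne').const_mul _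
      · have hyI := hF.Ioo_subset hδ hy
        simp only [hW]
        rw [Real.log_div (hw.RW_pos hα hv hv1 hs n hyI).ne' h0.ne', hF.log_RW hα hyI]
        have : ∀ i : Option (Fin n), RW α w v s n (branch α w v s i y) / RW α w v s n 0 =
            w (branch α w v s i y) := fun i =>
          hWw _ (Ioo_subset_Icc_self (hF.branch_mem hα i hyI))
        simp only [this]
        ring
    refine this.congr_of_eventuallyEq ?_
    filter_upwards [Ioo_mem_nhds hy.1 hy.2] with x hx using (hWw x (Ioo_subset_Icc_self hx)).symm
  have hWd : ∀ y ∈ Ioo (-v / s) (1 / s), DifferentiableAt ℝ W y := fun y hy => by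
    refine DifferentiableAt.div_const ?_ _
    have h1 : ∀ j : ℕ, DifferentiableAt ℝ w ((hf α w v)^[j] (s * y)) := fun j => by
      have := hF.iterate_mem hα j hy
      exact hdiff _ ⟨by linarith [this.1], this.2⟩
    have h2 : ∀ j : ℕ, DifferentiableAt ℝ w (-(hf α w v)^[j] (s * y)) := fun j => by
      have := hF.iterate_mem hα j hy
      exact hdiff _ ⟨by linarith [this.2], by linarith [this.1]⟩
    refine DifferentiableAt.mul ((h1 n).comp y (hit n y hy))
      (DifferentiableAt.fun_finsetProd fun j _ => DifferentiableAt.mul ?_ ?_)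
    · exact (hit (j + 1) y hy).rpow_const (Or.inl (hit_pos j y hy).ne')
    · exact (h2 j).comp y (hit j y hy).neg
  exact ⟨W, deriv W, hWw, fun y hy => (hWd y (hIcc hy)).hasDerivAt,
    (continuousOn_deriv_of_concaveOn hWc hWd).mono hIcc⟩

end Fixed
end Renorm

namespace Renorm

open Set Topology

/-- The increasing affine image of `Pf w` fixing `-1` and `1`. -/
noncomputable def Nf (w : ℝ → ℝ) (y : ℝ) : ℝ :=
  -1 + (Pf w y - Pf w (-1)) / ((Pf w 1 - Pf w (-1)) / 2)

section
variable {w : ℝ → ℝ} {α v : ℝ}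

lemma Weight.scale_pos (hw : Weight w) : 0 < (Pf w 1 - Pf w (-1)) / 2 :=
  half_pos (hw.den_pos one_pos)

lemma Weight.strictMono_Nf (hw : Weight w) : StrictMono (Nf w) := fun x y hxy => by
  have := hw.scale_pos
  have := hw.strictMono_Pf hxy
  unfold Nf
  gcongr

lemma Nf_neg_one : Nf w (-1) = -1 := by simp [Nf]

lemma Weight.Nf_one (hw : Weight w) : Nf w 1 = 1 := by
  have := (hw.den_pos one_pos).ne'
  unfold Nf
  field_simp
  norm_num

lemma Weight.hasStrictDerivAt_Nf (hw : Weight w) (y : ℝ) :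
    HasStrictDerivAt (Nf w) (((w y) ^ 2)⁻¹ / ((Pf w 1 - Pf w (-1)) / 2)) y := by
  refine hasStrictDerivAt_of_hasDerivAt_of_continuousAt (Filter.Eventually.of_forall fun y =>
    (((hw.hasDerivAt_Pf y).sub_const _).div_const _).const_add _) ?_
  exact ((hw.cont.continuousAt.pow 2).inv₀ (pow_pos (hw.pos y) 2).ne').div_const _

lemma Weight.surjOn_Nf (hw : Weight w) : SurjOn (Nf w) (Icc (-1) 1) (Icc (-1) 1) := by
  have h := intermediate_value_Icc (by norm_num : (-1 : ℝ) ≤ 1)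
    (f := Nf w) fun y _ => (hw.hasStrictDerivAt_Nf y).hasDerivAt.continuousAt.continuousWithinAt
  rwa [Nf_neg_one, hw.Nf_one] at h

lemma Weight.invFun_Nf (hw : Weight w) (y : ℝ) : Function.invFun (Nf w) (Nf w y) = y :=
  Function.leftInverse_invFun hw.strictMono_Nf.injective y

/-- The inverse of `Nf w` is a diffeomorphism as soon as `w` is continuously differentiable. -/
lemma Weight.isDiffeo (hw : Weight w) {W W' : ℝ → ℝ} (hWw : ∀ y ∈ Icc (-1 : ℝ) 1, W y = w y)
    (hW : ∀ y ∈ Icc (-1 : ℝ) 1, HasDerivAt W (W' y) y) (hW' : ContinuousOn W' (Icc (-1) 1)) :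
    ∃ d1 d2, IsDiffeo (Function.invFun (Nf w)) d1 d2 := by
  set φ := Function.invFun (Nf w)
  set κ := (Pf w 1 - Pf w (-1)) / 2 with hκ
  have hκ0 : 0 < κ := hw.scale_pos
  have hφN : ∀ y, φ (Nf w y) = y := hw.invFun_Nf
  have hm : MapsTo φ (Icc (-1) 1) (Icc (-1) 1) := fun x hx => by
    obtain ⟨y, hy, rfl⟩ := hw.surjOn_Nf hx
    rwa [hφN]
  have hN : MapsTo (Nf w) (Icc (-1) 1) (Icc (-1) 1) := fun y hy => by
    have h1 := hw.strictMono_Nf.monotone hy.1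
    have h2 := hw.strictMono_Nf.monotone hy.2
    rw [Nf_neg_one] at h1
    rw [hw.Nf_one] at h2
    exact ⟨h1, h2⟩
  have hd : ∀ x ∈ Icc (-1 : ℝ) 1, HasDerivAt φ (κ * W (φ x) ^ 2) x := fun x hx => by
    obtain ⟨y, hy, rfl⟩ := hw.surjOn_Nf hx
    have hp := hw.pos y
    have h := (hw.hasStrictDerivAt_Nf y).to_local_left_inverse (by positivity)
      (Filter.Eventually.of_forall hφN)
    rw [hφN, hWw y hy]
    refine h.hasDerivAt.congr_deriv ?_
    rw [inv_div, div_inv_eq_mul]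
  have hφc : ContinuousOn φ (Icc (-1) 1) := fun x hx => (hd x hx).continuousAt.continuousWithinAt
  have hWc : ContinuousOn W (Icc (-1) 1) := fun x hx => (hW x hx).continuousAt.continuousWithinAt
  refine ⟨fun x => κ * W (φ x) ^ 2, fun x => κ * (2 * W (φ x) * (W' (φ x) * (κ * W (φ x) ^ 2))),
    ⟨hm, ?_, ?_⟩, ?_, ?_, fun x hx => (hd x hx).hasDerivWithinAt, fun x hx => ?_, ?_,
    fun x hx => ?_⟩
  · intro x hx y hy hxy
    obtain ⟨a, -, rfl⟩ := hw.surjOn_Nf hx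
    obtain ⟨b, -, rfl⟩ := hw.surjOn_Nf hy
    rw [hφN, hφN] at hxy
    rw [hxy]
  · exact fun y hy => ⟨Nf w y, hN hy, hφN y⟩
  · simpa only [Nf_neg_one] using hφN (-1)
  · simpa only [hw.Nf_one] using hφN 1
  · have h := (((hW _ (hm hx)).comp x (hd x hx)).pow 2).const_mul κ
    refine (h.congr_deriv ?_).hasDerivWithinAt
    simp
  · have hWφ := hWc.comp hφc hm
    exact continuousOn_const.mul ((continuousOn_const.mul hWφ).mul
      ((hW'.comp hφc hm).mul (continuousOn_const.mul (hWφ.pow 2))))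
  · have := hw.pos (φ x)
    simp only [hWw _ (hm hx)]
    positivity

/-- The unimodal map with diffeomorphic part the inverse of `Nf w` and value `v` at `0`. -/
lemma Weight.exists_isUnimodal (hw : Weight w) {W W' : ℝ → ℝ}
    (hWw : ∀ y ∈ Icc (-1 : ℝ) 1, W y = w y)
    (hW : ∀ y ∈ Icc (-1 : ℝ) 1, HasDerivAt W (W' y) y) (hW' : ContinuousOn W' (Icc (-1) 1))
    (hα : 1 < α) (hv : 0 < v) (hv1 : v ≤ 1) :
    ∃ f, IsUnimodal α f ∧ ∀ x ∈ Icc (-1 : ℝ) 1, f x ∈ Icc (-1) 1 ∧ Uf w v (f x) = |x| ^ α := by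
  obtain ⟨d1, d2, hφ⟩ := hw.isDiffeo hWw hW hW'
  have hN1 : -1 < Nf w v := by simpa only [Nf_neg_one] using hw.strictMono_Nf (by linarith : -1 < v)
  have hN2 : Nf w v ≤ 1 := by simpa only [hw.Nf_one] using hw.strictMono_Nf.monotone hv1
  set t := (1 + Nf w v) / 2 with ht
  refine ⟨fun x => Function.invFun (Nf w) (foldMap α t x),
    ⟨_, d1, d2, t, ⟨by linarith, by linarith⟩, hφ, fun x => rfl⟩, fun x hx => ?_⟩
  have hx1 : |x| ^ α ≤ 1 := Real.rpow_le_one (abs_nonneg x) (abs_le.2 hx) (by linarith)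
  have hx0 : 0 ≤ |x| ^ α := Real.rpow_nonneg (abs_nonneg x) _
  have hq : foldMap α t x ∈ Icc (-1 : ℝ) 1 := by
    unfold foldMap
    constructor <;> nlinarith
  obtain ⟨y, hy, hyq⟩ := hw.surjOn_Nf hq
  dsimp only
  rw [← hyq, hw.invFun_Nf]
  refine ⟨hy, ?_⟩
  have hD := hw.den_pos hv
  have hκ := (hw.den_pos one_pos).ne'
  rw [Uf, div_eq_iff hD.ne']
  simp only [foldMap, ht, Nf] at hyq
  field_simp at hyq
  linarith

end
end Renorm

namespace Renorm

open Set Topology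

namespace Fixed

variable {α δ v s : ℝ} {n : ℕ} {w f : ℝ → ℝ}

lemma map_neg (hF : Fixed α δ n w v s)
    (hf : ∀ x ∈ Icc (-1 : ℝ) 1, f x ∈ Icc (-1) 1 ∧ Uf w v (f x) = |x| ^ α)
    {x : ℝ} (hx : x ∈ Icc (-1 : ℝ) 1) : f (-x) = f x := by
  apply (hF.weight.strictAnti_Uf hF.v_pos).injective
  rw [(hf x hx).2, (hf (-x) ⟨by linarith [hx.2], by linarith [hx.1]⟩).2, abs_neg]

lemma map_hf (hF : Fixed α δ n w v s) (hα : 1 < α)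
    (hf : ∀ x ∈ Icc (-1 : ℝ) 1, f x ∈ Icc (-1) 1 ∧ Uf w v (f x) = |x| ^ α)
    {x : ℝ} (hx : x ∈ Icc (-v) 1) : f (Renorm.hf α w v x) = -x := by
  have h := hF.weight.hf_mapsTo_Icc hα hF.v_pos hx.2
  apply (hF.weight.strictAnti_Uf hF.v_pos).injective
  rw [(hf _ ⟨by linarith [h.1], h.2⟩).2, abs_of_nonneg h.1,
    hF.weight.hf_rpow hα hF.v_pos hx.1]

lemma iterate_iterate (hF : Fixed α δ n w v s) (hα : 1 < α)
    (hf : ∀ x ∈ Icc (-1 : ℝ) 1, f x ∈ Icc (-1) 1 ∧ Uf w v (f x) = |x| ^ α)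
    (j m : ℕ) {z : ℝ} (hz : z ∈ Icc (-v) 1) :
    f^[j + 1] ((Renorm.hf α w v)^[m + (j + 1)] z) = -(Renorm.hf α w v)^[m] z := by
  have hmem := fun i => hF.weight.iterate_mem hα hF.v_pos i hz
  induction j with
  | zero =>
    change f ((Renorm.hf α w v)^[m + 1] z) = _
    rw [Function.iterate_succ_apply', hF.map_hf hα hf (hmem m)]
  | succ j ih =>
    have hm := hmem (m + (j + 1))
    rw [← ih, Function.iterate_succ_apply, ← add_assoc m,
      Function.iterate_succ_apply' (Renorm.hf α w v),
      hF.map_hf hα hf hm, Function.iterate_succ_apply, Function.iterate_succ_apply,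
      hF.map_neg hf ⟨by linarith [hm.1, hF.v_lt], hm.2⟩]

lemma map_mul (hF : Fixed α δ n w v s)
    (hf : ∀ x ∈ Icc (-1 : ℝ) 1, f x ∈ Icc (-1) 1 ∧ Uf w v (f x) = |x| ^ α)
    (hδ : 0 < δ) {x : ℝ} (hx : x ∈ Icc (-1 : ℝ) 1) :
    f (s * x) = (Renorm.hf α w v)^[n] (s * f x) := by
  have hs := hF.s_pos
  have hs1 : s < 1 := (hF.s_lt hδ).trans hF.v_lt
  apply (hF.weight.strictAnti_Uf hF.v_pos).injective
  rw [hF.Uf_iterate _ (hf x hx).1, (hf x hx).2, (hf (s * x) ⟨by nlinarith [hx.1, hx.2],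
    by nlinarith [hx.1, hx.2]⟩).2, abs_mul, abs_of_pos hs,
    Real.mul_rpow hs.le (abs_nonneg x)]

lemma mul_mem (hF : Fixed α δ n w v s)
    (hf : ∀ x ∈ Icc (-1 : ℝ) 1, f x ∈ Icc (-1) 1 ∧ Uf w v (f x) = |x| ^ α)
    (hδ : 0 < δ) {x : ℝ} (hx : x ∈ Icc (-1 : ℝ) 1) : s * f x ∈ Icc (-s) s ∧
    s * f x ∈ Icc (-v) 1 := by
  have hs := hF.s_pos
  have hsv := hF.s_lt hδ
  have hv := hF.v_lt
  have h := (hf x hx).1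
  have h1 : -s ≤ s * f x := by nlinarith [h.1]
  have h2 : s * f x ≤ s := by nlinarith [h.2]
  exact ⟨⟨h1, h2⟩, by linarith, by linarith⟩

lemma iterate_mul (hF : Fixed α δ n w v s) (hα : 1 < α)
    (hf : ∀ x ∈ Icc (-1 : ℝ) 1, f x ∈ Icc (-1) 1 ∧ Uf w v (f x) = |x| ^ α)
    (hδ : 0 < δ) {j m : ℕ} (hjm : m + (j + 1) = n) {x : ℝ}
    (hx : x ∈ Icc (-1 : ℝ) 1) : f^[j + 2] (s * x) = -(Renorm.hf α w v)^[m] (s * f x) := by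
  rw [Function.iterate_succ_apply, hF.map_mul hf hδ hx, ← hjm,
    hF.iterate_iterate hα hf j m (hF.mul_mem hf hδ hx).2]

lemma interior_disjoint {A B : Set ℝ} {c : ℝ} (hA : ∀ x ∈ A, x ≤ c) (hB : ∀ x ∈ B, c ≤ x) :
    Disjoint (interior A) (interior B) := by
  have h1 : interior A ⊆ Iio c := interior_Iic (a := c) ▸ interior_mono hA
  have h2 : interior B ⊆ Ioi c := interior_Ici (a := c) ▸ interior_mono hB
  exact ((Iic_disjoint_Ioi le_rfl).mono_left Iio_subset_Iic_self).mono h1 h2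

/-- Position of the intervals of the cycle different from the one around the critical value. -/
lemma exists_image_mem (hF : Fixed α δ n w v s) (hα : 1 < α) (hδ : 0 < δ)
    (hf : ∀ x ∈ Icc (-1 : ℝ) 1, f x ∈ Icc (-1) 1 ∧ Uf w v (f x) = |x| ^ α) {i : ℕ} (hi : i ≤ n)
    (hi1 : i ≠ 1) {y : ℝ} (hy : y ∈ f^[i] '' Icc (-s) s) :
    y ∈ Icc (-(Renorm.hf α w v)^[if i = 0 then 0 else n + 1 - i] s)
      (-(Renorm.hf α w v)^[if i = 0 then 0 else n + 1 - i] (-s)) := by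
  have hs := hF.s_pos
  obtain ⟨x, hx, rfl⟩ := hy
  obtain _ | _ | j := i
  · simpa using hx
  · exact (hi1 rfl).elim
  obtain ⟨x, rfl⟩ : ∃ x', x = s * x' := ⟨x / s, by field_simp⟩
  have hx' : x ∈ Icc (-1 : ℝ) 1 := ⟨by nlinarith [hx.1], by nlinarith [hx.2]⟩
  have hm := (hF.mul_mem hf hδ hx').1
  have hmon := hF.weight.monotone_iterate hα hF.v_pos (n + 1 - (j + 2))
  rw [if_neg (by omega), hF.iterate_mul hα hf hδ (m := n + 1 - (j + 2)) (by omega) hx']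
  exact ⟨neg_le_neg (hmon hm.2), neg_le_neg (hmon hm.1)⟩

lemma le_of_mem_image_one (hF : Fixed α δ n w v s) (hα : 1 < α) (hδ : 0 < δ)
    (hf : ∀ x ∈ Icc (-1 : ℝ) 1, f x ∈ Icc (-1) 1 ∧ Uf w v (f x) = |x| ^ α)
    {y : ℝ} (hy : y ∈ f^[1] '' Icc (-s) s) : s ≤ y := by
  have hs := hF.s_pos
  obtain ⟨x, hx, rfl⟩ := hy
  obtain ⟨x, rfl⟩ : ∃ x', x = s * x' := ⟨x / s, by field_simp⟩
  have hx' : x ∈ Icc (-1 : ℝ) 1 := ⟨by nlinarith [hx.1], by nlinarith [hx.2]⟩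
  rw [Function.iterate_one, hF.map_mul hf hδ hx']
  exact hF.le_iterate.trans
    (hF.weight.monotone_iterate hα hF.v_pos n (hF.mul_mem hf hδ hx').1.1)

lemma disjoint_images (hF : Fixed α δ n w v s) (hα : 1 < α) (hδ : 0 < δ)
    (hf : ∀ x ∈ Icc (-1 : ℝ) 1, f x ∈ Icc (-1) 1 ∧ Uf w v (f x) = |x| ^ α) {i j : ℕ}
    (hi : i ≤ n) (hj : j ≤ n) (hij : i ≠ j) :
    Disjoint (interior (f^[i] '' Icc (-s) s)) (interior (f^[j] '' Icc (-s) s)) := by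
  have hle : ∀ {i : ℕ}, i ≤ n → i ≠ 1 → ∀ y ∈ f^[i] '' Icc (-s) s, y ≤ s := fun hi hi1 y hy =>
    (hF.exists_image_mem hα hδ hf hi hi1 hy).2.trans (neg_le.1 (hF.neg_le_iterate hα hδ _))
  rcases eq_or_ne i 1 with rfl | hi1
  · exact (interior_disjoint (hle hj hij.symm) fun y => hF.le_of_mem_image_one hα hδ hf).symm
  rcases eq_or_ne j 1 with rfl | hj1
  · exact interior_disjoint (hle hi hi1) fun y => hF.le_of_mem_image_one hα hδ hf
  have hI := fun y => hF.exists_image_mem hα hδ hf hi hi1 (y := y)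
  have hJ := fun y => hF.exists_image_mem hα hδ hf hj hj1 (y := y)
  have hne : (if i = 0 then 0 else n + 1 - i) ≠ if j = 0 then 0 else n + 1 - j := by
    split_ifs <;> omega
  rcases lt_or_gt_of_ne hne with h | h
  · exact (interior_disjoint (fun y hy => (hJ y hy).2) fun y hy =>
      (neg_le_neg (hF.iterate_le_iterate hα hδ h)).trans (hI y hy).1).symm
  · exact interior_disjoint (fun y hy => (hI y hy).2) fun y hy =>
      (neg_le_neg (hF.iterate_le_iterate hα hδ h)).trans (hJ y hy).1

end Fixed

theorem exists_renormalization_fixedPoint {α : ℝ} (hα : 1 < α) {n : ℕ} (hn : n ≠ 0) :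
    ∃ f : ℝ → ℝ, IsUnimodal α f ∧ ∃ s ∈ Ioo (0 : ℝ) 1,
      (∀ i j, i ≤ n → j ≤ n → i ≠ j →
        Disjoint (interior (f^[i] '' Icc (-s) s)) (interior (f^[j] '' Icc (-s) s))) ∧
      f^[n + 1] '' Icc (-s) s ⊆ Icc (-s) s ∧
      ∀ x ∈ Icc (-1 : ℝ) 1, f^[n + 1] (s * x) = -(s * f x) := by
  obtain ⟨w, v, s, hF⟩ := exists_fixed hα hn rfl
  have hδ : 0 < 1 / (20 * α) := by positivity
  obtain ⟨W, W', hWw, hW, hW'⟩ := hF.exists_hasDerivAt hα hδ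
  obtain ⟨f, hfu, hf⟩ := hF.weight.exists_isUnimodal hWw hW hW' hα hF.v_pos hF.v_lt.le
  have hs := hF.s_pos
  obtain ⟨m, rfl⟩ := Nat.exists_eq_succ_of_ne_zero hn
  have hret : ∀ x ∈ Icc (-1 : ℝ) 1, f^[m + 2] (s * x) = -(s * f x) := fun x hx =>
    hF.iterate_mul hα hf hδ (j := m) (m := 0) (Nat.zero_add _) hx
  refine ⟨f, hfu, s, ⟨hs, (hF.s_lt hδ).trans hF.v_lt⟩,
    fun i j hi hj hij => hF.disjoint_images hα hδ hf hi hj hij, ?_, hret⟩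
  rintro _ ⟨x, hx, rfl⟩
  obtain ⟨x, rfl⟩ : ∃ x', x = s * x' := ⟨x / s, by field_simp⟩
  have hx' : x ∈ Icc (-1 : ℝ) 1 := ⟨by nlinarith [hx.1], by nlinarith [hx.2]⟩
  have hm := (hF.mul_mem hf hδ hx').1
  change f^[m + 2] (s * x) ∈ _
  rw [hret x hx']
  exact ⟨neg_le_neg hm.2, neg_le.1 hm.1⟩

end Renorm

/-- For every critical exponent `α > 1` and every `k ≥ 2` the renormalization operator with
period-`k` combinatorics has a fixed point: there are a unimodal map `f`, `s ∈ (0,1)` and a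
sign `ε ∈ {-1,1}` such that the intervals `f^i([-s,s])`, `0 ≤ i ≤ k-1`, have pairwise
disjoint interiors, `f^k([-s,s]) ⊆ [-s,s]`, and `ε f^k(ε s x)/s = f x` on `[-1,1]`. -/
theorem renormalization_period_k_fixed_point (α : ℝ) (hα : 1 < α) (k : ℕ) (hk : 2 ≤ k) :
    ∃ f : ℝ → ℝ, IsUnimodal α f ∧
      ∃ s ∈ Set.Ioo (0 : ℝ) 1, ∃ ε : ℝ, (ε = -1 ∨ ε = 1) ∧
        (∀ i j, i ≤ k - 1 → j ≤ k - 1 → i ≠ j →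
          Disjoint (interior (f^[i] '' Set.Icc (-s) s))
                   (interior (f^[j] '' Set.Icc (-s) s))) ∧
        f^[k] '' Set.Icc (-s) s ⊆ Set.Icc (-s) s ∧
        ∀ x ∈ Set.Icc (-1 : ℝ) 1, ε * f^[k] (ε * s * x) / s = f x := by
  obtain ⟨n, rfl⟩ : ∃ n, k = n + 1 := ⟨k - 1, by omega⟩
  obtain ⟨f, hf, s, hs, hdisj, hsub, hret⟩ :=
    Renorm.exists_renormalization_fixedPoint hα (n := n) (by omega)
  have heven : ∀ x, f (-x) = f x := fun x => by
    obtain ⟨φ, d1, d2, t, -, -, h⟩ := hf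
    rw [h, h, foldMap, foldMap, abs_neg]
  refine ⟨f, hf, s, hs, -1, Or.inl rfl, hdisj, hsub, fun x hx => ?_⟩
  have h := hret (-x) ⟨by linarith [hx.2], by linarith [hx.1]⟩
  rw [heven] at h
  rw [show -1 * s * x = s * -x by ring, h]
  have := hs.1.ne'
  field_simp
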